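/- (Logvinenko–Sereda theorem on the torus, finitely many parallelepipeds) There is a universal constant c̃ ≥ 3 such that the following holds. Let d, n ≥ 1, L > 0, p ∈ [1,∞], and let f ∈ L^p(T^d_L) have Fourier coefficients supported in J_1 ∪ ... ∪ J_n, where each J_l ⊂ R^d is an axis-parallel parallelepiped with side lengths b_1,...,b_d. Let S ⊂ R^d be (γ,a)-thick with 0 < a_j ≤ 2πL for all j. Then ‖f‖_{L^p(T^d_L)} ≤ (c̃^d/γ)^{(c̃^d/γ)^n a·b + n - (p-1)/p} ‖f‖_{L^p(S ∩ T^d_L)}. -/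

import Mathlib

open MeasureTheory Real

/-- The trigonometric polynomial on `T^d_L` with Fourier coefficients `F` supported on `T`. -/
noncomputable def trigPoly {d : ℕ} (L : ℝ) (T : Finset (Fin d → ℤ)) (F : (Fin d → ℤ) → ℂ) :
    (Fin d → ℝ) → ℂ :=
  fun x => ∑ k ∈ T, F k * Complex.exp (Complex.I * ((∑ j, x j * (k j : ℝ) / L : ℝ) : ℂ))

/-- The fundamental domain `[0, 2πL]^d` of the torus `T^d_L`. -/
def torusCube (d : ℕ) (L : ℝ) : Set (Fin d → ℝ) :=
  Set.univ.pi fun _ : Fin d => Set.Icc (0 : ℝ) (2 * π * L)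

/-- The Cauchy transform `z ↦ ∑ 1 / (z - w)` of a finite multiset of points. -/
noncomputable def cauchySum (s : Multiset ℂ) (z : ℂ) : ℂ := (s.map fun w => (z - w)⁻¹).sum

lemma cauchySum_add (s t : Multiset ℂ) (z : ℂ) :
    cauchySum (s + t) z = cauchySum s z + cauchySum t z := by
  simp [cauchySum]

lemma norm_cauchySum_le {s : Multiset ℂ} {z : ℂ} {δ : ℝ} (hδ : 0 < δ)
    (h : ∀ w ∈ s, δ ≤ ‖z - w‖) : ‖cauchySum s z‖ ≤ s.card / δ := by
  induction s using Multiset.induction_on with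
  | empty => simp [cauchySum]
  | cons a s ih =>
    have h1 := ih fun w hw => h w (Multiset.mem_cons_of_mem hw)
    have h2 : ‖(z - a)⁻¹‖ ≤ 1 / δ := by
      rw [norm_inv, ← one_div]
      exact one_div_le_one_div_of_le hδ (h a (Multiset.mem_cons_self a s))
    have h3 : cauchySum (a ::ₘ s) z = (z - a)⁻¹ + cauchySum s z := by simp [cauchySum]
    rw [h3]
    refine (norm_add_le _ _).trans ?_
    have : ((a ::ₘ s).card : ℝ) / δ = 1 / δ + s.card / δ := by
      rw [Multiset.card_cons]; push_cast; ring
    rw [this]; exact add_le_add h2 h1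

lemma cauchySum_im_nonpos {s : Multiset ℂ} {z : ℂ} (hz : 0 < z.im) (h : ∀ w ∈ s, w.im ≤ 0) :
    (cauchySum s z).im ≤ 0 := by
  refine Multiset.sum_induction (fun w : ℂ => w.im ≤ 0) _ ?_ ?_ ?_
  · intro a b ha hb; simp only [Complex.add_im]; linarith
  · simp
  · intro a ha
    obtain ⟨w, hw, rfl⟩ := Multiset.mem_map.1 ha
    rw [Complex.inv_im]
    refine div_nonpos_of_nonpos_of_nonneg ?_ (Complex.normSq_nonneg _)
    have := h w hw
    simp only [Complex.sub_im]; linarith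

lemma differentiableAt_cauchySum {s : Multiset ℂ} {z : ℂ} (h : ∀ w ∈ s, z ≠ w) :
    DifferentiableAt ℂ (cauchySum s) z := by
  induction s using Multiset.induction_on with
  | empty =>
    have : cauchySum 0 = fun _ => 0 := by ext; simp [cauchySum]
    rw [this]; fun_prop
  | cons a s ih =>
    have h3 : cauchySum (a ::ₘ s) = fun z => (z - a)⁻¹ + cauchySum s z := by
      ext; simp [cauchySum]
    rw [h3]
    have h1 := ih fun w hw => h w (Multiset.mem_cons_of_mem hw)
    have h2 : z - a ≠ 0 := sub_ne_zero.2 (h a (Multiset.mem_cons_self a s))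
    fun_prop (disch := assumption)

lemma norm_sub_I_mul_sq (w : ℂ) (y : ℝ) :
    ‖w - Complex.I * y‖ ^ 2 = ‖w‖ ^ 2 - 2 * y * w.im + y ^ 2 := by
  rw [Complex.sq_norm, Complex.sq_norm, Complex.normSq_apply, Complex.normSq_apply]
  simp; ring

lemma le_norm_sub_I_mul {w : ℂ} {y : ℝ} (hy : 0 < y) (hw : w.im ≤ 0) :
    y ≤ ‖w - Complex.I * y‖ := by
  have h := norm_sub_I_mul_sq w y
  refine le_of_sq_le_sq ?_ (norm_nonneg _)
  nlinarith [sq_nonneg ‖w‖, mul_nonneg hy.le (neg_nonneg.2 hw)]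

lemma re_div_sub_I_mul {w : ℂ} {y : ℝ} :
    (w / (w - Complex.I * y)).re = (‖w‖ ^ 2 - y * w.im) / ‖w - Complex.I * y‖ ^ 2 := by
  rw [Complex.div_re, Complex.sq_norm, Complex.sq_norm, ← add_div]
  congr 1
  rw [Complex.normSq_apply]; simp; ring

lemma re_div_sub_I_mul_nonneg {w : ℂ} {y : ℝ} (hy : 0 < y) (hw : w.im ≤ 0) :
    0 ≤ (w / (w - Complex.I * y)).re := by
  rw [re_div_sub_I_mul]
  have := mul_nonneg hy.le (neg_nonneg.2 hw)
  refine div_nonneg ?_ (sq_nonneg _)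
  nlinarith [sq_nonneg ‖w‖]

lemma half_le_re_div_sub_I_mul {w : ℂ} {y : ℝ} (hy : 0 < y) (hw : w.im ≤ 0) (h : y ≤ ‖w‖) :
    1 / 2 ≤ (w / (w - Complex.I * y)).re := by
  rw [re_div_sub_I_mul]
  have h1 := le_norm_sub_I_mul hy hw
  have h0 : 0 < ‖w - Complex.I * y‖ ^ 2 := by have := hy.trans_le h1; positivity
  rw [le_div_iff₀ h0, norm_sub_I_mul_sq]
  nlinarith [mul_nonneg hy.le (neg_nonneg.2 hw)]

lemma volume_cauchySum_shift_le {s : Multiset ℂ} (hs : ∀ w ∈ s, w.im ≤ 0 ∧ ‖w‖ ≤ 6)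
    {y ε : ℝ} (hy : 0 < y) (hε : 0 < ε) (hε1 : ε < 12) :
    volume (Set.Ioc (-12 : ℝ) 12 ∩ {t | y ≤ ‖cauchySum s (t + ε * Complex.I)‖}) ≤
      ENNReal.ofReal (16 * s.card / y) := by
  set φ : ℂ → ℂ := fun z => cauchySum s z / (cauchySum s z - Complex.I * y) with hφ
  have him : ∀ z : ℂ, 0 < z.im → (cauchySum s z).im ≤ 0 := fun z hz =>
    cauchySum_im_nonpos hz fun w hw => (hs w hw).1
  have hdiff : ∀ z : ℂ, 0 < z.im → DifferentiableAt ℂ φ z := by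
    intro z hz
    have h1 : DifferentiableAt ℂ (cauchySum s) z := differentiableAt_cauchySum fun w hw h => by
      have := (hs w hw).1; rw [← h] at this; linarith
    have h2 : cauchySum s z - Complex.I * y ≠ 0 := by
      have := le_norm_sub_I_mul hy (him z hz)
      intro h; rw [h, norm_zero] at this; linarith
    exact h1.div (h1.sub_const _) h2
  have hbound : ∀ z : ℂ, 0 < z.im → (∀ w ∈ s, 6 ≤ ‖z - w‖) → ‖φ z‖ ≤ s.card / (6 * y) := by
    intro z hz hw
    have h1 := norm_cauchySum_le (by norm_num : (0 : ℝ) < 6) hw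
    have h2 := le_norm_sub_I_mul hy (him z hz)
    simp only [hφ, norm_div]
    calc _ ≤ (s.card / 6 : ℝ) / y := by gcongr
      _ = _ := by field_simp
  have hrect := Complex.integral_boundary_rect_eq_zero_of_differentiableOn φ
    (-12 + ε * Complex.I) (12 + 12 * Complex.I) (by
      intro z hz
      refine (hdiff z ?_).differentiableWithinAt
      have : z.im ∈ Set.uIcc ε 12 := by simpa using hz.2
      rw [Set.uIcc_of_le hε1.le] at this
      linarith [this.1])
  simp only [Complex.add_re, Complex.neg_re, Complex.re_ofNat, Complex.mul_re, Complex.ofReal_re,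
    Complex.I_re, mul_zero, Complex.ofReal_im, Complex.I_im, mul_one, sub_self, add_zero,
    Complex.add_im, Complex.neg_im, Complex.im_ofNat, neg_zero, Complex.mul_im, zero_add] at hrect
  set K : ℝ := s.card / (6 * y) with hK
  have hK0 : 0 ≤ K := by positivity
  have htop : ‖∫ x : ℝ in (-12 : ℝ)..12, φ (x + (12 : ℝ) * Complex.I)‖ ≤ K * 24 := by
    have := intervalIntegral.norm_integral_le_of_norm_le_const (a := -12) (b := 12) (C := K)
      (f := fun x : ℝ => φ (x + (12 : ℝ) * Complex.I)) (fun x _ => hbound _ (by simp) fun w hw => by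
        refine le_trans ?_ (Complex.abs_im_le_norm _)
        have := (hs w hw).1
        simp only [Complex.sub_im, Complex.add_im, Complex.ofReal_im, Complex.mul_im,
          Complex.ofReal_re, Complex.I_im, Complex.I_re]
        refine le_trans ?_ (le_abs_self _); linarith)
    norm_num at this ⊢; exact this
  have hside : ∀ x : ℝ, |x| = 12 →
      ‖Complex.I • ∫ u : ℝ in ε..12, φ (x + u * Complex.I)‖ ≤ K * 12 := by
    intro x hx
    rw [norm_smul, Complex.norm_I, one_mul]
    have := intervalIntegral.norm_integral_le_of_norm_le_const (a := ε) (b := 12) (C := K)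
      (f := fun u : ℝ => φ (x + u * Complex.I)) (fun u hu => hbound _ (by
          rw [Set.uIoc_of_le hε1.le] at hu
          simp; linarith [hu.1]) fun w hw => by
        refine le_trans ?_ (Complex.abs_re_le_norm _)
        have h1 := (Complex.abs_re_le_norm w).trans (hs w hw).2
        simp only [Complex.sub_re, Complex.add_re, Complex.ofReal_re, Complex.mul_re,
          Complex.ofReal_im, Complex.I_im, Complex.I_re]
        have h2 := abs_sub_abs_le_abs_sub x w.re
        have h3 : x + (u * 0 - 0 * 1) - w.re = x - w.re := by ring
        rw [h3]; linarith)
    refine this.trans ?_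
    rw [abs_of_pos (by linarith)]
    gcongr; linarith
  have hbot : ‖∫ x : ℝ in (-12 : ℝ)..12, φ (x + ε * Complex.I)‖ ≤ K * 48 := by
    have e1 := hside 12 (by norm_num)
    have e2 := hside (-12) (by norm_num)
    push_cast at e1 e2 htop hrect
    have : (∫ x : ℝ in (-12 : ℝ)..12, φ (x + ε * Complex.I)) =
        (∫ x : ℝ in (-12 : ℝ)..12, φ (x + 12 * Complex.I))
          - (Complex.I • ∫ u : ℝ in ε..12, φ (12 + u * Complex.I))
          + Complex.I • ∫ u : ℝ in ε..12, φ (-12 + u * Complex.I) := by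
      linear_combination hrect
    rw [this]
    refine (norm_add_le _ _).trans ?_
    have := norm_sub_le (∫ x : ℝ in (-12 : ℝ)..12, φ (x + 12 * Complex.I))
      (Complex.I • ∫ u : ℝ in ε..12, φ (12 + u * Complex.I))
    linarith
  have hcont : Continuous fun x : ℝ => φ (x + ε * Complex.I) := by
    rw [continuous_iff_continuousAt]
    intro x
    exact ContinuousAt.comp (f := fun x : ℝ => (x : ℂ) + ε * Complex.I) (g := φ)
      (hdiff _ (by simpa using hε)).continuousAt (by fun_prop)
  have hre : ∫ x : ℝ in (-12 : ℝ)..12, (φ (x + ε * Complex.I)).re ≤ K * 48 := by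
    have h1 := Complex.reCLM.intervalIntegral_comp_comm
      (hcont.intervalIntegrable (μ := volume) (-12) 12)
    simp only [Complex.reCLM_apply] at h1
    rw [h1]
    exact (Complex.re_le_norm _).trans hbot
  rw [intervalIntegral.integral_of_le (by norm_num)] at hre
  have hnn : ∀ x : ℝ, 0 ≤ (φ (x + ε * Complex.I)).re := fun x =>
    re_div_sub_I_mul_nonneg hy (him _ (by simpa using hε))
  have hmarkov := mul_meas_ge_le_integral_of_nonneg (μ := volume.restrict (Set.Ioc (-12 : ℝ) 12))
    (f := fun x : ℝ => (φ (x + ε * Complex.I)).re) (Filter.Eventually.of_forall hnn)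
    ((Complex.continuous_re.comp hcont).continuousOn.integrableOn_Icc.mono_set
      Set.Ioc_subset_Icc_self) (1 / 2)
  have hsub : Set.Ioc (-12 : ℝ) 12 ∩ {t | y ≤ ‖cauchySum s (t + ε * Complex.I)‖} ⊆
      {x : ℝ | 1 / 2 ≤ (φ (x + ε * Complex.I)).re} ∩ Set.Ioc (-12 : ℝ) 12 := fun t ht =>
    ⟨half_le_re_div_sub_I_mul hy (him _ (by simpa using hε)) ht.2, ht.1⟩
  refine (measure_mono hsub).trans ?_
  have hmeas : MeasurableSet {x : ℝ | 1 / 2 ≤ (φ (x + ε * Complex.I)).re} :=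
    (isClosed_le continuous_const (Complex.continuous_re.comp hcont)).measurableSet
  rw [← Measure.restrict_apply hmeas, ← ofReal_measureReal]
  refine ENNReal.ofReal_le_ofReal ?_
  have : 16 * (s.card : ℝ) / y = 2 * (K * 48) := by rw [hK]; field_simp; ring
  rw [this]; linarith

lemma volume_cauchySum_lower_le {s : Multiset ℂ} (hs : ∀ w ∈ s, w.im ≤ 0 ∧ ‖w‖ ≤ 6)
    {y : ℝ} (hy : 0 < y) :
    volume (Set.Icc (0 : ℝ) 2 ∩ {t | y < ‖cauchySum s t‖}) ≤ ENNReal.ofReal (16 * s.card / y) := by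
  set ε : ℕ → ℝ := fun n => 1 / ((n : ℝ) + 1) with hε
  have hεlim : Filter.Tendsto ε Filter.atTop (nhds 0) := tendsto_one_div_add_atTop_nhds_zero_nat
  set A : ℕ → Set ℝ := fun N => ⋂ n ≥ N,
    (Set.Ioc (-12 : ℝ) 12 ∩ {t : ℝ | y ≤ ‖cauchySum s (t + ε n * Complex.I)‖}) with hA
  have hmono : Monotone A := by
    intro M N hMN t ht
    simp only [hA, Set.mem_iInter] at ht ⊢
    exact fun n hn => ht n (hMN.trans hn)
  have hAle : ∀ N, volume (A N) ≤ ENNReal.ofReal (16 * s.card / y) := fun N =>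
    (measure_mono (Set.biInter_subset_of_mem (le_refl N))).trans
      (volume_cauchySum_shift_le hs hy (by positivity) (by
        have : ε N ≤ 1 := by
          rw [hε]; exact div_le_one_of_le₀ (by simp) (by positivity)
        linarith))
  have hU : volume (⋃ N, A N) ≤ ENNReal.ofReal (16 * s.card / y) :=
    le_of_tendsto' (tendsto_measure_iUnion_atTop hmono) hAle
  have hfin : volume ((fun w : ℂ => w.re) '' {w | w ∈ s}) = 0 := by
    refine Set.Finite.measure_zero (Set.Finite.image _ ?_) _
    exact Multiset.finite_toSet s
  have hsub : Set.Icc (0 : ℝ) 2 ∩ {t | y < ‖cauchySum s t‖} ⊆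
      (⋃ N, A N) ∪ (fun w : ℂ => w.re) '' {w | w ∈ s} := by
    intro t ht
    by_cases hmem : t ∈ (fun w : ℂ => w.re) '' {w | w ∈ s}
    · exact Or.inr hmem
    left
    have hne : ∀ w ∈ s, (t : ℂ) ≠ w := fun w hw h => hmem ⟨w, hw, by simp [← h]⟩
    have hc : ContinuousAt (cauchySum s) (t : ℂ) := (differentiableAt_cauchySum hne).continuousAt
    have hlim : Filter.Tendsto (fun n => ‖cauchySum s (t + ε n * Complex.I)‖) Filter.atTop
        (nhds ‖cauchySum s t‖) := by
      refine (hc.norm.tendsto).comp ?_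
      have h1 : Filter.Tendsto (fun n => (t : ℂ) + ε n * Complex.I) Filter.atTop
          (nhds ((t : ℂ) + ((0 : ℝ) : ℂ) * Complex.I)) :=
        tendsto_const_nhds.add (((Complex.continuous_ofReal.tendsto 0).comp hεlim).mul_const _)
      simpa using h1
    obtain ⟨N, hN⟩ := Filter.eventually_atTop.1 (hlim.eventually (lt_mem_nhds ht.2))
    refine Set.mem_iUnion.2 ⟨N, ?_⟩
    simp only [hA, Set.mem_iInter]
    exact fun n hn => ⟨⟨by linarith [ht.1.1], by linarith [ht.1.2]⟩, (hN n hn).le⟩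
  calc _ ≤ volume ((⋃ N, A N) ∪ (fun w : ℂ => w.re) '' {w | w ∈ s}) := measure_mono hsub
    _ ≤ volume (⋃ N, A N) + 0 := hfin ▸ measure_union_le _ _
    _ ≤ _ := by simpa using hU

lemma cauchySum_conj (s : Multiset ℂ) (t : ℝ) :
    cauchySum (s.map (starRingEnd ℂ)) t = starRingEnd ℂ (cauchySum s t) := by
  simp only [cauchySum, Multiset.map_map]
  rw [map_multiset_sum, Multiset.map_map]
  congr 1
  refine Multiset.map_congr rfl fun w _ => ?_
  simp

/-- Weak-type bound on `[0,2]` for the Cauchy transform of a finite multiset of points. -/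
lemma volume_cauchySum_le {s : Multiset ℂ} (hs : ∀ w ∈ s, ‖w‖ ≤ 6) {y : ℝ} (hy : 0 < y) :
    volume (Set.Icc (0 : ℝ) 2 ∩ {t | y < ‖cauchySum s t‖}) ≤ ENNReal.ofReal (32 * s.card / y) := by
  classical
  set s₁ := s.filter fun w => w.im ≤ 0 with hs₁
  set s₂ := s.filter fun w => ¬ w.im ≤ 0 with hs₂
  have hsum : s₁ + s₂ = s := Multiset.filter_add_not _ _
  have hcard : (s.card : ℝ) = s₁.card + s₂.card := by
    rw [← hsum, Multiset.card_add]; push_cast; ring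
  have h1 := volume_cauchySum_lower_le (s := s₁) (fun w hw => by
    rw [hs₁, Multiset.mem_filter] at hw; exact ⟨hw.2, hs w hw.1⟩) (half_pos hy)
  have h2 := volume_cauchySum_lower_le (s := s₂.map (starRingEnd ℂ)) (fun w hw => by
    obtain ⟨v, hv, rfl⟩ := Multiset.mem_map.1 hw
    rw [hs₂, Multiset.mem_filter] at hv
    refine ⟨?_, by simpa using hs v hv.1⟩
    simp only [Complex.conj_im]; linarith [not_le.1 hv.2]) (half_pos hy)
  simp only [cauchySum_conj, RCLike.norm_conj, Multiset.card_map] at h2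
  have hsub : Set.Icc (0 : ℝ) 2 ∩ {t | y < ‖cauchySum s t‖} ⊆
      (Set.Icc (0 : ℝ) 2 ∩ {t | y / 2 < ‖cauchySum s₁ t‖}) ∪
      (Set.Icc (0 : ℝ) 2 ∩ {t | y / 2 < ‖cauchySum s₂ t‖}) := by
    rintro t ⟨ht, hty⟩
    by_contra hcon
    simp only [Set.mem_union, Set.mem_inter_iff, ht, true_and, Set.mem_ofPred_eq, not_or,
      not_lt] at hcon hty
    rw [← hsum, cauchySum_add] at hty
    linarith [norm_add_le (cauchySum s₁ t) (cauchySum s₂ t)]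
  refine (measure_mono hsub).trans ((measure_union_le _ _).trans ((add_le_add h1 h2).trans ?_))
  rw [← ENNReal.ofReal_add (by positivity) (by positivity)]
  refine ENNReal.ofReal_le_ofReal (le_of_eq ?_)
  rw [hcard]; field_simp; ring

lemma norm_deriv_le_of_ne_zero {q : ℂ → ℂ} (hq : Differentiable ℂ q) {x₀ : ℂ} {M : ℝ} (hM : 0 < M)
    (h0 : ∀ z ∈ Metric.ball x₀ 4, q z ≠ 0)
    (hb : ∀ z ∈ Metric.ball x₀ 4, ‖q z‖ ≤ exp M * ‖q x₀‖) {z : ℂ} (hz : ‖z - x₀‖ ≤ 2) :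
    ‖deriv q z‖ ≤ 6 * M * ‖q z‖ := by
  have hq' : Differentiable ℂ (deriv q) := hq.deriv
  have hlog : DifferentiableOn ℂ (fun z => deriv q z / q z) (Metric.ball x₀ 4) :=
    hq'.differentiableOn.div hq.differentiableOn h0
  obtain ⟨G, hG0, hG⟩ := hlog.isExactOn_ball.with_val_at x₀ 0
  have hx₀ : x₀ ∈ Metric.ball x₀ 4 := by simp
  have hqx : q x₀ ≠ 0 := h0 _ hx₀
  have hexp : ∀ z ∈ Metric.ball x₀ 4, q z = q x₀ * Complex.exp (G z) := by
    have hder : ∀ z ∈ Metric.ball x₀ 4, HasDerivAt (fun z => q z * Complex.exp (-G z)) 0 z := by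
      intro z hz
      have := (hq z).hasDerivAt.mul ((hG z hz).neg.cexp)
      have e : deriv q z * Complex.exp (-G z) +
          q z * (Complex.exp (-G z) * -(deriv q z / q z)) = 0 := by
        field_simp [h0 z hz]; ring
      rw [← e]; exact this
    intro z hz
    have := (convex_ball x₀ (4 : ℝ)).is_const_of_fderivWithin_eq_zero (𝕜 := ℂ)
      (f := fun z => q z * Complex.exp (-G z))
      (fun w hw => (hder w hw).differentiableAt.differentiableWithinAt) (fun w hw => by
        rw [fderivWithin_of_isOpen Metric.isOpen_ball hw]
        have := (hder w hw).hasFDerivAt.fderiv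
        rw [this]; ext; simp) hz hx₀
    simp only [hG0, neg_zero, Complex.exp_zero, mul_one] at this
    rw [← this, mul_assoc, ← Complex.exp_add]; simp
  have hre : ∀ z ∈ Metric.ball x₀ 4, (G z).re ≤ M := by
    intro z hz
    have h1 := hb z hz
    rw [hexp z hz, norm_mul, Complex.norm_exp, mul_comm] at h1
    exact Real.exp_le_exp.1 (le_of_mul_le_mul_right h1 (norm_pos_iff.2 hqx))
  have hmap : ∀ u ∈ Metric.ball (0 : ℂ) 4, x₀ + u ∈ Metric.ball x₀ 4 := by
    intro u hu; simpa using hu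
  have hGb : ∀ w : ℂ, ‖w - x₀‖ ≤ 3 → ‖G w‖ ≤ 6 * M := by
    intro w hw
    have := Complex.borelCaratheodory_zero (f := fun u => G (x₀ + u)) (R := 4) (z := w - x₀) hM
      (fun u hu => by
        have := (hG _ (hmap u hu)).differentiableAt
        exact (this.comp u (f := fun u => x₀ + u) (by fun_prop)).differentiableWithinAt)
      (fun u hu => hre _ (hmap u hu)) (by norm_num) (by simp; linarith) (by simp [hG0])
    simp only [add_sub_cancel] at this
    refine this.trans ?_
    rw [div_le_iff₀ (by linarith)]
    nlinarith [norm_nonneg (w - x₀)]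
  have hsub : Metric.closedBall z 1 ⊆ Metric.ball x₀ 4 := by
    intro w hw
    have := norm_sub_le_norm_sub_add_norm_sub w z x₀
    rw [mem_closedBall_iff_norm] at hw; rw [mem_ball_iff_norm]; linarith
  have hzb : z ∈ Metric.ball x₀ 4 := hsub (by simp)
  have hd := Complex.norm_deriv_le_of_forall_mem_sphere_norm_le (c := z) (R := 1) (C := 6 * M)
    (f := G) (by norm_num) (by
      refine DifferentiableOn.diffContOnCl fun w hw => ?_
      rw [closure_ball _ (by norm_num)] at hw
      exact (hG w (hsub hw)).differentiableAt.differentiableWithinAt) (fun w hw => hGb w (by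
        have := norm_sub_le_norm_sub_add_norm_sub w z x₀
        rw [mem_sphere_iff_norm] at hw; linarith))
  rw [(hG z hzb).deriv, norm_div, div_one, div_le_iff₀ (norm_pos_iff.2 (h0 z hzb))] at hd
  exact hd

lemma pow_card_le_norm_prod {s : Multiset ℂ} {z : ℂ} {δ : ℝ} (hδ : 0 ≤ δ)
    (h : ∀ w ∈ s, δ ≤ ‖z - w‖) : δ ^ s.card ≤ ‖(s.map fun w => z - w).prod‖ := by
  induction s using Multiset.induction_on with
  | empty => simp
  | cons a s ih =>
    have h1 := ih fun w hw => h w (Multiset.mem_cons_of_mem hw)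
    have h2 := h a (Multiset.mem_cons_self a s)
    simp only [Multiset.card_cons, Multiset.map_cons, Multiset.prod_cons, norm_mul, pow_succ']
    gcongr

lemma norm_prod_le_pow_card {s : Multiset ℂ} {z : ℂ} {δ : ℝ} (hδ : 0 ≤ δ)
    (h : ∀ w ∈ s, ‖z - w‖ ≤ δ) : ‖(s.map fun w => z - w).prod‖ ≤ δ ^ s.card := by
  induction s using Multiset.induction_on with
  | empty => simp
  | cons a s ih =>
    have h1 := ih fun w hw => h w (Multiset.mem_cons_of_mem hw)
    have h2 := h a (Multiset.mem_cons_self a s)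
    simp only [Multiset.card_cons, Multiset.map_cons, Multiset.prod_cons, norm_mul, pow_succ']
    gcongr

lemma hasDerivAt_prod_sub {s : Multiset ℂ} {z : ℂ} (h : z ∉ s) :
    HasDerivAt (fun z => (s.map fun w => z - w).prod)
      ((s.map fun w => z - w).prod * cauchySum s z) z := by
  induction s using Multiset.induction_on with
  | empty => simpa [cauchySum] using hasDerivAt_const z (1 : ℂ)
  | cons a s ih =>
    simp only [Multiset.mem_cons, not_or] at h
    have h1 := ih h.2
    have h3 : cauchySum (a ::ₘ s) z = (z - a)⁻¹ + cauchySum s z := by simp [cauchySum]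
    simp only [Multiset.map_cons, Multiset.prod_cons, h3]
    have h2 : z - a ≠ 0 := sub_ne_zero.2 h.1
    have h4 := ((hasDerivAt_id z).sub_const a).mul h1
    have e : (z - a) * (s.map fun w => z - w).prod * ((z - a)⁻¹ + cauchySum s z) =
        1 * (s.map fun w => z - w).prod +
          (z - a) * ((s.map fun w => z - w).prod * cauchySum s z) := by
      field_simp
    rw [e]; exact h4

lemma norm_le_of_factorization {p q : ℂ → ℂ} (hq : Differentiable ℂ q) {x₀ : ℂ} {M : ℝ}
    (hb : ∀ z : ℂ, ‖z - x₀‖ ≤ 12 → ‖p z‖ ≤ exp M * ‖p x₀‖) {s : Multiset ℂ}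
    (hs : ∀ w ∈ s, ‖w - x₀‖ ≤ 4) (hp : ∀ z, p z = (s.map fun w => z - w).prod * q z)
    {z : ℂ} (hz : ‖z - x₀‖ ≤ 12) : ‖q z‖ * 2 ^ s.card ≤ exp M * ‖q x₀‖ := by
  have h1 : ‖p x₀‖ ≤ 4 ^ s.card * ‖q x₀‖ := by
    rw [hp, norm_mul]; gcongr
    exact norm_prod_le_pow_card (by norm_num) fun w hw => by rw [norm_sub_rev]; exact hs w hw
  have h2 : ∀ z ∈ Metric.sphere x₀ 12, ‖q z‖ ≤ exp M * ‖q x₀‖ / 2 ^ s.card := by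
    intro z hz
    rw [mem_sphere_iff_norm] at hz
    have e1 := hb z hz.le
    rw [hp, norm_mul] at e1
    have e2 : (8 : ℝ) ^ s.card ≤ ‖(s.map fun w => z - w).prod‖ :=
      pow_card_le_norm_prod (by norm_num) fun w hw => by
        have := norm_sub_le_norm_sub_add_norm_sub z w x₀
        have := hs w hw
        linarith
    have e3 : (8 : ℝ) ^ s.card * ‖q z‖ ≤ exp M * (4 ^ s.card * ‖q x₀‖) :=
      (mul_le_mul_of_nonneg_right e2 (norm_nonneg _)).trans
        (e1.trans (mul_le_mul_of_nonneg_left h1 (exp_pos M).le))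
    have e4 : (8 : ℝ) ^ s.card = 4 ^ s.card * 2 ^ s.card := by rw [← mul_pow]; norm_num
    rw [le_div_iff₀ (by positivity)]
    rw [e4] at e3
    refine le_of_mul_le_mul_left ?_ (by positivity : (0 : ℝ) < 4 ^ s.card)
    linarith
  rw [← le_div_iff₀ (by positivity)]
  refine Complex.norm_le_of_forall_mem_frontier_norm_le (U := Metric.ball x₀ 12)
    Metric.isBounded_ball hq.diffContOnCl (fun z hz => ?_) ?_
  · rw [frontier_ball _ (by norm_num)] at hz; exact h2 z hz
  · rw [closure_ball _ (by norm_num)]; exact mem_closedBall_iff_norm.2 hz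

lemma exists_factorization {p : ℂ → ℂ} (hp : Differentiable ℂ p) {x₀ : ℂ} (h0 : p x₀ ≠ 0) {M : ℝ}
    (hb : ∀ z : ℂ, ‖z - x₀‖ ≤ 12 → ‖p z‖ ≤ exp M * ‖p x₀‖) :
    ∃ (s : Multiset ℂ) (q : ℂ → ℂ), (∀ w ∈ s, ‖w - x₀‖ ≤ 4) ∧ Differentiable ℂ q ∧
      (∀ z, p z = (s.map fun w => z - w).prod * q z) ∧ (∀ z ∈ Metric.ball x₀ 4, q z ≠ 0) ∧
      (s.card : ℝ) * log 2 ≤ M := by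
  classical
  set P : ℕ → Prop := fun k => ∃ (s : Multiset ℂ) (q : ℂ → ℂ), s.card = k ∧
    (∀ w ∈ s, ‖w - x₀‖ ≤ 4) ∧ Differentiable ℂ q ∧
      (∀ z, p z = (s.map fun w => z - w).prod * q z) with hP
  have hbd : ∀ (s : Multiset ℂ) (q : ℂ → ℂ), (∀ w ∈ s, ‖w - x₀‖ ≤ 4) → Differentiable ℂ q →
      (∀ z, p z = (s.map fun w => z - w).prod * q z) → (s.card : ℝ) * log 2 ≤ M := by
    intro s q hs hq hpq
    have h1 := norm_le_of_factorization hq hb hs hpq (z := x₀) (by simp)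
    have h2 : q x₀ ≠ 0 := by
      intro h; apply h0; rw [hpq, h, mul_zero]
    rw [mul_comm] at h1
    have h3 := le_of_mul_le_mul_right h1 (norm_pos_iff.2 h2)
    have h4 := Real.log_le_log (by positivity) h3
    rwa [Real.log_pow, Real.log_exp] at h4
  have hPbd : ∀ k, P k → k ≤ ⌊M / log 2⌋₊ := by
    rintro k ⟨s, q, rfl, hs, hq, hpq⟩
    refine Nat.le_floor ?_
    rw [le_div_iff₀ (Real.log_pos (by norm_num))]
    exact hbd s q hs hq hpq
  have hP0 : P 0 := ⟨0, p, rfl, by simp, hp, by simp⟩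
  set k := Nat.findGreatest P ⌊M / log 2⌋₊ with hk
  obtain ⟨s, q, hsk, hs, hq, hpq⟩ : P k := Nat.findGreatest_spec (Nat.zero_le _) hP0
  refine ⟨s, q, hs, hq, hpq, ?_, hbd s q hs hq hpq⟩
  intro w hw hqw
  have hP1 : P (k + 1) := by
    refine ⟨w ::ₘ s, dslope q w, by simp [hsk], ?_, ?_, ?_⟩
    · intro v hv
      rcases Multiset.mem_cons.1 hv with rfl | hv
      · rw [mem_ball_iff_norm] at hw; exact hw.le
      · exact hs v hv
    · rw [← differentiableOn_univ] at hq ⊢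
      exact (Complex.differentiableOn_dslope Filter.univ_mem).2 hq
    · intro z
      have := sub_smul_dslope q w z
      rw [hqw, sub_zero, smul_eq_mul] at this
      rw [hpq, ← this]; simp only [Multiset.map_cons, Multiset.prod_cons]; ring
  have := Nat.le_findGreatest (hPbd _ hP1) hP1
  omega

/-- A weak type bound for the logarithmic derivative of an entire function with controlled
growth. -/
lemma volume_norm_deriv_gt_le {p : ℂ → ℂ} (hp : Differentiable ℂ p) {x₀ : ℂ} (h0 : p x₀ ≠ 0)
    (hx₀ : ‖x₀ - 1‖ ≤ 1) {M : ℝ} (hM : 0 < M)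
    (hb : ∀ z : ℂ, ‖z - x₀‖ ≤ 12 → ‖p z‖ ≤ exp M * ‖p x₀‖) {y : ℝ} (hy : 0 < y) :
    volume (Set.Icc (0 : ℝ) 2 ∩ {t | y * ‖p t‖ < ‖deriv p t‖}) ≤ ENNReal.ofReal (100 * M / y) := by
  rcases lt_or_ge y (12 * M) with hyM | hyM
  · refine (measure_mono Set.inter_subset_left).trans ?_
    rw [Real.volume_Icc]
    refine ENNReal.ofReal_le_ofReal ?_
    rw [le_div_iff₀ hy]; linarith
  obtain ⟨s, q, hs, hq, hpq, hq0, hcard⟩ := exists_factorization hp h0 hb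
  have hnear : ∀ t : ℝ, t ∈ Set.Icc (0 : ℝ) 2 → ‖(t : ℂ) - x₀‖ ≤ 2 := by
    intro t ht
    have h1 := norm_sub_le_norm_sub_add_norm_sub (t : ℂ) 1 x₀
    have h2 : ‖(t : ℂ) - 1‖ ≤ 1 := by
      rw [← Complex.ofReal_one, ← Complex.ofReal_sub, Complex.norm_real, Real.norm_eq_abs, abs_le]
      constructor <;> linarith [ht.1, ht.2]
    rw [norm_sub_rev] at hx₀; linarith
  have hs6 : ∀ w ∈ s, ‖w‖ ≤ 6 := by
    intro w hw
    have h1 := norm_add₃_le (a := w - x₀) (b := x₀ - 1) (c := 1)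
    have := hs w hw
    simp only [sub_add_sub_cancel, sub_add_cancel, norm_one] at h1
    linarith
  have hfin : volume ((fun w : ℂ => w.re) '' {w | w ∈ s}) = 0 :=
    Set.Finite.measure_zero (Set.Finite.image _ (Multiset.finite_toSet s)) _
  have hsub : Set.Icc (0 : ℝ) 2 ∩ {t | y * ‖p t‖ < ‖deriv p t‖} ⊆
      (Set.Icc (0 : ℝ) 2 ∩ {t | y / 2 < ‖cauchySum s t‖}) ∪ (fun w : ℂ => w.re) '' {w | w ∈ s} := by
    rintro t ⟨ht, hlt⟩
    by_cases hmem : (t : ℂ) ∈ s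
    · exact Or.inr ⟨t, hmem, by simp⟩
    refine Or.inl ⟨ht, ?_⟩
    by_contra hcon
    simp only [Set.mem_ofPred_eq, not_lt] at hcon hlt
    refine absurd hlt (not_lt.2 ?_)
    have hqd := norm_deriv_le_of_ne_zero hq hM hq0 (fun z hz => by
      rw [mem_ball_iff_norm] at hz
      have h1 := norm_le_of_factorization hq hb hs hpq (z := z) (by linarith)
      have h2 : (1 : ℝ) ≤ 2 ^ s.card := one_le_pow₀ (by norm_num)
      nlinarith [norm_nonneg (q z)]) (hnear t ht)
    have hder := (hasDerivAt_prod_sub hmem).mul (hq t).hasDerivAt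
    have hpe : p = fun z => (s.map fun w => z - w).prod * q z := funext hpq
    have hd : deriv p t = p t * cauchySum s t + (s.map fun w => (t : ℂ) - w).prod * deriv q t := by
      rw [hpe]; refine hder.deriv.trans ?_; ring
    rw [hd]
    refine (norm_add_le _ _).trans ?_
    rw [norm_mul, norm_mul]
    have e1 : ‖(s.map fun w => (t : ℂ) - w).prod‖ * ‖deriv q t‖ ≤ 6 * M * ‖p t‖ := by
      rw [hpq, norm_mul]
      nlinarith [norm_nonneg (s.map fun w => (t : ℂ) - w).prod]
    nlinarith [norm_nonneg (p t)]
  refine (measure_mono hsub).trans ((measure_union_le _ _).trans ?_)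
  rw [hfin, add_zero]
  refine (volume_cauchySum_le hs6 (by positivity : 0 < y / 2)).trans (ENNReal.ofReal_le_ofReal ?_)
  have hl := Real.log_two_gt_d9
  have : (s.card : ℝ) ≤ 3 / 2 * M := by nlinarith [(Nat.cast_nonneg s.card : (0 : ℝ) ≤ s.card)]
  rw [div_le_div_iff₀ (by positivity) hy]
  nlinarith

/-- Exponential polynomials with frequencies `ν c` of multiplicity at most `m c`. -/
def expPoly {ι : Type*} [Fintype ι] (ν : ι → ℝ) (m : ι → ℕ) : Set (ℂ → ℂ) :=
  {p | ∃ q : ι → Polynomial ℂ, (∀ c, q c ∈ Polynomial.degreeLT ℂ (m c)) ∧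
    p = fun z => ∑ c, (q c).eval z * Complex.exp (Complex.I * ν c * z)}

section expPoly

variable {ι : Type*} [Fintype ι] {ν : ι → ℝ} {m : ι → ℕ} {p : ℂ → ℂ}

lemma expPoly_differentiable (hp : p ∈ expPoly ν m) : Differentiable ℂ p := by
  obtain ⟨q, -, rfl⟩ := hp
  refine Differentiable.fun_sum fun c _ => ?_
  exact (q c).differentiable.mul (by fun_prop)

lemma expPoly_zero_mult (hp : p ∈ expPoly ν m) (hm : ∀ c, m c = 0) : p = 0 := by
  obtain ⟨q, hq, rfl⟩ := hp
  ext z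
  refine Finset.sum_eq_zero fun c _ => ?_
  have := hq c
  rw [hm c, Polynomial.mem_degreeLT] at this
  have : q c = 0 := by
    by_contra h
    rw [Polynomial.degree_eq_natDegree h] at this
    simp at this
  simp [this]

lemma expPoly_const_mul (hp : p ∈ expPoly ν m) (a : ℂ) : (fun z => a * p z) ∈ expPoly ν m := by
  obtain ⟨q, hq, rfl⟩ := hp
  refine ⟨fun c => Polynomial.C a * q c, fun c => ?_, ?_⟩
  · beta_reduce
    rw [← Polynomial.smul_eq_C_mul]; exact Submodule.smul_mem _ _ (hq c)
  · ext z; simp [Finset.mul_sum, mul_assoc]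

lemma expPoly_shift (hp : p ∈ expPoly ν m) (a : ℝ) :
    (fun z => Complex.exp (-(Complex.I * a * z)) * p z) ∈ expPoly (fun c => ν c - a) m := by
  obtain ⟨q, hq, rfl⟩ := hp
  refine ⟨q, hq, ?_⟩
  ext z
  rw [Finset.mul_sum]
  refine Finset.sum_congr rfl fun c _ => ?_
  rw [mul_left_comm, ← Complex.exp_add]
  congr 2; push_cast; ring

lemma derivative_mem_degreeLT {R : Type*} [Semiring R] {q : Polynomial R} {n : ℕ}
    (hq : q ∈ Polynomial.degreeLT R n) :
    Polynomial.derivative q ∈ Polynomial.degreeLT R (n - 1) := by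
  rw [Polynomial.mem_degreeLT, Polynomial.degree_lt_iff_coeff_zero] at *
  intro k hk
  rw [Polynomial.coeff_derivative, hq (k + 1) (by omega), zero_mul]

lemma expPoly_deriv [DecidableEq ι] (hp : p ∈ expPoly ν m) (c : ι) :
    (fun z => deriv p z - Complex.I * ν c * p z) ∈
      expPoly ν (Function.update m c (m c - 1)) := by
  obtain ⟨q, hq, rfl⟩ := hp
  refine ⟨fun e => Polynomial.derivative (q e) + Polynomial.C (Complex.I * (ν e - ν c)) * q e,
    fun e => ?_, ?_⟩
  · by_cases hec : e = c
    · subst hec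
      simpa using derivative_mem_degreeLT (hq e)
    · rw [Function.update_of_ne hec]
      refine Submodule.add_mem _ ?_ ?_
      · exact Polynomial.degreeLT_mono (Nat.sub_le _ _) (derivative_mem_degreeLT (hq e))
      · rw [← Polynomial.smul_eq_C_mul]; exact Submodule.smul_mem _ _ (hq e)
  · ext z
    have hd : HasDerivAt (fun z => ∑ e, (q e).eval z * Complex.exp (Complex.I * ν e * z))
        (∑ e, ((Polynomial.derivative (q e)).eval z * Complex.exp (Complex.I * ν e * z) +
          (q e).eval z * (Complex.exp (Complex.I * ν e * z) * (Complex.I * ν e)))) z := by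
      refine HasDerivAt.fun_sum fun e _ => ((q e).hasDerivAt z).mul ?_
      have := ((hasDerivAt_id z).const_mul (Complex.I * ν e)).cexp
      simpa using this
    rw [hd.deriv, Finset.mul_sum, ← Finset.sum_sub_distrib]
    refine Finset.sum_congr rfl fun e _ => ?_
    simp only [Polynomial.eval_add, Polynomial.eval_mul, Polynomial.eval_C]; ring

lemma sum_update_pred [DecidableEq ι] {c : ι} (hc : 0 < m c) :
    ∑ e, Function.update m c (m c - 1) e + 1 = ∑ e, m e := by
  rw [← Finset.add_sum_erase _ _ (Finset.mem_univ c),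
    ← Finset.add_sum_erase _ m (Finset.mem_univ c), Function.update_self]
  have : ∑ x ∈ Finset.univ.erase c, Function.update m c (m c - 1) x =
      ∑ x ∈ Finset.univ.erase c, m x := by
    refine Finset.sum_congr rfl fun x hx => ?_
    rw [Function.update_of_ne (Finset.ne_of_mem_erase hx)]
  rw [this]; omega

/-- Successively removing one unit of multiplicity. -/
lemma expPoly_exists_chain {K : ℂ} (hK : K ≠ 0) (N : ℕ) : ∀ {m : ι → ℕ} {p : ℂ → ℂ},
    p ∈ expPoly ν m → ∑ c, m c = N →
    ∃ (g : ℕ → ℂ → ℂ) (mm : ℕ → ι → ℕ) (τ : ℕ → ℝ), g 0 = p ∧ g N = 0 ∧ ∀ k < N,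
      g k ∈ expPoly ν (mm k) ∧ ∑ e, mm k e = N - k ∧ (∀ e, mm k e ≤ m e) ∧
      (∃ c, 0 < mm k c ∧ τ k = ν c) ∧
      ∀ z, deriv (g k) z - Complex.I * τ k * g k z = K * g (k + 1) z := by
  classical
  induction N with
  | zero =>
    intro m p hp hN
    have h0 : ∀ c, m c = 0 := fun c => (Finset.sum_eq_zero_iff.1 hN) c (Finset.mem_univ c)
    exact ⟨fun _ => p, fun _ => m, fun _ => 0, rfl, expPoly_zero_mult hp h0, by simp⟩
  | succ N ih =>
    intro m p hp hN
    obtain ⟨c, hc⟩ : ∃ c, 0 < m c := by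
      by_contra! h
      have : ∑ c, m c = 0 := Finset.sum_eq_zero fun c _ => by simpa using h c
      omega
    obtain ⟨g, mm, τ, hg0, hgN, hg⟩ := ih (expPoly_const_mul (expPoly_deriv hp c) K⁻¹)
      (by have := sum_update_pred hc; omega)
    refine ⟨fun k => Nat.casesOn k p g, fun k => Nat.casesOn k m mm, fun k => Nat.casesOn k (ν c) τ,
      rfl, hgN, ?_⟩
    intro k hk
    cases k with
    | zero =>
      refine ⟨hp, hN, fun e => le_rfl, ⟨c, hc, rfl⟩, fun z => ?_⟩
      simp only [hg0]
      rw [← mul_assoc, mul_inv_cancel₀ hK, one_mul]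
      rfl
    | succ k =>
      obtain ⟨h1, h2, h3, h4, h5⟩ := hg k (by omega)
      refine ⟨h1, by simpa using h2, fun e => (h3 e).trans ?_, h4, h5⟩
      by_cases hec : e = c
      · subst hec; simp
      · rw [Function.update_of_ne hec]

end expPoly

section chain

variable {g : ℕ → ℂ → ℂ} {τ : ℕ → ℝ} {N : ℕ} {K Λ : ℝ}

/-- Cauchy estimates along a chain. -/
lemma norm_chain_le (hg : ∀ k < N, Differentiable ℂ (g k)) (hN : g N = 0) (hK : N + Λ ≤ K)
    (hΛ : 0 ≤ Λ) (hτ : ∀ k < N, |τ k| ≤ Λ)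
    (h : ∀ k < N, ∀ z, deriv (g k) z - Complex.I * τ k * g k z = K * g (k + 1) z)
    {x : ℂ} {A : ℝ} (hA : ∀ z : ℂ, ‖z - x‖ ≤ 1 → ‖g 0 z‖ ≤ A) {k : ℕ} (hk : k ≤ N) :
    ‖g k x‖ ≤ A := by
  have hA0 : 0 ≤ A := (norm_nonneg _).trans (hA x (by simp))
  rcases Nat.eq_zero_or_pos N with h0 | hNpos
  · subst h0; obtain rfl : k = 0 := by omega
    exact hA x (by simp)
  have hN0 : (0 : ℝ) < N := by exact_mod_cast hNpos
  have key : ∀ k ≤ N, ∀ z : ℂ, ‖z - x‖ ≤ 1 - k / N → ‖g k z‖ ≤ A := by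
    intro k
    induction k with
    | zero => intro _ z hz; exact hA z (by simpa using hz)
    | succ k ih =>
      intro hk z hz
      have hz' : ∀ w : ℂ, ‖w - z‖ ≤ 1 / N → ‖g k w‖ ≤ A := by
        intro w hw
        refine ih (by omega) w ?_
        have h1 := norm_sub_le_norm_sub_add_norm_sub w z x
        push_cast at hz
        rw [add_div] at hz; linarith
      have hd := Complex.norm_deriv_le_of_forall_mem_sphere_norm_le (c := z) (R := 1 / N) (C := A)
        (f := g k) (by positivity) (hg k (by omega)).diffContOnCl (fun w hw => hz' w (by
          rw [mem_sphere_iff_norm] at hw; exact hw.le))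
      rw [div_div_eq_mul_div, div_one] at hd
      have e := h k (by omega) z
      have hK0 : 0 < K := by linarith
      have e2 : K * ‖g (k + 1) z‖ ≤ A * N + Λ * A := by
        have : ‖(K : ℂ) * g (k + 1) z‖ = K * ‖g (k + 1) z‖ := by
          rw [norm_mul, Complex.norm_real, Real.norm_of_nonneg hK0.le]
        rw [← this, ← e]
        refine (norm_sub_le _ _).trans (add_le_add hd ?_)
        rw [norm_mul, norm_mul, Complex.norm_I, Complex.norm_real, one_mul]
        have := hτ k (by omega)
        have h3 := hz' z (by simp)
        rw [Real.norm_eq_abs]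
        gcongr
      have e3 : K * ‖g (k + 1) z‖ ≤ K * A := by nlinarith
      exact le_of_mul_le_mul_left e3 hK0
  refine key k hk x ?_
  have : (k : ℝ) / N ≤ 1 := by rw [div_le_one hN0]; exact_mod_cast hk
  simpa using this

/-- Gronwall estimate along a chain. -/
lemma norm_chain_le_exp (hg : ∀ k < N, Differentiable ℂ (g k)) (hN : g N = 0) (hK : 0 ≤ K)
    (hτ : ∀ k < N, |τ k| ≤ Λ)
    (h : ∀ k < N, ∀ z, deriv (g k) z - Complex.I * τ k * g k z = K * g (k + 1) z)
    {x : ℂ} {B : ℝ} (hB0 : 0 ≤ B) (hB : ∀ k < N, ‖g k x‖ ≤ B) (hΛ : 0 ≤ Λ) {k : ℕ} (hk : k < N)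
    (z : ℂ) :
    ‖g k z‖ ≤ B * exp ((Λ + K) * ‖z - x‖) := by
  set f : ℝ → Fin N → ℂ := fun s j => g j (x + s * (z - x)) with hf
  set f' : ℝ → Fin N → ℂ := fun s j => deriv (g j) (x + s * (z - x)) * (z - x) with hf'
  have hder : ∀ s : ℝ, HasDerivAt f (f' s) s := by
    intro s
    refine hasDerivAt_pi.2 fun j => ?_
    have h1 : HasDerivAt (fun s : ℝ => x + (s : ℂ) * (z - x)) (z - x) s := by
      have := ((hasDerivAt_id (s : ℂ)).mul_const (z - x)).const_add x
      simpa using this.comp_ofReal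
    exact (hg j j.2 _).hasDerivAt.comp s h1
  have hbd : ∀ s : ℝ, ‖f' s‖ ≤ ((Λ + K) * ‖z - x‖) * ‖f s‖ + 0 := by
    intro s
    rw [add_zero, pi_norm_le_iff_of_nonneg (by positivity)]
    intro j
    have e := h j j.2 (x + s * (z - x))
    have e' : f' s j = (Complex.I * τ j * g j (x + s * (z - x)) +
        K * g (j + 1) (x + s * (z - x))) * (z - x) := by
      simp only [hf']; rw [← e]; ring
    have e1 : ‖g j (x + s * (z - x))‖ ≤ ‖f s‖ := norm_le_pi_norm (f s) j
    have e2 : ‖g (j + 1) (x + s * (z - x))‖ ≤ ‖f s‖ := by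
      rcases Nat.lt_or_ge (j + 1) N with hj | hj
      · exact norm_le_pi_norm (f s) ⟨j + 1, hj⟩
      · have : (j : ℕ) + 1 = N := by have := j.2; omega
        rw [this, hN]; simp
    rw [e', norm_mul, mul_right_comm (Λ + K)]
    gcongr
    refine (norm_add_le _ _).trans ?_
    rw [norm_mul, norm_mul, norm_mul, Complex.norm_I, one_mul, Complex.norm_real,
      Complex.norm_real, Real.norm_eq_abs, Real.norm_of_nonneg hK, add_mul]
    have := hτ j j.2
    gcongr
  have hgr := norm_le_gronwallBound_of_norm_deriv_right_le (f := f) (f' := f') (δ := B)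
    (K := (Λ + K) * ‖z - x‖) (ε := 0) (a := 0) (b := 1)
    (fun s _ => (hder s).continuousAt.continuousWithinAt)
    (fun s _ => (hder s).hasDerivWithinAt) (by
      rw [pi_norm_le_iff_of_nonneg hB0]; intro j; simpa [hf] using hB j j.2)
    (fun s _ => hbd s) 1 (by simp)
  rw [gronwallBound_ε0, sub_zero, mul_one] at hgr
  refine le_trans ?_ hgr
  have := norm_le_pi_norm (f 1) ⟨k, hk⟩
  simpa [hf] using this

end chain

section expPoly

variable {ι : Type*} [Fintype ι] {ν : ι → ℝ} {m : ι → ℕ} {p : ℂ → ℂ}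

lemma exists_chain_of_abs_le {Λ K : ℝ} {N : ℕ} (hK : 0 < K) (hp : p ∈ expPoly ν m)
    (hN : ∑ c, m c = N) (hν : ∀ c, 0 < m c → |ν c| ≤ Λ) :
    ∃ (g : ℕ → ℂ → ℂ) (τ : ℕ → ℝ), g 0 = p ∧ g N = 0 ∧ (∀ k < N, Differentiable ℂ (g k)) ∧
      (∀ k < N, |τ k| ≤ Λ) ∧
      ∀ k < N, ∀ z, deriv (g k) z - Complex.I * τ k * g k z = K * g (k + 1) z := by
  obtain ⟨g, mm, τ, h0, h1, h2⟩ := expPoly_exists_chain (by exact_mod_cast hK.ne' : (K : ℂ) ≠ 0)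
    N hp hN
  refine ⟨g, τ, h0, h1, fun k hk => expPoly_differentiable (h2 k hk).1, fun k hk => ?_,
    fun k hk => (h2 k hk).2.2.2.2⟩
  obtain ⟨-, -, h3, ⟨c, hc, h4⟩, -⟩ := h2 k hk
  rw [h4]; exact hν c (lt_of_lt_of_le hc (h3 c))

/-- Growth of an exponential polynomial away from its maximum on a unit disc. -/
lemma expPoly_norm_le {Λ : ℝ} (hΛ : 0 ≤ Λ) {N : ℕ} (hN1 : 0 < N) (hp : p ∈ expPoly ν m)
    (hN : ∑ c, m c = N) (hν : ∀ c, 0 < m c → |ν c| ≤ Λ) {x : ℂ} {A : ℝ}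
    (hA : ∀ z : ℂ, ‖z - x‖ ≤ 1 → ‖p z‖ ≤ A) (z : ℂ) :
    ‖p z‖ ≤ A * exp ((2 * Λ + N) * ‖z - x‖) := by
  have hN0 : (0 : ℝ) < N := by exact_mod_cast hN1
  obtain ⟨g, τ, rfl, hgN, hd, hτ, h⟩ := exists_chain_of_abs_le (K := N + Λ) (by positivity)
    hp hN hν
  have hA0 : 0 ≤ A := (norm_nonneg _).trans (hA x (by simp))
  have := norm_chain_le_exp hd hgN (by positivity : 0 ≤ N + Λ) hτ h hA0
    (fun k hk => norm_chain_le hd hgN le_rfl hΛ hτ h hA hk.le) hΛ hN1 z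
  refine this.trans_eq ?_
  congr 2; ring

lemma volume_expPoly_ratio_le {Λ : ℝ} (hΛ : 0 ≤ Λ) {N : ℕ} (hp : p ∈ expPoly ν m)
    (hN : ∑ c, m c = N) {c : ι} (hc : 0 < m c) (hν : ∀ e, 0 < m e → |ν e - ν c| ≤ Λ)
    {y : ℝ} (hy : 0 < y) :
    volume (Set.Icc (0 : ℝ) 2 ∩ {t | y * ‖p t‖ < ‖deriv p t - Complex.I * ν c * p t‖}) ≤
      ENNReal.ofReal (1300 * (2 * Λ + N) / y) := by
  have hN1 : 0 < N := by
    rw [← hN]; exact lt_of_lt_of_le hc (Finset.single_le_sum (fun _ _ => Nat.zero_le _)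
      (Finset.mem_univ c))
  have hN0 : (0 : ℝ) < N := by exact_mod_cast hN1
  set P : ℂ → ℂ := fun z => Complex.exp (-(Complex.I * ν c * z)) * p z with hPdef
  have hP : P ∈ expPoly (fun e => ν e - ν c) m := expPoly_shift hp (ν c)
  have hPd := expPoly_differentiable hP
  have hpd := expPoly_differentiable hp
  have hder : ∀ z, deriv P z = Complex.exp (-(Complex.I * ν c * z)) *
      (deriv p z - Complex.I * ν c * p z) := by
    intro z
    have h1 : HasDerivAt (fun z : ℂ => Complex.exp (-(Complex.I * ν c * z)))
        (Complex.exp (-(Complex.I * ν c * z)) * -(Complex.I * ν c)) z := by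
      simpa using ((hasDerivAt_id z).const_mul (Complex.I * ν c)).neg.cexp
    refine (h1.mul (hpd z).hasDerivAt).deriv.trans ?_; ring
  have hnorm : ∀ t : ℝ, ‖Complex.exp (-(Complex.I * ν c * t))‖ = 1 := by
    intro t; rw [Complex.norm_exp]; simp
  have hset : Set.Icc (0 : ℝ) 2 ∩ {t | y * ‖p t‖ < ‖deriv p t - Complex.I * ν c * p t‖} =
      Set.Icc (0 : ℝ) 2 ∩ {t | y * ‖P t‖ < ‖deriv P t‖} := by
    ext t; simp only [hPdef, Set.mem_inter_iff, Set.mem_ofPred_eq]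
    rw [hder, norm_mul, norm_mul, hnorm, one_mul, one_mul]
  rw [hset]
  obtain ⟨x₀, hx₀, hmax⟩ := (isCompact_closedBall (1 : ℂ) 1).exists_isMaxOn ⟨1, by simp⟩
    hPd.continuous.norm.continuousOn
  have hx₀' : ‖x₀ - 1‖ ≤ 1 := mem_closedBall_iff_norm.1 hx₀
  have hgrow := expPoly_norm_le hΛ hN1 hP hN hν (x := 1) (A := ‖P x₀‖) (fun z hz =>
    hmax (mem_closedBall_iff_norm.2 hz))
  by_cases h0 : P x₀ = 0
  · have : P = 0 := by
      ext z
      have := hgrow z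
      simpa [h0] using this
    have h2 : Set.Icc (0 : ℝ) 2 ∩ {t | y * ‖P t‖ < ‖deriv P t‖} = ∅ := by
      rw [this]; ext t; simp
    rw [h2]; simp
  · refine (volume_norm_deriv_gt_le hPd h0 hx₀' (M := 13 * (2 * Λ + N)) (by positivity)
      (fun z hz => ?_) hy).trans (ENNReal.ofReal_le_ofReal (le_of_eq (by ring)))
    refine (hgrow z).trans ?_
    rw [mul_comm]
    have := norm_sub_le_norm_sub_add_norm_sub z x₀ 1
    have h13 : ‖z - 1‖ ≤ 13 := by linarith
    have h14 : (2 * Λ + N) * ‖z - 1‖ ≤ 13 * (2 * Λ + N) := by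
      rw [mul_comm]; gcongr
    gcongr

end expPoly

section expPoly

variable {ι : Type*} [Fintype ι] {ν : ι → ℝ} {m : ι → ℕ} {p : ℂ → ℂ}

lemma volume_expPoly_ratio_le_const {Λ K : ℝ} (hΛ : 0 ≤ Λ) (hK : 0 < K) {N : ℕ}
    (hp : p ∈ expPoly ν m) (hN : ∑ c, m c = N) {c : ι} (hc : 0 < m c)
    (hν : ∀ e, 0 < m e → |ν e - ν c| ≤ Λ) (hKΛ : 2 * Λ + N ≤ 3 * K) {h : ℂ → ℂ}
    (hh : ∀ z, deriv p z - Complex.I * ν c * p z = K * h z) {y : ℝ} (hy : 0 < y) :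
    volume (Set.Icc (0 : ℝ) 2 ∩ {t | y * ‖p t‖ < ‖h t‖}) ≤ ENNReal.ofReal (3900 / y) := by
  have := volume_expPoly_ratio_le hΛ hp hN hc hν (y := K * y) (by positivity)
  have hset : Set.Icc (0 : ℝ) 2 ∩ {t | y * ‖p t‖ < ‖h t‖} =
      Set.Icc (0 : ℝ) 2 ∩ {t | K * y * ‖p t‖ < ‖deriv p t - Complex.I * ν c * p t‖} := by
    ext t
    simp only [Set.mem_inter_iff, Set.mem_ofPred_eq, hh, norm_mul, Complex.norm_real,
      Real.norm_of_nonneg hK.le]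
    rw [mul_assoc K y, mul_lt_mul_iff_right₀ hK]
  rw [hset]
  refine this.trans (ENNReal.ofReal_le_ofReal ?_)
  rw [div_le_div_iff₀ (by positivity) hy]
  nlinarith

/-- An exponential polynomial of order `N` is the start of a chain of functions with successive
ratios of weak type, one of which is large at every point. -/
lemma expPoly_exists_ratio_chain (N : ℕ) : ∀ {m : ι → ℕ} {p : ℂ → ℂ}, p ∈ expPoly ν m →
    ∑ c, m c = N + 1 → ∃ (g : ℕ → ℂ → ℂ) (B : ℝ), g 0 = p ∧ (∀ k ≤ N, Continuous (g k)) ∧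
      (∀ k < N, ∀ y > 0, volume (Set.Icc (0 : ℝ) 2 ∩ {t | y * ‖g k t‖ < ‖g (k + 1) t‖}) ≤
        ENNReal.ofReal (3900 / y)) ∧ 0 ≤ B ∧ (∀ t : ℝ, t ∈ Set.Icc (0 : ℝ) 2 → ‖p t‖ ≤ B) ∧
      ∀ t : ℝ, t ∈ Set.Icc (0 : ℝ) 2 → ∃ k ≤ N, B ≤ exp 12 ^ N * ‖g k t‖ := by
  classical
  induction N with
  | zero =>
    intro m p hp hN
    obtain ⟨c, hc⟩ : ∃ c, 0 < m c := by
      by_contra! h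
      have : ∑ c, m c = 0 := Finset.sum_eq_zero fun c _ => by simpa using h c
      omega
    have h0 : deriv p - (fun z => Complex.I * ν c * p z) = 0 := by
      have := expPoly_deriv hp c
      refine expPoly_zero_mult this fun e => ?_
      have h1 := sum_update_pred hc
      have h2 : ∑ e, Function.update m c (m c - 1) e = 0 := by omega
      exact Finset.sum_eq_zero_iff.1 h2 e (Finset.mem_univ e)
    have hd := expPoly_differentiable hp
    set P : ℝ → ℂ := fun t => Complex.exp (-(Complex.I * ν c * t)) * p t with hP
    have hder : ∀ t : ℝ, HasDerivAt P 0 t := by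
      intro t
      have h1 : HasDerivAt (fun z : ℂ => Complex.exp (-(Complex.I * ν c * z)))
          (Complex.exp (-(Complex.I * ν c * t)) * -(Complex.I * ν c)) (t : ℂ) := by
        simpa using ((hasDerivAt_id (t : ℂ)).const_mul (Complex.I * ν c)).neg.cexp
      have h2 := (h1.mul (hd t).hasDerivAt).comp_ofReal
      have h3 := congrFun h0 (t : ℂ)
      simp only [Pi.sub_apply, Pi.zero_apply, sub_eq_zero] at h3
      rw [h3] at h2
      have e : Complex.exp (-(Complex.I * ν c * t)) * -(Complex.I * ν c) * p t +
          Complex.exp (-(Complex.I * ν c * t)) * (Complex.I * ν c * p t) = 0 := by ring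
      rw [← e]; exact h2
    have hconst : ∀ t : ℝ, P t = P 0 := fun t =>
      is_const_of_deriv_eq_zero (fun t => (hder t).differentiableAt) (fun t => (hder t).deriv) t 0
    have hnorm : ∀ t : ℝ, ‖p t‖ = ‖P 0‖ := by
      intro t
      rw [← hconst t, hP, norm_mul, Complex.norm_exp]; simp
    exact ⟨fun _ => p, ‖P 0‖, rfl, fun k _ => hd.continuous, by simp, norm_nonneg _,
      fun t _ => (hnorm t).le, fun t _ => ⟨0, le_rfl, by simp [hnorm]⟩⟩
  | succ N ih =>
    intro m p hp hN
    have hd := expPoly_differentiable hp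
    set act : Finset (ι × ι) := Finset.univ.filter fun c => 0 < m c.1 ∧ 0 < m c.2 with hact
    obtain ⟨c, hc⟩ : ∃ c, 0 < m c := by
      by_contra! h
      have : ∑ c, m c = 0 := Finset.sum_eq_zero fun c _ => by simpa using h c
      omega
    obtain ⟨⟨c₁, c₂⟩, hmem, hmax⟩ := act.exists_max_image (fun c => ν c.2 - ν c.1)
      ⟨(c, c), by simp [hact, hc]⟩
    simp only [hact, Finset.mem_filter, Finset.mem_univ, true_and, Prod.forall] at hmem hmax
    obtain ⟨hc₁, hc₂⟩ := hmem
    set Λ : ℝ := ν c₂ - ν c₁ with hΛ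
    have hΛ0 : 0 ≤ Λ := by have := hmax c c ⟨hc, hc⟩; simpa using this
    have hspread : ∀ e e', 0 < m e → 0 < m e' → |ν e - ν e'| ≤ Λ := by
      intro e e' he he'
      rw [abs_le]
      exact ⟨by linarith [hmax e e' ⟨he, he'⟩], hmax e' e ⟨he', he⟩⟩
    rcases le_or_gt ((N : ℝ) + 2) Λ with hbig | hsmall
    · have hΛpos : 0 < Λ := by linarith [(Nat.cast_nonneg N : (0 : ℝ) ≤ N)]
      have hΛC : (Λ : ℂ) ≠ 0 := by exact_mod_cast hΛpos.ne'
      have step : ∀ e, 0 < m e → ∃ (h : ℂ → ℂ) (g : ℕ → ℂ → ℂ) (B : ℝ),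
          (∀ z, deriv p z - Complex.I * ν e * p z = Λ * h z) ∧
          g 0 = p ∧ (∀ k ≤ N + 1, Continuous (g k)) ∧
          (∀ k < N + 1, ∀ y > 0, volume (Set.Icc (0 : ℝ) 2 ∩ {t | y * ‖g k t‖ < ‖g (k + 1) t‖}) ≤
            ENNReal.ofReal (3900 / y)) ∧ 0 ≤ B ∧ (∀ t : ℝ, t ∈ Set.Icc (0 : ℝ) 2 → ‖h t‖ ≤ B) ∧
          ∀ t : ℝ, t ∈ Set.Icc (0 : ℝ) 2 → ∃ k ≤ N + 1, B ≤ exp 12 ^ N * ‖g k t‖ := by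
        intro e he
        obtain ⟨g, B, hg0, hgc, hgv, hB0, hB, hex⟩ := ih
          (expPoly_const_mul (expPoly_deriv hp e) (Λ : ℂ)⁻¹)
          (by have := sum_update_pred he; omega)
        have hh : ∀ z, deriv p z - Complex.I * ν e * p z = Λ * g 0 z := by
          intro z; rw [hg0, ← mul_assoc, mul_inv_cancel₀ hΛC, one_mul]
        refine ⟨g 0, fun k => Nat.casesOn k p g, B, hh, rfl, ?_, ?_, hB0,
          fun t ht => by rw [hg0]; exact hB t ht, fun t ht => ?_⟩
        · intro k hk
          cases k with
          | zero => exact hd.continuous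
          | succ k => exact hgc k (by omega)
        · intro k hk y hy
          cases k with
          | zero =>
            refine volume_expPoly_ratio_le_const hΛ0 hΛpos hp hN he (fun e' he' => hspread e' e he' he)
              ?_ hh hy
            push_cast; linarith
          | succ k => exact hgv k (by omega) y hy
        · obtain ⟨k, hk, hkB⟩ := hex t ht
          exact ⟨k + 1, by omega, hkB⟩
      obtain ⟨h₁, g₁, B₁, e₁, a₁, b₁, d₁, f₁, i₁, j₁⟩ := step c₁ hc₁
      obtain ⟨h₂, g₂, B₂, e₂, a₂, b₂, d₂, f₂, i₂, j₂⟩ := step c₂ hc₂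
      have hpB : ∀ t : ℝ, t ∈ Set.Icc (0 : ℝ) 2 → ‖p t‖ ≤ B₁ + B₂ := by
        intro t ht
        have : Complex.I * p t = h₁ t - h₂ t := by
          apply mul_left_cancel₀ hΛC
          rw [mul_sub, ← e₁, ← e₂, hΛ]; push_cast; ring
        have h3 : ‖p t‖ = ‖h₁ t - h₂ t‖ := by rw [← this, norm_mul, Complex.norm_I, one_mul]
        rw [h3]
        exact (norm_sub_le _ _).trans (add_le_add (i₁ t ht) (i₂ t ht))
      have h2 : (2 : ℝ) ≤ exp 12 := by
        have := Real.add_one_le_exp (12 : ℝ); linarith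
      rcases le_total B₁ B₂ with hle | hle
      · refine ⟨g₂, B₁ + B₂, a₂, b₂, d₂, by positivity, hpB, fun t ht => ?_⟩
        obtain ⟨k, hk, hkB⟩ := j₂ t ht
        refine ⟨k, hk, ?_⟩
        rw [pow_succ']
        nlinarith
      · refine ⟨g₁, B₁ + B₂, a₁, b₁, d₁, by positivity, hpB, fun t ht => ?_⟩
        obtain ⟨k, hk, hkB⟩ := j₁ t ht
        refine ⟨k, hk, ?_⟩
        rw [pow_succ']
        nlinarith
    · set K : ℝ := 2 * (N + 2) with hK
      have hK0 : 0 < K := by positivity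
      have hP := expPoly_shift hp (ν c₁)
      obtain ⟨g, mm, τ, hg0, hgN, hg⟩ := expPoly_exists_chain
        (by exact_mod_cast hK0.ne' : (K : ℂ) ≠ 0) (N + 2) hP hN
      have hgd : ∀ k < N + 2, Differentiable ℂ (g k) := fun k hk =>
        expPoly_differentiable (hg k hk).1
      have hnorm : ∀ t : ℝ, ‖g 0 t‖ = ‖p t‖ := by
        intro t; rw [hg0, norm_mul, Complex.norm_exp]; simp
      have hτ : ∀ k < N + 2, |τ k| ≤ Λ := by
        intro k hk
        obtain ⟨-, -, h3, ⟨e, he, h4⟩, -⟩ := hg k hk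
        rw [h4]; exact hspread e c₁ (he.trans_le (h3 e)) hc₁
      obtain ⟨x, hx, hxmax⟩ := (isCompact_Icc (a := (0 : ℝ)) (b := 2)).exists_isMaxOn ⟨0, by simp⟩
        (f := fun t : ℝ => ‖p t‖) (hd.continuous.norm.comp Complex.continuous_ofReal).continuousOn
      refine ⟨fun k => if k = 0 then p else g k, ‖p x‖, by simp, ?_, ?_, norm_nonneg _,
        fun t ht => hxmax ht, fun t ht => ?_⟩
      · intro k hk
        by_cases hk0 : k = 0
        · simpa [hk0] using hd.continuous
        · simpa [hk0] using (hgd k (by omega)).continuous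
      · intro k hk y hy
        have hn : ∀ t : ℝ, ‖(if k = 0 then p else g k) t‖ = ‖g k t‖ := by
          intro t
          by_cases hk0 : k = 0
          · simp [hk0, hnorm]
          · simp [hk0]
        simp only [hn, Nat.add_eq_zero_iff, one_ne_zero, and_false, if_false]
        obtain ⟨h1, h2, h3, ⟨e, he, h4⟩, h5⟩ := hg k (by omega)
        refine volume_expPoly_ratio_le_const hΛ0 hK0 h1 h2 he (fun e' he' => ?_) ?_
          (fun z => by rw [← h5, h4]) hy
        · have := hspread e' e (he'.trans_le (h3 e')) (he.trans_le (h3 e))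
          simpa using this
        · rw [Nat.cast_sub (by omega)]; push_cast
          have : (0 : ℝ) ≤ k := Nat.cast_nonneg k
          linarith
      · obtain ⟨k, hk, hkmax⟩ := (Finset.range (N + 2)).exists_max_image (fun k => ‖g k t‖)
          ⟨0, by simp⟩
        rw [Finset.mem_range] at hk
        refine ⟨k, by omega, ?_⟩
        have := norm_chain_le_exp hgd hgN hK0.le hτ (fun k hk => (hg k hk).2.2.2.2)
          (norm_nonneg (g k t)) (fun j hj => hkmax j (Finset.mem_range.2 hj)) hΛ0
          (Nat.succ_pos _) (x : ℂ)
        rw [hnorm] at this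
        have hn : ‖(if k = 0 then p else g k) t‖ = ‖g k t‖ := by
          by_cases hk0 : k = 0
          · simp [hk0, hnorm]
          · simp [hk0]
        rw [hn, ← Real.exp_nat_mul, mul_comm]
        refine this.trans (mul_le_mul_of_nonneg_left (Real.exp_le_exp.2 ?_) (norm_nonneg _))
        have h1 : ‖(x : ℂ) - t‖ ≤ 2 := by
          rw [← Complex.ofReal_sub, Complex.norm_real, Real.norm_eq_abs, abs_le]
          constructor <;> linarith [ht.1, ht.2, hx.1, hx.2]
        have h2 : Λ + K ≤ 3 * (N + 2) := by rw [hK]; linarith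
        push_cast
        have h3 : (0 : ℝ) ≤ N := Nat.cast_nonneg N
        have h4 : (Λ + K) * ‖(x : ℂ) - t‖ ≤ 3 * (N + 2) * 2 := by gcongr
        linarith

end expPoly

lemma lintegral_le_of_meas_lt_le {α : Type*} [MeasurableSpace α] {μ : Measure α} {f : α → ℝ}
    (hf0 : ∀ x, 0 ≤ f x) (hf : Measurable f) {v : ℝ} (hv : 0 ≤ v)
    (hμ : μ Set.univ ≤ ENNReal.ofReal v)
    (h : ∀ s > 0, μ {x | s < f x} ≤ ENNReal.ofReal (v / s ^ 2)) :
    ∫⁻ x, ENNReal.ofReal (f x) ∂μ ≤ ENNReal.ofReal (2 * v) := by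
  rw [lintegral_eq_lintegral_meas_lt μ (Filter.Eventually.of_forall hf0) hf.aemeasurable,
    ← Set.Ioc_union_Ioi_eq_Ioi zero_le_one,
    lintegral_union measurableSet_Ioi (Set.Ioc_disjoint_Ioi le_rfl)]
  have h1 : ∫⁻ s in Set.Ioc (0 : ℝ) 1, μ {x | s < f x} ≤ ENNReal.ofReal v := by
    calc _ ≤ ∫⁻ s in Set.Ioc (0 : ℝ) 1, ENNReal.ofReal v :=
          lintegral_mono fun s => (measure_mono (Set.subset_univ _)).trans hμ
      _ = _ := by simp
  have h2 : ∫⁻ s in Set.Ioi (1 : ℝ), μ {x | s < f x} ≤ ENNReal.ofReal v := by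
    have hInt := integrableOn_Ioi_rpow_of_lt (a := -2) (c := 1) (by norm_num) zero_lt_one
    calc _ ≤ ∫⁻ s in Set.Ioi (1 : ℝ), ENNReal.ofReal (v * s ^ (-2 : ℝ)) := by
          refine setLIntegral_mono' measurableSet_Ioi fun s hs => ?_
          have hs0 : (0 : ℝ) < s := lt_trans zero_lt_one hs
          refine (h s hs0).trans_eq ?_
          rw [Real.rpow_neg hs0.le, div_eq_mul_inv]; norm_cast
      _ = ENNReal.ofReal (∫ s in Set.Ioi (1 : ℝ), v * s ^ (-2 : ℝ)) := by
          rw [ofReal_integral_eq_lintegral_ofReal (hInt.const_mul v)]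
          refine (ae_restrict_iff' measurableSet_Ioi).2 (Filter.Eventually.of_forall fun s hs => ?_)
          have hs0 : (0 : ℝ) < s := lt_trans zero_lt_one hs
          exact mul_nonneg hv (Real.rpow_nonneg hs0.le _)
      _ = ENNReal.ofReal v := by
          rw [integral_const_mul, integral_Ioi_rpow_of_lt (by norm_num) zero_lt_one]
          norm_num
  calc _ ≤ ENNReal.ofReal v + ENNReal.ofReal v := add_le_add h1 h2
    _ = _ := by rw [← ENNReal.ofReal_add hv hv, two_mul]

lemma exists_mem_le_of_setLIntegral_le {α : Type*} [MeasurableSpace α] {μ : Measure α} {F : α → ℝ}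
    (hF : Measurable F) {E Z : Set α} {v c : ℝ} (hv : 0 < v) (hE : μ E = ENNReal.ofReal v)
    (hZ : μ Z = 0) (hc : 0 ≤ c)
    (h : ∫⁻ x in E, ENNReal.ofReal (F x) ∂μ ≤ ENNReal.ofReal (c * v)) : ∃ x ∈ E \ Z, F x ≤ c := by
  have hEZ : μ (E \ Z) = ENNReal.ofReal v := by rw [measure_sdiff_null hZ, hE]
  obtain ⟨x, hx, hle⟩ := exists_le_setLAverage (μ := μ) (s := E \ Z)
    (f := fun x => ENNReal.ofReal (F x)) (by rw [hEZ]; simpa using hv) (by rw [hEZ]; simp)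
    hF.ennreal_ofReal.aemeasurable
  refine ⟨x, hx, ?_⟩
  rw [setLAverage_eq, hEZ] at hle
  have h2 : ENNReal.ofReal (F x) ≤ ENNReal.ofReal c := by
    refine hle.trans (ENNReal.div_le_of_le_mul ?_)
    rw [← ENNReal.ofReal_mul hc]
    exact (lintegral_mono_set Set.sdiff_subset).trans h
  exact (ENNReal.ofReal_le_ofReal_iff hc).1 h2

/-- Turán–Nazarov inequality with linear dependence on the measure. -/
lemma expPoly_turan {ι : Type*} [Fintype ι] {ν : ι → ℝ} {m : ι → ℕ} {p : ℂ → ℂ}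
    (hp : p ∈ expPoly ν m) {N : ℕ} (hN : ∑ c, m c = N + 1) {E : Set ℝ} (hEm : MeasurableSet E)
    (hE2 : E ⊆ Set.Icc 0 2) {v : ℝ} (hv : 0 < v) (hvE : volume E = ENNReal.ofReal v) {δ : ℝ}
    (hδ : ∀ t ∈ E, ‖p t‖ ≤ δ) {t : ℝ} (ht : t ∈ Set.Icc (0 : ℝ) 2) :
    ‖p t‖ ≤ (3900 * exp 16 / v) ^ N * δ := by
  obtain ⟨g, B, hg0, hgc, hgv, hB0, hB, hex⟩ := expPoly_exists_ratio_chain N hp hN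
  refine (hB t ht).trans ?_
  have hv2 : v ≤ 2 := by
    have := measure_mono (μ := volume) hE2
    rw [hvE, Real.volume_Icc] at this
    simpa using (ENNReal.ofReal_le_ofReal_iff (by norm_num)).1 this
  have hcont : ∀ k ≤ N, Measurable fun t : ℝ => ‖g k t‖ := fun k hk =>
    ((hgc k hk).comp Complex.continuous_ofReal).norm.measurable
  set A : ℝ := √(3900 / v) with hA
  have hA2 : A ^ 2 = 3900 / v := Real.sq_sqrt (by positivity)
  have hA1 : 1 ≤ A := by
    rw [hA, Real.one_le_sqrt, le_div_iff₀ hv]; linarith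
  set r : ℕ → ℝ → ℝ := fun k t => ‖g (k + 1) t‖ / ‖g k t‖ with hr
  have hr0 : ∀ k t, 0 ≤ r k t := fun k t => by positivity
  have hInt : ∀ k < N, ∫⁻ t in E, ENNReal.ofReal (√(r k t) / A) ≤ ENNReal.ofReal (2 * v) := by
    intro k hk
    refine lintegral_le_of_meas_lt_le (fun t => by positivity)
      (((hcont (k + 1) hk).div (hcont k hk.le)).sqrt.div_const _) hv.le (by simp [hvE]) ?_
    intro s hs
    have hsub : {t : ℝ | s < √(r k t) / A} ∩ E ⊆
        Set.Icc (0 : ℝ) 2 ∩ {t | (s * A) ^ 2 * ‖g k t‖ < ‖g (k + 1) t‖} := by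
      rintro t ⟨h1, h2⟩
      refine ⟨hE2 h2, ?_⟩
      have hpos : 0 < s * A := by positivity
      have h3 : s * A < √(r k t) := (lt_div_iff₀ (by positivity)).1 h1
      have h4 : (s * A) ^ 2 < r k t := (Real.lt_sqrt hpos.le).1 h3
      have h5 : 0 < ‖g k t‖ := by
        rcases (norm_nonneg (g k t)).eq_or_lt with h | h
        · simp only [hr, ← h, div_zero] at h4
          nlinarith [sq_nonneg (s * A)]
        · exact h
      exact (lt_div_iff₀ h5).1 h4
    rw [Measure.restrict_apply' hEm]
    refine (measure_mono hsub).trans ((hgv k hk _ (by positivity)).trans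
      (ENNReal.ofReal_le_ofReal (le_of_eq ?_)))
    rw [mul_pow, hA2]; field_simp
  set Z : Set ℝ := ⋃ k ∈ Set.Iio N, (Set.Icc (0 : ℝ) 2 ∩ {t | ‖g k t‖ = 0 ∧ 0 < ‖g (k + 1) t‖})
    with hZdef
  have hZ : volume Z = 0 := by
    rw [hZdef, measure_biUnion_null_iff (Set.to_countable _)]
    intro k hk
    rw [Set.mem_Iio] at hk
    refine le_antisymm ?_ zero_le
    refine ENNReal.le_of_forall_pos_le_add fun ε hε _ => ?_
    rw [zero_add]
    have hε' : (0 : ℝ) < ε := by exact_mod_cast hε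
    have := hgv k hk (3900 / ε) (by positivity)
    refine le_trans (measure_mono ?_) (this.trans (le_of_eq ?_))
    · rintro t ⟨h1, h2, h3⟩
      refine ⟨h1, ?_⟩
      simp only [Set.mem_ofPred_eq, h2, mul_zero]; exact h3
    · rw [div_div_cancel₀ (by norm_num)]; simp
  obtain ⟨t₀, ⟨ht₀, hZt⟩, hsum⟩ := exists_mem_le_of_setLIntegral_le (μ := volume)
    (F := fun t => ∑ k ∈ Finset.range N, √(r k t) / A) (c := 2 * N)
    (Finset.measurable_sum _ fun k hk => by
      rw [Finset.mem_range] at hk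
      exact ((hcont (k + 1) hk).div (hcont k hk.le)).sqrt.div_const _) hv hvE hZ (by positivity)
    (by
      simp_rw [ENNReal.ofReal_sum_of_nonneg fun k _ =>
        div_nonneg (Real.sqrt_nonneg (r k _)) (by positivity : 0 ≤ A)]
      rw [lintegral_finsetSum' _ fun k hk => by
        rw [Finset.mem_range] at hk
        exact (((hcont (k + 1) hk).div
          (hcont k hk.le)).sqrt.div_const _).ennreal_ofReal.aemeasurable]
      calc _ ≤ ∑ k ∈ Finset.range N, ENNReal.ofReal (2 * v) :=
            Finset.sum_le_sum fun k hk => hInt k (Finset.mem_range.1 hk)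
        _ = _ := by
            rw [Finset.sum_const, Finset.card_range, nsmul_eq_mul,
              show (2 * (N : ℝ) * v) = N * (2 * v) by ring, ENNReal.ofReal_mul (Nat.cast_nonneg N),
              ENNReal.ofReal_natCast])
  have hstep : ∀ k < N, ‖g (k + 1) t₀‖ ≤ (A * (1 + √(r k t₀) / A)) ^ 2 * ‖g k t₀‖ := by
    intro k hk
    have h1 : r k t₀ ≤ (A * (1 + √(r k t₀) / A)) ^ 2 := by
      rw [mul_add, mul_one, mul_div_cancel₀ _ (by positivity)]
      nlinarith [Real.sq_sqrt (hr0 k t₀), Real.sqrt_nonneg (r k t₀)]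
    rcases (norm_nonneg (g k t₀)).eq_or_lt with h | h
    · rw [← h, mul_zero]
      by_contra! hcon
      exact hZt (Set.mem_biUnion (Set.mem_Iio.2 hk) ⟨hE2 ht₀, h.symm, hcon⟩)
    · rw [← div_le_iff₀ h]; exact h1
  have hprod : ∀ k ≤ N, ‖g k t₀‖ ≤
      (∏ j ∈ Finset.range k, (A * (1 + √(r j t₀) / A)) ^ 2) * ‖p t₀‖ := by
    intro k
    induction k with
    | zero => intro _; simp [hg0]
    | succ k ih =>
      intro hk
      refine (hstep k hk).trans ?_
      rw [Finset.prod_range_succ, mul_comm (∏ j ∈ _, _), mul_assoc]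
      gcongr
      exact ih (by omega)
  have hfac : ∀ j, 1 ≤ A * (1 + √(r j t₀) / A) := fun j => by
    have : 0 ≤ √(r j t₀) / A := by positivity
    nlinarith
  obtain ⟨k, hk, hkB⟩ := hex t₀ (hE2 ht₀)
  have hbig : (∏ j ∈ Finset.range k, (A * (1 + √(r j t₀) / A)) ^ 2) ≤
      (3900 / v * exp 4) ^ N := by
    calc _ ≤ ∏ j ∈ Finset.range N, (A * (1 + √(r j t₀) / A)) ^ 2 := by
          rw [← Finset.prod_range_mul_prod_Ico _ hk]
          refine le_mul_of_one_le_right (Finset.prod_nonneg fun j _ => by positivity) ?_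
          refine (Finset.prod_const_one (s := Finset.Ico k N)).ge.trans ?_
          exact Finset.prod_le_prod (fun _ _ => zero_le_one) fun j _ => one_le_pow₀ (hfac j)
      _ ≤ ∏ j ∈ Finset.range N, (A ^ 2 * exp (2 * (√(r j t₀) / A))) := by
          refine Finset.prod_le_prod (fun j _ => by positivity) fun j _ => ?_
          rw [mul_pow, mul_comm (2 : ℝ), Real.exp_mul, Real.rpow_two]
          gcongr
          rw [add_comm]; exact Real.add_one_le_exp _
      _ = (3900 / v) ^ N * exp (2 * ∑ j ∈ Finset.range N, √(r j t₀) / A) := by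
          rw [Finset.prod_mul_distrib, Finset.prod_const, Finset.card_range, hA2, ← Real.exp_sum,
            Finset.mul_sum]
      _ ≤ (3900 / v) ^ N * exp (N * 4) := by
          refine mul_le_mul_of_nonneg_left (Real.exp_le_exp.2 ?_) (by positivity)
          linarith
      _ = _ := by rw [mul_pow, Real.exp_nat_mul]
  calc B ≤ exp 12 ^ N * ‖g k t₀‖ := hkB
    _ ≤ exp 12 ^ N * ((3900 / v * exp 4) ^ N * δ) := by
        gcongr
        exact (hprod k hk).trans (mul_le_mul hbig (hδ t₀ ht₀) (norm_nonneg _) (by positivity))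
    _ = _ := by
        rw [← mul_assoc, ← mul_pow]
        congr 2
        rw [show (16 : ℝ) = 12 + 4 by norm_num, Real.exp_add]; ring

lemma exists_ray {d : ℕ} {Q E : Set (Fin d → ℝ)} (hQm : MeasurableSet Q) (hQc : Convex ℝ Q)
    (hQ0 : volume Q ≠ 0) (hQfin : volume Q ≠ ⊤) (hE : MeasurableSet E)
    (hEQ : E ⊆ Q) {y : Fin d → ℝ} (hy : y ∈ Q) :
    ∃ u : Fin d → ℝ, ENNReal.ofReal (1 / 2 ^ d) * volume E ≤
      volume (Set.Icc (0 : ℝ) 2 ∩ {t | y + t • (u - y) ∈ E}) * volume Q := by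
  have hW : Measurable (Function.uncurry fun (u : Fin d → ℝ) (t : ℝ) =>
      E.indicator (1 : (Fin d → ℝ) → ENNReal) (y + t • (u - y))) :=
    (measurable_one.indicator hE).comp (f := fun q : (Fin d → ℝ) × ℝ => y + q.2 • (q.1 - y))
      (by fun_prop)
  set F : (Fin d → ℝ) → ENNReal := fun u => ∫⁻ t in Set.Icc (1 : ℝ) 2,
    E.indicator (1 : (Fin d → ℝ) → ENNReal) (y + t • (u - y)) with hF
  have hmap : ∀ u, Measurable fun t : ℝ => y + t • (u - y) := fun u => by fun_prop
  have hFle : ∀ u, F u ≤ volume (Set.Icc (0 : ℝ) 2 ∩ {t | y + t • (u - y) ∈ E}) := by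
    intro u
    have h1 : F u = volume ({t : ℝ | y + t • (u - y) ∈ E} ∩ Set.Icc (1 : ℝ) 2) := by
      have : (fun t : ℝ => E.indicator (1 : (Fin d → ℝ) → ENNReal) (y + t • (u - y))) =
          ((fun t : ℝ => y + t • (u - y)) ⁻¹' E).indicator 1 := by
        rfl
      rw [hF]; simp only [this]
      rw [lintegral_indicator_one ((hmap u) hE), Measure.restrict_apply ((hmap u) hE)]
      rfl
    rw [h1, Set.inter_comm]
    exact measure_mono (Set.inter_subset_inter_left _ (Set.Icc_subset_Icc_left zero_le_one))
  have hInt : ENNReal.ofReal (1 / 2 ^ d) * volume E ≤ ∫⁻ u in Q, F u := by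
    rw [hF, lintegral_lintegral_swap hW.aemeasurable]
    calc ENNReal.ofReal (1 / 2 ^ d) * volume E
        = ∫⁻ t in Set.Icc (1 : ℝ) 2, ENNReal.ofReal (1 / 2 ^ d) * volume E := by
          rw [setLIntegral_const, Real.volume_Icc]; norm_num
      _ ≤ _ := by
          refine setLIntegral_mono' measurableSet_Icc fun t ht => ?_
          have ht0 : 0 < t := by linarith [ht.1]
          have hm : Measurable fun u : Fin d → ℝ => y + t • (u - y) := by fun_prop
          have : (fun u : Fin d → ℝ => E.indicator (1 : (Fin d → ℝ) → ENNReal) (y + t • (u - y))) =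
              ((fun u => y + t • (u - y)) ⁻¹' E).indicator 1 := by
            rfl
          simp only [this]
          rw [lintegral_indicator_one (hm hE), Measure.restrict_apply (hm hE)]
          have hsub : AffineMap.homothety y t⁻¹ '' E ⊆ ((fun u => y + t • (u - y)) ⁻¹' E) ∩ Q := by
            rintro _ ⟨x, hx, rfl⟩
            constructor
            · simp only [Set.mem_preimage, AffineMap.homothety_apply, vsub_eq_sub, vadd_eq_add,
                add_sub_cancel_right, smul_smul, mul_inv_cancel₀ ht0.ne', one_smul]
              rw [add_sub_cancel]; exact hx
            · have h1 : t⁻¹ ≤ 1 := inv_le_one_of_one_le₀ ht.1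
              have := hQc (hEQ hx) hy (inv_nonneg.2 ht0.le) (sub_nonneg.2 h1) (by ring)
              convert this using 1
              rw [AffineMap.homothety_apply, vsub_eq_sub, vadd_eq_add, smul_sub, sub_smul, one_smul]
              abel
          refine le_trans ?_ (measure_mono hsub)
          rw [Measure.addHaar_image_homothety]
          gcongr
          rw [Module.finrank_fin_fun, abs_of_pos (by positivity), one_div, ← inv_pow]
          gcongr; exact ht.2
  obtain ⟨u, -, hu⟩ := exists_setLAverage_le (μ := volume) (s := Q) (f := F) hQ0
    hQm.nullMeasurableSet (by
      refine ((lintegral_mono fun u => (hFle u).trans (measure_mono Set.inter_subset_left)).trans_lt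
        ?_).ne
      rw [setLIntegral_const, Real.volume_Icc]
      exact ENNReal.mul_lt_top ENNReal.ofReal_lt_top hQfin.lt_top)
  rw [setLAverage_eq, ENNReal.div_le_iff hQ0 hQfin] at hu
  exact ⟨u, hInt.trans (hu.trans (mul_le_mul_left (hFle u) _))⟩

/-- Remez type inequality on a convex set. -/
lemma remez_convex {d : ℕ} {ι : Type*} [Fintype ι] {N m : ℕ} (hN : Fintype.card ι * m = N + 1)
    {P : (Fin d → ℝ) → ℂ}
    (hP : ∀ y u : Fin d → ℝ, ∃ ν : ι → ℝ, ∃ p ∈ expPoly ν (fun _ => m),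
      ∀ t : ℝ, P (y + t • u) = p t)
    {Q E : Set (Fin d → ℝ)} (hQm : MeasurableSet Q) (hQc : Convex ℝ Q)
    (hQ0 : volume Q ≠ 0) (hQfin : volume Q ≠ ⊤) (hE : MeasurableSet E)
    (hEQ : E ⊆ Q) {v : ℝ} (hv : 0 < v) (hvE : ENNReal.ofReal v * volume Q ≤ volume E) {δ : ℝ}
    (hδ : ∀ x ∈ E, ‖P x‖ ≤ δ) {y : Fin d → ℝ} (hy : y ∈ Q) :
    ‖P y‖ ≤ (3900 * exp 16 * 2 ^ d / v) ^ N * δ := by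
  obtain ⟨u, hu⟩ := exists_ray hQm hQc hQ0 hQfin hE hEQ hy
  obtain ⟨ν, p, hp, hpP⟩ := hP y (u - y)
  set G : Set ℝ := Set.Icc (0 : ℝ) 2 ∩ {t | y + t • (u - y) ∈ E} with hG
  have hm : Measurable fun t : ℝ => y + t • (u - y) := by fun_prop
  have hGm : MeasurableSet G := measurableSet_Icc.inter (hm hE)
  have hGfin : volume G ≠ ⊤ :=
    ((measure_mono Set.inter_subset_left).trans_lt (by rw [Real.volume_Icc]; simp)).ne
  have hle : v / 2 ^ d ≤ (volume G).toReal := by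
    refine (ENNReal.ofReal_le_iff_le_toReal hGfin).1 ?_
    rw [← ENNReal.mul_le_mul_iff_left hQ0 hQfin]
    refine le_trans ?_ hu
    rw [div_eq_mul_one_div, mul_comm v, ENNReal.ofReal_mul (by positivity), mul_assoc]
    gcongr
  have hpos : 0 < (volume G).toReal := lt_of_lt_of_le (by positivity) hle
  have hEne : E.Nonempty := by
    by_contra h
    rw [Set.not_nonempty_iff_eq_empty] at h
    rw [h, measure_empty, nonpos_iff_eq_zero, mul_eq_zero] at hvE
    exact hvE.elim (fun h => (ENNReal.ofReal_pos.2 hv).ne' h) hQ0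
  obtain ⟨x, hx⟩ := hEne
  have hδ0 : 0 ≤ δ := (norm_nonneg _).trans (hδ x hx)
  have := expPoly_turan hp (N := N) (by simpa using hN) hGm Set.inter_subset_left hpos
    (ENNReal.ofReal_toReal hGfin).symm (δ := δ) (fun t ht => by rw [← hpP]; exact hδ _ ht.2)
    (t := 0) (by simp)
  rw [← hpP, zero_smul, add_zero] at this
  refine this.trans (mul_le_mul_of_nonneg_right (pow_le_pow_left₀ (by positivity) ?_ _) hδ0)
  rw [div_le_div_iff₀ hpos hv]
  rw [div_le_iff₀ (by positivity)] at hle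
  have : 0 ≤ 3900 * exp 16 := by positivity
  nlinarith

lemma continuous_trigPoly {d : ℕ} (L : ℝ) (T : Finset (Fin d → ℤ)) (F : (Fin d → ℤ) → ℂ) :
    Continuous (trigPoly L T F) := by
  unfold trigPoly
  fun_prop

lemma eLpNorm_trigPoly_translate {d : ℕ} {L : ℝ} (hL : 0 < L) (T : Finset (Fin d → ℤ))
    (F : (Fin d → ℤ) → ℂ) (p : ENNReal) (y : Fin d → ℝ) :
    eLpNorm (fun x => trigPoly L T F (x + y)) p (volume.restrict (torusCube d L)) =
      eLpNorm (trigPoly L T F) p (volume.restrict (torusCube d L)) := by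
  have hP : 0 < 2 * π * L := by positivity
  have : Fact (0 < 2 * π * L) := ⟨hP⟩
  set g : (Fin d → AddCircle (2 * π * L)) → ℂ :=
    fun x => ∑ k ∈ T, F k * ∏ j, fourier (k j) (x j) with hg
  have hgc : Continuous g := by rw [hg]; fun_prop
  set mk : (Fin d → ℝ) → Fin d → AddCircle (2 * π * L) := fun x j => (x j : AddCircle (2 * π * L))
  have hmk : MeasurePreserving mk (volume.restrict (torusCube d L)) volume := by
    have h1 : (volume.restrict (torusCube d L) : Measure (Fin d → ℝ)) =
        Measure.pi fun _ : Fin d => (volume.restrict (Set.Ioc (0 : ℝ) (0 + 2 * π * L))) := by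
      rw [← Measure.restrict_pi_pi, torusCube, zero_add]
      refine Measure.restrict_congr_set ?_
      have := Measure.univ_pi_Ioc_ae_eq_Icc (μ := fun _ : Fin d => (volume : Measure ℝ))
        (f := fun _ => 0) (g := fun _ => 2 * π * L)
      rw [← Set.pi_univ_Icc] at this
      exact this.symm
    rw [h1]
    exact measurePreserving_pi _ _ fun _ => AddCircle.measurePreserving_mk (2 * π * L) 0
  have hgf : ∀ x, trigPoly L T F x = g (mk x) := by
    intro x
    rw [hg, trigPoly]
    refine Finset.sum_congr rfl fun k _ => ?_
    congr 1
    simp only [mk, fourier_coe_apply]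
    rw [← Complex.exp_sum]
    congr 1
    push_cast
    rw [Finset.mul_sum]
    refine Finset.sum_congr rfl fun j _ => ?_
    have : (L : ℂ) ≠ 0 := by exact_mod_cast hL.ne'
    have hpi : (π : ℂ) ≠ 0 := by exact_mod_cast pi_ne_zero
    field_simp
  have hadd : ∀ x, mk (x + y) = mk x + mk y := fun x => by ext j; simp [mk]
  have e1 : (fun x => trigPoly L T F (x + y)) = (fun z => g (z + mk y)) ∘ mk := by
    ext x; simp [hgf, hadd]
  have e2 : trigPoly L T F = g ∘ mk := by ext x; simp [hgf]
  rw [e1, e2, eLpNorm_comp_measurePreserving (g := fun z => g (z + mk y))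
      (hgc.comp (continuous_add_const (mk y))).aestronglyMeasurable hmk,
    eLpNorm_comp_measurePreserving hgc.aestronglyMeasurable hmk]
  exact eLpNorm_comp_measurePreserving hgc.aestronglyMeasurable
    (measurePreserving_add_right volume (mk y))

/-- `m` is an `L^p` Fourier multiplier of norm at most `A` on trigonometric polynomials with
frequencies in `T`. -/
def MulBound {d : ℕ} (L : ℝ) (p : ENNReal) (T : Finset (Fin d → ℤ)) (m : (Fin d → ℤ) → ℂ)
    (A : ℝ) : Prop :=
  ∀ F : (Fin d → ℤ) → ℂ,
    eLpNorm (trigPoly L T fun k => m k * F k) p (volume.restrict (torusCube d L)) ≤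
      ENNReal.ofReal A * eLpNorm (trigPoly L T F) p (volume.restrict (torusCube d L))

section MulBound

variable {d : ℕ} {L : ℝ} {p : ENNReal} {T : Finset (Fin d → ℤ)} {m m' : (Fin d → ℤ) → ℂ} {A A' : ℝ}

lemma MulBound.congr (h : MulBound L p T m A) (hm : ∀ k ∈ T, m' k = m k) : MulBound L p T m' A := by
  intro F
  convert h F using 2
  ext x
  exact Finset.sum_congr rfl fun k hk => by simp only [hm k hk]

lemma MulBound.mono (h : MulBound L p T m A) (hA : A ≤ A') : MulBound L p T m A' := fun F =>
  (h F).trans (by gcongr)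

lemma MulBound.one : MulBound L p T (fun _ => 1) 1 := fun F => by simp

lemma MulBound.mul (h : MulBound L p T m A) (h' : MulBound L p T m' A') (hA : 0 ≤ A) :
    MulBound L p T (fun k => m k * m' k) (A * A') := by
  intro F
  have := (h fun k => m' k * F k).trans (mul_le_mul_right (h' F) _)
  rw [← mul_assoc, ← ENNReal.ofReal_mul hA] at this
  simpa only [mul_assoc] using this

lemma MulBound.prod {ι : Type*} (s : Finset ι) {m : ι → (Fin d → ℤ) → ℂ} {A : ι → ℝ}
    (h : ∀ i ∈ s, MulBound L p T (m i) (A i)) (hA : ∀ i ∈ s, 0 ≤ A i) :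
    MulBound L p T (fun k => ∏ i ∈ s, m i k) (∏ i ∈ s, A i) := by
  classical
  induction s using Finset.induction_on with
  | empty => simpa using MulBound.one
  | insert i s hi ih =>
    simp only [Finset.prod_insert hi]
    exact (h i (by simp)).mul (ih (fun j hj => h j (by simp [hj])) fun j hj => hA j (by simp [hj]))
      (hA i (by simp))

lemma MulBound.add (h : MulBound L p T m A) (h' : MulBound L p T m' A') (hp : 1 ≤ p)
    (hA : 0 ≤ A) (hA' : 0 ≤ A') :
    MulBound L p T (fun k => m k + m' k) (A + A') := by
  intro F
  have e : trigPoly L T (fun k => (m k + m' k) * F k) =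
      trigPoly L T (fun k => m k * F k) + trigPoly L T (fun k => m' k * F k) := by
    ext x
    simp only [trigPoly, Pi.add_apply, ← Finset.sum_add_distrib]
    exact Finset.sum_congr rfl fun k _ => by ring
  rw [e, ENNReal.ofReal_add hA hA', add_mul]
  exact (eLpNorm_add_le (continuous_trigPoly _ _ _).aestronglyMeasurable
    (continuous_trigPoly _ _ _).aestronglyMeasurable hp).trans (add_le_add (h F) (h' F))

lemma MulBound.const_mul (h : MulBound L p T m A) (c : ℂ) :
    MulBound L p T (fun k => c * m k) (‖c‖ * A) := by
  intro F
  have e : trigPoly L T (fun k => c * m k * F k) = c • trigPoly L T (fun k => m k * F k) := by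
    ext x
    simp only [trigPoly, Pi.smul_apply, smul_eq_mul, Finset.mul_sum]
    exact Finset.sum_congr rfl fun k _ => by ring
  rw [e, eLpNorm_const_smul, ENNReal.ofReal_mul (norm_nonneg _), mul_assoc, ofReal_norm]
  exact mul_le_mul_right (h F) _

lemma MulBound.sum (hp : 1 ≤ p) {ι : Type*} (s : Finset ι) {m : ι → (Fin d → ℤ) → ℂ} {A : ι → ℝ}
    (h : ∀ i ∈ s, MulBound L p T (m i) (A i)) (hA : ∀ i ∈ s, 0 ≤ A i) :
    MulBound L p T (fun k => ∑ i ∈ s, m i k) (∑ i ∈ s, A i) := by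
  classical
  induction s using Finset.induction_on with
  | empty =>
    intro F
    have : trigPoly L T (fun _ => 0) = 0 := by ext x; simp [trigPoly]
    simp [this]
  | insert i s hi ih =>
    simp only [Finset.sum_insert hi]
    exact (h i (by simp)).add (ih (fun j hj => h j (by simp [hj])) fun j hj => hA j (by simp [hj]))
      hp (hA i (by simp)) (Finset.sum_nonneg fun j hj => hA j (by simp [hj]))

lemma MulBound.exp (hL : 0 < L) (y : Fin d → ℝ) :
    MulBound L p T (fun k => Complex.exp (Complex.I * ((∑ j, y j * (k j : ℝ) / L : ℝ) : ℂ))) 1 := by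
  intro F
  rw [ENNReal.ofReal_one, one_mul, ← eLpNorm_trigPoly_translate hL T F p y]
  refine le_of_eq ?_
  congr 1
  ext x
  simp only [trigPoly]
  refine Finset.sum_congr rfl fun k _ => ?_
  rw [mul_comm (Complex.exp _) (F k), mul_assoc, ← Complex.exp_add, ← mul_add, ← Complex.ofReal_add,
    ← Finset.sum_add_distrib]
  simp only [Pi.add_apply, add_mul, add_div, add_comm]

end MulBound

/-- Coefficients of the (unnormalized) Fejér kernel. -/
def fejerCoeff (N : ℕ) (k : ℤ) : ℕ := (N - |k|).toNat

lemma sum_exp_eq_zero {M : ℕ} {r : ℤ} (hr : |r| < M) :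
    ∑ s ∈ Finset.range M, Complex.exp (2 * π * Complex.I * s * r / M) = if r = 0 then (M : ℂ) else 0 := by
  split_ifs with h
  · simp [h]
  have hM : 0 < M := by have := abs_nonneg r; omega
  have hM0 : (M : ℂ) ≠ 0 := by exact_mod_cast hM.ne'
  set w := Complex.exp (2 * π * Complex.I * r / M) with hw
  have e : ∀ s : ℕ, Complex.exp (2 * π * Complex.I * s * r / M) = w ^ s := by
    intro s
    rw [hw, ← Complex.exp_nat_mul]
    congr 1; ring
  simp only [e]
  have hw1 : w ≠ 1 := by
    rw [hw, Ne, Complex.exp_eq_one_iff]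
    rintro ⟨n, hn⟩
    have h2 : (2 * π * Complex.I : ℂ) ≠ 0 := Complex.two_pi_I_ne_zero
    have h3 : (r : ℂ) = n * M := by
      field_simp at hn
      linear_combination hn
    have h4 : r = n * M := by exact_mod_cast h3
    rcases eq_or_ne n 0 with rfl | hn0
    · simp at h4; exact h h4
    · have : (1 : ℤ) ≤ |n| := Int.one_le_abs hn0
      rw [h4, abs_mul, Nat.abs_cast] at hr
      nlinarith
  have hwM : w ^ M = 1 := by
    rw [hw, ← Complex.exp_nat_mul, Complex.exp_eq_one_iff]
    exact ⟨r, by field_simp⟩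
  rw [geom_sum_eq hw1, hwM, sub_self, zero_div]

lemma card_pairs_eq_fejerCoeff (N : ℕ) (k : ℤ) :
    ∑ a ∈ Finset.Ico (0 : ℤ) N, ∑ b ∈ Finset.Ico (0 : ℤ) N, (if b - a + k = 0 then (1 : ℂ) else 0) =
      fejerCoeff N k := by
  have : ∀ a ∈ Finset.Ico (0 : ℤ) N, ∑ b ∈ Finset.Ico (0 : ℤ) N,
      (if b - a + k = 0 then (1 : ℂ) else 0) = if a ∈ Finset.Ico k (N + k) then 1 else 0 := by
    intro a _
    have : ∀ b : ℤ, (b - a + k = 0) = (b = a - k) := fun b => by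
      rw [eq_iff_iff]; constructor <;> intro h <;> omega
    simp only [this, Finset.sum_ite_eq', Finset.mem_Ico]
    congr 1
    rw [eq_iff_iff]
    constructor <;> intro h <;> omega
  rw [Finset.sum_congr rfl this, ← Finset.sum_filter, Finset.sum_const, nsmul_eq_mul, mul_one,
    Finset.filter_mem_eq_inter, Finset.Ico_inter_Ico, Int.card_Ico, fejerCoeff]
  congr 1
  rcases abs_cases k with ⟨h, _⟩ | ⟨h, _⟩ <;> rw [h] <;> omega

lemma sum_fejer {M N : ℕ} {k : ℤ} (hk : |k| + N ≤ M) :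
    ∑ s ∈ Finset.range M, (‖∑ a ∈ Finset.Ico (0 : ℤ) N, Complex.exp (2 * π * Complex.I * s * a / M)‖ ^ 2 : ℝ) *
      Complex.exp (2 * π * Complex.I * s * k / M) = M * (fejerCoeff N k : ℂ) := by
  have h1 : ∀ s ∈ Finset.range M,
      (‖∑ a ∈ Finset.Ico (0 : ℤ) N, Complex.exp (2 * π * Complex.I * s * a / M)‖ ^ 2 : ℝ) *
      Complex.exp (2 * π * Complex.I * s * k / M) =
      ∑ a ∈ Finset.Ico (0 : ℤ) N, ∑ b ∈ Finset.Ico (0 : ℤ) N,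
        Complex.exp (2 * π * Complex.I * s * (b - a + k : ℤ) / M) := by
    intro s _
    rw [← Complex.normSq_eq_norm_sq, Complex.normSq_eq_conj_mul_self, map_sum,
      Finset.sum_mul_sum, Finset.sum_mul]
    refine Finset.sum_congr rfl fun a _ => ?_
    rw [Finset.sum_mul]
    refine Finset.sum_congr rfl fun b _ => ?_
    rw [← Complex.exp_conj, ← Complex.exp_add, ← Complex.exp_add]
    congr 1
    simp [Complex.conj_ofNat]
    ring
  rw [Finset.sum_congr rfl h1, Finset.sum_comm, ← card_pairs_eq_fejerCoeff, Finset.mul_sum]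
  refine Finset.sum_congr rfl fun a ha => ?_
  rw [Finset.sum_comm, Finset.mul_sum]
  refine Finset.sum_congr rfl fun b hb => ?_
  rw [Finset.mem_Ico] at ha hb
  rw [sum_exp_eq_zero]
  · simp
  · rw [abs_lt]; have := abs_le.1 (le_refl |k|); omega

section Multipliers

variable {d : ℕ} {L : ℝ} {p : ENNReal}

lemma mulBound_fejer (hL : 0 < L) (hp : 1 ≤ p) (T : Finset (Fin d → ℤ)) (j : Fin d) (c : ℤ)
    (N : ℕ) : MulBound L p T (fun k => (fejerCoeff N (k j - c) : ℂ)) N := by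
  rcases Nat.eq_zero_or_pos N with rfl | hN
  · refine (MulBound.one.const_mul 0).mono (A' := ((0 : ℕ) : ℝ)) (by simp) |>.congr fun k _ => ?_
    simp [fejerCoeff]
  set M : ℕ := N + ∑ k ∈ T, (k j - c).natAbs with hM
  have hM0 : 0 < M := by omega
  have hMC : (M : ℂ) ≠ 0 := by exact_mod_cast hM0.ne'
  have hle : ∀ k ∈ T, |k j - c| + N ≤ M := by
    intro k hk
    have : (k j - c).natAbs ≤ ∑ k ∈ T, (k j - c).natAbs :=
      Finset.single_le_sum (f := fun k : Fin d → ℤ => (k j - c).natAbs) (fun _ _ => Nat.zero_le _) hk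
    rw [Int.abs_eq_natAbs]; omega
  set W : ℕ → ℝ := fun s =>
    ‖∑ a ∈ Finset.Ico (0 : ℤ) N, Complex.exp (2 * π * Complex.I * s * a / M)‖ ^ 2 with hW
  have key := MulBound.sum (L := L) (p := p) (T := T) hp (Finset.range M)
    (m := fun s k => (1 / M * W s * Complex.exp (-(2 * π * Complex.I * s * c / M)) : ℂ) *
      Complex.exp (Complex.I * ((∑ i, (Pi.single j (2 * π * L * s / M) : Fin d → ℝ) i * (k i : ℝ) / L : ℝ) : ℂ)))
    (A := fun s => ‖(1 / M * W s * Complex.exp (-(2 * π * Complex.I * s * c / M)) : ℂ)‖ * 1)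
    (fun s _ => (MulBound.exp hL _).const_mul _) (fun s _ => by positivity)
  have hmass : ∑ s ∈ Finset.range M,
      ‖(1 / M * W s * Complex.exp (-(2 * π * Complex.I * s * c / M)) : ℂ)‖ * 1 = N := by
    have h := sum_fejer (M := M) (N := N) (k := 0) (by simp; omega)
    have h2 : fejerCoeff N 0 = N := by simp [fejerCoeff]
    simp only [Int.cast_zero, mul_zero, zero_div, Complex.exp_zero, mul_one, h2] at h
    have h3 : ∑ s ∈ Finset.range M, W s = M * N := by
      simp only [hW]; exact_mod_cast h
    have h4 : ∀ s ∈ Finset.range M,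
        ‖(1 / M * W s * Complex.exp (-(2 * π * Complex.I * s * c / M)) : ℂ)‖ * 1 = 1 / M * W s := by
      intro s _
      have : (-(2 * π * Complex.I * s * c / M) : ℂ) = ((-(2 * π * s * c / M) : ℝ) : ℂ) * Complex.I := by
        push_cast; ring
      rw [norm_mul, norm_mul, this, Complex.norm_exp_ofReal_mul_I, Complex.norm_real,
        Real.norm_of_nonneg (by positivity)]
      simp
    rw [Finset.sum_congr rfl h4, ← Finset.mul_sum, h3]
    have : (M : ℝ) ≠ 0 := by exact_mod_cast hM0.ne'
    field_simp
  rw [hmass] at key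
  refine key.congr fun k hk => ?_
  have h := sum_fejer (hle k hk)
  rw [eq_comm, ← mul_right_inj' hMC, ← h, Finset.mul_sum]
  refine Finset.sum_congr rfl fun s _ => ?_
  have e : ∑ i, (Pi.single j (2 * π * L * s / M) : Fin d → ℝ) i * (k i : ℝ) / L =
      2 * π * s / M * k j := by
    rw [Finset.sum_eq_single j]
    · rw [Pi.single_eq_same]; field_simp
    · intro i _ hi; simp [Pi.single_eq_of_ne hi]
    · simp
  rw [e, mul_assoc, ← Complex.exp_add]
  have : (-(2 * π * Complex.I * s * c / M) + Complex.I * ((2 * π * s / M * k j : ℝ) : ℂ)) =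
      2 * π * Complex.I * s * (k j - c : ℤ) / M := by
    push_cast; ring
  rw [this, ← mul_assoc, ← mul_assoc, mul_one_div_cancel hMC, one_mul]

/-- Bernstein's inequality. -/
lemma mulBound_deriv (hL : 0 < L) (hp : 1 ≤ p) (T : Finset (Fin d → ℤ)) (j : Fin d) (c : ℤ)
    (N : ℕ) (h : ∀ k ∈ T, |k j - c| ≤ N) :
    MulBound L p T (fun k => ((k j - c : ℤ) : ℂ)) (2 * N) := by
  have := (mulBound_fejer hL hp T j (c + N) N).add
    ((mulBound_fejer hL hp T j (c - N) N).const_mul (-1)) hp (by positivity) (by positivity)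
  refine (this.mono (le_of_eq ?_)).congr fun k hk => ?_
  · simp; ring
  · have h1 : (fejerCoeff N (k j - (c + N)) : ℤ) - fejerCoeff N (k j - (c - N)) = k j - c := by
      have h2 := abs_le.1 (h k hk)
      rw [fejerCoeff, fejerCoeff]
      rcases abs_cases (k j - (c + N)) with ⟨h3, _⟩ | ⟨h3, _⟩ <;>
      rcases abs_cases (k j - (c - N)) with ⟨h4, _⟩ | ⟨h4, _⟩ <;> rw [h3, h4] <;> omega
    rw [← h1]; push_cast; ring

/-- De la Vallée Poussin means: projecting on a separated box of frequencies is bounded. -/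
lemma eLpNorm_trigPoly_filter_le (hL : 0 < L) (hp : 1 ≤ p) (T T' : Finset (Fin d → ℤ)) (hT : T' ⊆ T)
    (c : Fin d → ℤ) (N : Fin d → ℕ) (h1 : ∀ k ∈ T', ∀ j, |k j - c j| ≤ N j)
    (h2 : ∀ k ∈ T, k ∉ T' → ∃ j, 2 * (N j : ℤ) + 1 ≤ |k j - c j|) (F : (Fin d → ℤ) → ℂ) :
    eLpNorm (trigPoly L T' F) p (volume.restrict (torusCube d L)) ≤
      ENNReal.ofReal (3 ^ d) * eLpNorm (trigPoly L T F) p (volume.restrict (torusCube d L)) := by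
  classical
  have hVP : ∀ j ∈ (Finset.univ : Finset (Fin d)), MulBound L p T (fun k =>
      (1 / (N j + 1) : ℂ) * (fejerCoeff (2 * N j + 1) (k j - c j) +
        (-1) * fejerCoeff (N j) (k j - c j))) 3 := by
    intro j _
    refine (((mulBound_fejer hL hp T j (c j) (2 * N j + 1)).add
      ((mulBound_fejer hL hp T j (c j) (N j)).const_mul (-1)) hp (by positivity)
      (by positivity)).const_mul _).mono ?_
    have : ‖(1 / (N j + 1) : ℂ)‖ = 1 / ((N j : ℝ) + 1) := by
      rw [norm_div, norm_one]; congr 1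
      have : ((N j : ℂ) + 1) = ((N j + 1 : ℕ) : ℂ) := by push_cast; ring
      rw [this, Complex.norm_natCast]; push_cast; ring
    rw [this, norm_neg, norm_one, div_mul_eq_mul_div, div_le_iff₀ (by positivity)]
    push_cast
    linarith
  have key := MulBound.prod Finset.univ hVP (fun _ _ => by norm_num) F
  rw [Finset.prod_const, Finset.card_univ, Fintype.card_fin] at key
  refine le_trans (le_of_eq ?_) key
  congr 1
  ext x
  simp only [trigPoly]
  rw [← Finset.sum_subset hT]
  · refine Finset.sum_congr rfl fun k hk => ?_
    rw [Finset.prod_eq_one, one_mul]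
    intro j _
    have h3 : (fejerCoeff (2 * N j + 1) (k j - c j) : ℤ) - fejerCoeff (N j) (k j - c j) = N j + 1 := by
      have := h1 k hk j
      rw [fejerCoeff, fejerCoeff]; push_cast; omega
    have h4 : (fejerCoeff (2 * N j + 1) (k j - c j) : ℂ) - fejerCoeff (N j) (k j - c j) = N j + 1 := by
      exact_mod_cast congrArg (Int.cast : ℤ → ℂ) h3
    have h5 : (N j + 1 : ℂ) ≠ 0 := by exact_mod_cast Nat.succ_ne_zero (N j)
    rw [neg_one_mul, ← sub_eq_add_neg, h4, one_div, inv_mul_cancel₀ h5]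
  · intro k hk hk'
    obtain ⟨j, hj⟩ := h2 k hk hk'
    rw [Finset.prod_eq_zero (Finset.mem_univ j), zero_mul, zero_mul]
    have e1 : fejerCoeff (2 * N j + 1) (k j - c j) = 0 := by
      rw [fejerCoeff, Int.toNat_eq_zero]; push_cast; omega
    have e2 : fejerCoeff (N j) (k j - c j) = 0 := by
      rw [fejerCoeff, Int.toNat_eq_zero]; omega
    simp [e1, e2]

end Multipliers

/-- Merging of clusters until they are well separated. -/
lemma exists_separated {α : Type*} [DecidableEq α] {near : ℝ → α → α → Prop}
    (hmono : ∀ {r s x y}, r ≤ s → near r x y → near s x y)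
    (hsymm : ∀ {r x y}, near r x y → near r y x)
    (htri : ∀ {r s x y z}, near r x y → near s y z → near (r + s) x z) {T : Set α} (n : ℕ) :
    ∀ (Cs : Finset α) (ρ : ℝ), Cs.card = n + 1 → 0 < ρ → (∀ x ∈ T, ∃ c ∈ Cs, near ρ x c) →
      ∃ Cs' ⊆ Cs, Cs'.Nonempty ∧ ∃ ρ', 0 < ρ' ∧ ρ' ≤ 4 ^ n * ρ ∧ (∀ x ∈ T, ∃ c ∈ Cs', near ρ' x c) ∧
        (∀ x ∈ T, ∀ c ∈ Cs', ¬ near ρ' x c → ¬ near (2 * ρ') x c) ∧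
        ∀ x, ∀ c ∈ Cs', ∀ c' ∈ Cs', near ρ' x c → near ρ' x c' → c = c' := by
  induction n with
  | zero =>
    intro Cs ρ hcard hρ hcov
    refine ⟨Cs, subset_rfl, Finset.card_pos.1 (by omega), ρ, hρ, by simp, hcov, ?_,
      fun _ c hc c' hc' _ _ => Finset.card_le_one.1 hcard.le c hc c' hc'⟩
    intro x hx c hc hn
    obtain ⟨c', hc', hn'⟩ := hcov x hx
    obtain rfl := Finset.card_le_one.1 hcard.le c hc c' hc'
    exact absurd hn' hn
  | succ n ih =>
    intro Cs ρ hcard hρ hcov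
    by_cases hsep : ∀ c ∈ Cs, ∀ c' ∈ Cs, c ≠ c' → ¬ near (3 * ρ) c c'
    · refine ⟨Cs, subset_rfl, Finset.card_pos.1 (by omega), ρ, hρ, ?_, hcov, ?_, ?_⟩
      · exact le_mul_of_one_le_left hρ.le (one_le_pow₀ (by norm_num))
      · intro x hx c hc hn hn2
        obtain ⟨c', hc', hn'⟩ := hcov x hx
        have hne : c' ≠ c := by rintro rfl; exact hn hn'
        refine hsep c' hc' c hc hne ?_
        have := htri (hsymm hn') hn2
        rwa [show ρ + 2 * ρ = 3 * ρ by ring] at this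
      · intro x c hc c' hc' h h'
        by_contra hne
        exact hsep c hc c' hc' hne (hmono (by linarith) (htri (hsymm h) h'))
    · push Not at hsep
      obtain ⟨c, hc, c', hc', hne, hnear⟩ := hsep
      obtain ⟨Cs', hs, h1, ρ', h2, h3, h4, h5, h6⟩ := ih (Cs.erase c') (4 * ρ)
        (by rw [Finset.card_erase_of_mem hc']; omega) (by positivity) (by
          intro x hx
          obtain ⟨e, he, hxe⟩ := hcov x hx
          by_cases h : e = c'
          · subst h
            refine ⟨c, Finset.mem_erase.2 ⟨hne, hc⟩, ?_⟩
            have := htri hxe (hsymm hnear)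
            rwa [show ρ + 3 * ρ = 4 * ρ by ring] at this
          · exact ⟨e, Finset.mem_erase.2 ⟨h, he⟩, hmono (by linarith) hxe⟩)
      exact ⟨Cs', hs.trans (Finset.erase_subset _ _), h1, ρ', h2, h3.trans_eq (by ring), h4, h5, h6⟩

/-- Frequencies in a union of boxes split into well separated clusters. -/
lemma exists_clusters {d n : ℕ} {L : ℝ} (hL : 0 < L) {b : Fin d → ℝ} (hb : ∀ j, 0 < b j)
    {lam : Fin n → Fin d → ℝ} {T : Finset (Fin d → ℤ)} (hT0 : T.Nonempty)
    (hT : ∀ k ∈ T, ∃ l : Fin n, ∀ j,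
      (k j : ℝ) / L ∈ Set.Icc (lam l j - b j / 2) (lam l j + b j / 2)) :
    ∃ (Cs : Finset (Fin d → ℤ)) (N : Fin d → ℕ) (Tc : (Fin d → ℤ) → Finset (Fin d → ℤ)),
      Cs.Nonempty ∧ Cs.card ≤ n ∧ (∀ j, (N j : ℝ) ≤ 4 ^ (n - 1) * (b j * L)) ∧
      (∀ c ∈ Cs, Tc c ⊆ T ∧ (∀ k ∈ Tc c, ∀ j, |k j - c j| ≤ N j) ∧
        ∀ k ∈ T, k ∉ Tc c → ∃ j, 2 * (N j : ℤ) + 1 ≤ |k j - c j|) ∧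
      ∀ g : (Fin d → ℤ) → ℂ, ∑ k ∈ T, g k = ∑ c ∈ Cs, ∑ k ∈ Tc c, g k := by
  classical
  set near : ℝ → (Fin d → ℤ) → (Fin d → ℤ) → Prop :=
    fun r x y => ∀ j, ((|x j - y j| : ℤ) : ℝ) ≤ r * (b j * L) with hnear
  have hbL : ∀ j, 0 < b j * L := fun j => mul_pos (hb j) hL
  have : Nonempty (Fin n) := let ⟨k, hk⟩ := hT0; ⟨(hT k hk).choose⟩
  choose! l hl using hT
  have hrep : ∀ i : Fin n, ∃ c, (∃ k ∈ T, l k = i) → c ∈ T ∧ l c = i := fun i => by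
    by_cases h : ∃ k ∈ T, l k = i
    · obtain ⟨k, hk⟩ := h; exact ⟨k, fun _ => hk⟩
    · exact ⟨0, fun h' => absurd h' h⟩
  choose rep hrep using hrep
  set C0 : Finset (Fin d → ℤ) := Finset.univ.image rep with hC0
  have hcard : C0.card ≤ n := Finset.card_image_le.trans (by simp)
  have hcov : ∀ x ∈ (T : Set (Fin d → ℤ)), ∃ c ∈ C0, near 1 x c := by
    intro x hx
    obtain ⟨h1, h2⟩ := hrep (l x) ⟨x, hx, rfl⟩
    refine ⟨rep (l x), Finset.mem_image_of_mem _ (Finset.mem_univ _), fun j => ?_⟩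
    have h3 := hl x hx j
    have h4 := hl _ h1 j
    rw [h2] at h4
    rw [Set.mem_Icc] at h3 h4
    rw [le_div_iff₀ hL, div_le_iff₀ hL] at h3 h4
    push_cast
    rw [abs_le]
    constructor <;> nlinarith
  have hC0pos : 0 < C0.card := by
    obtain ⟨x, hx⟩ := hT0
    obtain ⟨c, hc, -⟩ := hcov x hx
    exact Finset.card_pos.2 ⟨c, hc⟩
  obtain ⟨Cs, hs, hne, ρ, hρ, hρ4, hcov', hsep, huniq⟩ := exists_separated (near := near)
    (fun {r s x y} hrs h j => (h j).trans (mul_le_mul_of_nonneg_right hrs (hbL j).le))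
    (fun {r x y} h j => by rw [abs_sub_comm]; exact h j)
    (fun {r s x y z} h h' j => by
      have h1 : |x j - z j| ≤ |x j - y j| + |y j - z j| := abs_sub_le _ _ _
      have h2 : ((|x j - z j| : ℤ) : ℝ) ≤ (|x j - y j| : ℤ) + (|y j - z j| : ℤ) := by exact_mod_cast h1
      have := h j
      have := h' j
      linarith) (C0.card - 1) C0 1 (by omega) one_pos hcov
  set N : Fin d → ℕ := fun j => ⌊ρ * (b j * L)⌋₊ with hN
  have hρb : ∀ j, 0 ≤ ρ * (b j * L) := fun j => mul_nonneg hρ.le (hbL j).le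
  have hnearN : ∀ x c, near ρ x c → ∀ j, |x j - c j| ≤ N j := by
    intro x c h j
    have h1 := h j
    rw [Int.abs_eq_natAbs, Int.cast_natCast] at h1
    rw [Int.abs_eq_natAbs]
    exact_mod_cast Nat.le_floor h1
  have hnear2 : ∀ x ∈ T, ∀ c ∈ Cs, ¬ near ρ x c → ∃ j, 2 * (N j : ℤ) + 1 ≤ |x j - c j| := by
    intro x hx c hc h
    have := hsep x hx c hc h
    simp only [hnear, not_forall, not_le] at this
    obtain ⟨j, hj⟩ := this
    refine ⟨j, ?_⟩
    have h1 : (N j : ℝ) ≤ ρ * (b j * L) := Nat.floor_le (hρb j)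
    have h2 : (2 * (N j : ℤ) : ℝ) < (|x j - c j| : ℤ) := by push_cast at hj ⊢; linarith
    have h3 : 2 * (N j : ℤ) < |x j - c j| := by exact_mod_cast h2
    omega
  refine ⟨Cs, N, fun c => T.filter (near ρ · c), hne, (Finset.card_le_card hs).trans hcard, ?_, ?_, ?_⟩
  · intro j
    refine (Nat.floor_le (hρb j)).trans (mul_le_mul_of_nonneg_right ?_ (hbL j).le)
    rw [mul_one] at hρ4
    exact hρ4.trans (pow_le_pow_right₀ (by norm_num) (by omega))
  · intro c hc
    refine ⟨Finset.filter_subset _ _, fun k hk => hnearN k c (Finset.mem_filter.1 hk).2,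
      fun k hk hk' => hnear2 k hk c hc fun h => hk' (Finset.mem_filter.2 ⟨hk, h⟩)⟩
  · intro g
    rw [← Finset.sum_biUnion]
    · congr 1
      ext k
      simp only [Finset.mem_biUnion, Finset.mem_filter]
      constructor
      · intro hk
        obtain ⟨c, hc, h⟩ := hcov' k hk
        exact ⟨c, hc, hk, h⟩
      · rintro ⟨c, -, h, -⟩; exact h
    · intro c hc c' hc' hcc
      rw [Function.onFun, Finset.disjoint_left]
      intro k hk hk'
      rw [Finset.mem_filter] at hk hk'
      exact hcc (huniq k c hc c' hc' hk.2 hk'.2)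

lemma eLpNorm_tsum_le {α : Type*} [MeasurableSpace α] {μ : Measure α} {p : ENNReal} (hp : 1 ≤ p)
    {f : ℕ → α → ENNReal} (hf : ∀ i, Measurable (f i)) :
    eLpNorm (fun x => ∑' i, f i x) p μ ≤ ∑' i, eLpNorm (f i) p μ := by
  rcases eq_or_ne p ⊤ with rfl | hptop
  · simp only [eLpNorm_exponent_top, eLpNormEssSup, enorm_eq_self]
    refine essSup_le_of_ae_le _ ?_
    have : ∀ᵐ x ∂μ, ∀ i, f i x ≤ essSup (f i) μ := ae_all_iff.2 fun i => ENNReal.ae_le_essSup (f i)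
    filter_upwards [this] with x hx
    exact ENNReal.tsum_le_tsum hx
  have hp0 : p ≠ 0 := (zero_lt_one.trans_le hp).ne'
  have hpr : 0 < p.toReal := ENNReal.toReal_pos hp0 hptop
  have hpart : ∀ n : ℕ, eLpNorm (fun x => ∑ i ∈ Finset.range n, f i x) p μ ≤ ∑' i, eLpNorm (f i) p μ := by
    intro n
    have h1 := eLpNorm_sum_le (μ := μ) (s := Finset.range n) (f := f)
      (fun i _ => (hf i).aestronglyMeasurable) hp
    have h2 : (∑ i ∈ Finset.range n, f i) = fun x => ∑ i ∈ Finset.range n, f i x := by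
      ext x; simp
    rw [h2] at h1
    exact h1.trans (ENNReal.sum_le_tsum _)
  rw [eLpNorm_eq_lintegral_rpow_enorm_toReal hp0 hptop, one_div,
    ENNReal.rpow_inv_le_iff hpr]
  simp only [enorm_eq_self]
  have h3 : ∀ x, (∑' i, f i x) ^ p.toReal = ⨆ n : ℕ, (∑ i ∈ Finset.range n, f i x) ^ p.toReal := by
    intro x
    rw [ENNReal.tsum_eq_iSup_nat]
    exact (ENNReal.orderIsoRpow p.toReal hpr).map_iSup _
  simp only [h3]
  rw [lintegral_iSup]
  · refine iSup_le fun n => ?_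
    have := hpart n
    rw [eLpNorm_eq_lintegral_rpow_enorm_toReal hp0 hptop, one_div,
      ENNReal.rpow_inv_le_iff hpr] at this
    simpa only [enorm_eq_self] using this
  · intro n
    exact (Finset.measurable_sum _ fun i _ => hf i).pow_const _
  · intro n n' h x
    exact ENNReal.rpow_le_rpow (Finset.sum_le_sum_of_subset (Finset.range_mono h)) hpr.le

lemma tsum_pow_div_factorial_tail {Z : ℝ} (hZ : 0 ≤ Z) (m : ℕ) :
    ∑' s : ℕ, ENNReal.ofReal (Z ^ (s + m) / (s + m).factorial) ≤
      ENNReal.ofReal (Z ^ m / m.factorial * exp Z) := by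
  have h1 : ∀ s : ℕ, Z ^ (s + m) / (s + m).factorial ≤
      Z ^ m / m.factorial * (Z ^ s / s.factorial) := by
    intro s
    have : s.factorial * m.factorial ≤ (s + m).factorial :=
      Nat.le_of_dvd (Nat.factorial_pos _) (Nat.factorial_mul_factorial_dvd_factorial_add s m)
    have h2 : (s.factorial * m.factorial : ℝ) ≤ (s + m).factorial := by exact_mod_cast this
    rw [div_mul_div_comm, pow_add, mul_comm (Z ^ s)]
    refine div_le_div_of_nonneg_left (by positivity) (by positivity) ?_
    rwa [mul_comm]
  have hsum : Summable fun s : ℕ => Z ^ s / s.factorial := Real.summable_pow_div_factorial Z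
  calc _ ≤ ∑' s : ℕ, ENNReal.ofReal (Z ^ m / m.factorial * (Z ^ s / s.factorial)) :=
        ENNReal.tsum_le_tsum fun s => ENNReal.ofReal_le_ofReal (h1 s)
    _ = ENNReal.ofReal (∑' s : ℕ, Z ^ m / m.factorial * (Z ^ s / s.factorial)) :=
        (ENNReal.ofReal_tsum_of_nonneg (fun s => by positivity) (hsum.mul_left _)).symm
    _ = _ := by rw [tsum_mul_left, Real.exp_eq_exp_ℝ, NormedSpace.exp_eq_tsum_div]

/-- A majorant for the remainder of the Taylor expansion of order `m` of the trigonometric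
polynomial `∑_{c ∈ Cs} ∑_{k ∈ Tc c} F k e^{i k·x/L}`, demodulated on each cluster. -/
noncomputable def taylorMajorant {d : ℕ} (L : ℝ) (m : ℕ) (A : Fin d → ℝ) (Cs : Finset (Fin d → ℤ))
    (Tc : (Fin d → ℤ) → Finset (Fin d → ℤ)) (F : (Fin d → ℤ) → ℂ) (z : Fin d → ℝ) : ENNReal :=
  ∑ c ∈ Cs, ∑' s : ℕ, ∑ w : Fin (s + m) → Fin d,
    ENNReal.ofReal ((∏ r, A (w r) / L) / (s + m).factorial) *
      ‖trigPoly L (Tc c) (fun k => (∏ r, ((k (w r) - c (w r) : ℤ) : ℂ)) * F k) z‖ₑ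

lemma measurable_taylorMajorant {d : ℕ} (L : ℝ) (m : ℕ) (A : Fin d → ℝ) (Cs : Finset (Fin d → ℤ))
    (Tc : (Fin d → ℤ) → Finset (Fin d → ℤ)) (F : (Fin d → ℤ) → ℂ) :
    Measurable (taylorMajorant L m A Cs Tc F) := by
  unfold taylorMajorant
  refine Finset.measurable_fun_sum _ fun c _ => Measurable.tsum fun s =>
    Finset.measurable_fun_sum _ fun w _ => ?_
  exact (continuous_trigPoly _ _ _).measurable.enorm.const_mul _

lemma eLpNorm_const_mul_enorm {α : Type*} [MeasurableSpace α]
    {μ : Measure α} {p : ENNReal} {a : ℝ} (ha : 0 ≤ a) (f : α → ℂ) :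
    eLpNorm (fun x => ENNReal.ofReal a * ‖f x‖ₑ) p μ = ENNReal.ofReal a * eLpNorm f p μ := by
  have h := eLpNorm_const_smul (a : ℂ) f p μ
  have h2 : ‖(a : ℂ)‖ₑ = ENNReal.ofReal a := by
    rw [← ofReal_norm, Complex.norm_real, Real.norm_of_nonneg ha]
  rw [← h2, ← h]
  refine eLpNorm_congr_enorm_ae (Filter.Eventually.of_forall fun x => ?_)
  simp [enorm_mul]

lemma eLpNorm_taylorMajorant_le {d : ℕ} {L : ℝ} (hL : 0 < L) {p : ENNReal} (hp : 1 ≤ p) (m : ℕ)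
    {A : Fin d → ℝ} (hA : ∀ j, 0 ≤ A j) {T : Finset (Fin d → ℤ)} {Cs : Finset (Fin d → ℤ)}
    {Tc : (Fin d → ℤ) → Finset (Fin d → ℤ)} {N : Fin d → ℕ}
    (h : ∀ c ∈ Cs, Tc c ⊆ T ∧ (∀ k ∈ Tc c, ∀ j, |k j - c j| ≤ N j) ∧
        ∀ k ∈ T, k ∉ Tc c → ∃ j, 2 * (N j : ℤ) + 1 ≤ |k j - c j|) (F : (Fin d → ℤ) → ℂ) {Z : ℝ}
    (hZ : ∑ j, A j / L * (2 * N j) ≤ Z) :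
    eLpNorm (taylorMajorant L m A Cs Tc F) p (volume.restrict (torusCube d L)) ≤
      ENNReal.ofReal (Cs.card * 3 ^ d * (Z ^ m / m.factorial * exp Z)) *
        eLpNorm (trigPoly L T F) p (volume.restrict (torusCube d L)) := by
  set μ := volume.restrict (torusCube d L)
  set Z₀ := ∑ j, A j / L * (2 * N j) with hZ₀
  have hAL : ∀ j, 0 ≤ A j / L := fun j => div_nonneg (hA j) hL.le
  have hZ₀0 : 0 ≤ Z₀ := Finset.sum_nonneg fun j _ => mul_nonneg (hAL j) (by positivity)
  have hZ0 : 0 ≤ Z := hZ₀0.trans hZ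
  have hterm : ∀ c ∈ Cs, ∀ s : ℕ, ∀ w : Fin (s + m) → Fin d,
      eLpNorm (fun z => ENNReal.ofReal ((∏ r, A (w r) / L) / (s + m).factorial) *
        ‖trigPoly L (Tc c) (fun k => (∏ r, ((k (w r) - c (w r) : ℤ) : ℂ)) * F k) z‖ₑ) p μ ≤
      ENNReal.ofReal ((∏ r, (A (w r) / L * (2 * N (w r)))) / (s + m).factorial) *
        (ENNReal.ofReal (3 ^ d) * eLpNorm (trigPoly L T F) p μ) := by
    intro c hc s w
    obtain ⟨h1, h2, h3⟩ := h c hc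
    rw [eLpNorm_const_mul_enorm (div_nonneg (Finset.prod_nonneg fun r _ => hAL _) (by positivity))]
    have h4 := MulBound.prod (L := L) (p := p) (T := Tc c) Finset.univ
      (m := fun r k => ((k (w r) - c (w r) : ℤ) : ℂ)) (A := fun r => 2 * (N (w r) : ℝ))
      (fun r _ => mulBound_deriv hL hp (Tc c) (w r) (c (w r)) (N (w r)) fun k hk => h2 k hk (w r))
      (fun r _ => by positivity) F
    have h5 := eLpNorm_trigPoly_filter_le hL hp T (Tc c) h1 c N h2 h3 F
    refine (mul_le_mul_right (h4.trans (mul_le_mul_right h5 _)) _).trans (le_of_eq ?_)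
    rw [← mul_assoc, ← ENNReal.ofReal_mul (div_nonneg (Finset.prod_nonneg fun r _ => hAL _)
      (by positivity)), div_mul_eq_mul_div]
    simp only [Finset.prod_mul_distrib, μ]
  have hsum : ∀ c ∈ Cs, eLpNorm (fun z => ∑' s : ℕ, ∑ w : Fin (s + m) → Fin d,
      ENNReal.ofReal ((∏ r, A (w r) / L) / (s + m).factorial) *
        ‖trigPoly L (Tc c) (fun k => (∏ r, ((k (w r) - c (w r) : ℤ) : ℂ)) * F k) z‖ₑ) p μ ≤
      ENNReal.ofReal (Z ^ m / m.factorial * exp Z) *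
        (ENNReal.ofReal (3 ^ d) * eLpNorm (trigPoly L T F) p μ) := by
    intro c hc
    have hmeas : ∀ s : ℕ, ∀ w : Fin (s + m) → Fin d, Measurable fun z =>
      ENNReal.ofReal ((∏ r, A (w r) / L) / (s + m).factorial) *
        ‖trigPoly L (Tc c) (fun k => (∏ r, ((k (w r) - c (w r) : ℤ) : ℂ)) * F k) z‖ₑ :=
      fun s w => (continuous_trigPoly _ _ _).measurable.enorm.const_mul _
    refine (eLpNorm_tsum_le hp fun s => Finset.measurable_fun_sum _ fun w _ => hmeas s w).trans ?_
    refine le_trans ?_ (mul_le_mul_left (tsum_pow_div_factorial_tail hZ0 m) _)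
    rw [← ENNReal.tsum_mul_right]
    refine ENNReal.tsum_le_tsum fun s => ?_
    have h6 := eLpNorm_sum_le (μ := μ) (s := Finset.univ)
      (f := fun (w : Fin (s + m) → Fin d) z =>
        ENNReal.ofReal ((∏ r, A (w r) / L) / (s + m).factorial) *
        ‖trigPoly L (Tc c) (fun k => (∏ r, ((k (w r) - c (w r) : ℤ) : ℂ)) * F k) z‖ₑ)
      (fun w _ => (hmeas s w).aestronglyMeasurable) hp
    rw [Finset.sum_fn] at h6
    refine h6.trans ((Finset.sum_le_sum fun w _ => hterm c hc s w).trans ?_)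
    rw [← Finset.sum_mul, ← ENNReal.ofReal_sum_of_nonneg (fun w _ => div_nonneg
      (Finset.prod_nonneg fun r _ => mul_nonneg (hAL _) (by positivity)) (by positivity)),
      ← Finset.sum_div, ← Fintype.sum_pow (fun j => A j / L * (2 * (N j : ℝ))) (s + m)]
    gcongr
  have h7 := eLpNorm_sum_le (μ := μ) (s := Cs) (p := p)
      (f := fun c z => ∑' s : ℕ, ∑ w : Fin (s + m) → Fin d,
      ENNReal.ofReal ((∏ r, A (w r) / L) / (s + m).factorial) *
        ‖trigPoly L (Tc c) (fun k => (∏ r, ((k (w r) - c (w r) : ℤ) : ℂ)) * F k) z‖ₑ)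
      (fun c _ => (Measurable.tsum fun s => Finset.measurable_fun_sum _ fun w _ =>
        (continuous_trigPoly _ _ _).measurable.enorm.const_mul _).aestronglyMeasurable) hp
  rw [Finset.sum_fn] at h7
  refine h7.trans ((Finset.sum_le_sum hsum).trans (le_of_eq ?_))
  rw [Finset.sum_const, nsmul_eq_mul, ← mul_assoc, ← mul_assoc, ← ENNReal.ofReal_natCast,
    ← ENNReal.ofReal_mul (by positivity), ← ENNReal.ofReal_mul (by positivity)]
  congr 2
  ring

/-- The phase `k · x / L`. -/
noncomputable def phase {d : ℕ} (L : ℝ) (k : Fin d → ℤ) (x : Fin d → ℝ) : ℝ := ∑ j, x j * (k j : ℝ) / L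

/-- The demodulated Taylor polynomial around `z`. -/
noncomputable def clusterTaylor {d : ℕ} (L : ℝ) (m : ℕ) (Cs : Finset (Fin d → ℤ))
    (Tc : (Fin d → ℤ) → Finset (Fin d → ℤ)) (F : (Fin d → ℤ) → ℂ) (z x : Fin d → ℝ) : ℂ :=
  ∑ c ∈ Cs, ∑ k ∈ Tc c, F k * Complex.exp (Complex.I * phase L (k - c) z) *
    (∑ s ∈ Finset.range m, (Complex.I * phase L (k - c) (x - z)) ^ s / (s.factorial : ℂ)) *
      Complex.exp (Complex.I * phase L c x)

section phase
variable {d : ℕ} (L : ℝ) (k c : Fin d → ℤ) (x y : Fin d → ℝ)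

lemma phase_add_right : phase L k (x + y) = phase L k x + phase L k y := by
  simp [phase, add_mul, add_div, Finset.sum_add_distrib]

lemma phase_add_left : phase L (k + c) x = phase L k x + phase L c x := by
  simp [phase, mul_add, add_div, Finset.sum_add_distrib]

lemma phase_smul (t : ℝ) : phase L k (t • x) = t * phase L k x := by
  simp only [phase, Finset.mul_sum, Pi.smul_apply, smul_eq_mul]
  exact Finset.sum_congr rfl fun j _ => by ring

end phase

lemma trigPoly_eq_clusters {d : ℕ} {L : ℝ} {T Cs : Finset (Fin d → ℤ)}
    {Tc : (Fin d → ℤ) → Finset (Fin d → ℤ)}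
    (h : ∀ g : (Fin d → ℤ) → ℂ, ∑ k ∈ T, g k = ∑ c ∈ Cs, ∑ k ∈ Tc c, g k) (F : (Fin d → ℤ) → ℂ)
    (z x : Fin d → ℝ) :
    trigPoly L T F x = ∑ c ∈ Cs, ∑ k ∈ Tc c, F k * Complex.exp (Complex.I * phase L (k - c) z) *
      Complex.exp (Complex.I * phase L (k - c) (x - z)) * Complex.exp (Complex.I * phase L c x) := by
  rw [trigPoly, h]
  refine Finset.sum_congr rfl fun c _ => Finset.sum_congr rfl fun k _ => ?_
  rw [mul_assoc, mul_assoc, ← Complex.exp_add, ← Complex.exp_add, ← mul_add, ← mul_add,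
    ← Complex.ofReal_add, ← Complex.ofReal_add]
  congr 4
  have h1 : phase L k x = phase L (k - c) x + phase L c x := by
    rw [← phase_add_left, sub_add_cancel]
  have h2 : phase L (k - c) x = phase L (k - c) z + phase L (k - c) (x - z) := by
    rw [← phase_add_right, add_sub_cancel]
  change phase L k x = _
  rw [h1, h2, add_assoc]

lemma clusterTaylor_self {d : ℕ} {L : ℝ} {m : ℕ} (hm : 0 < m) {T Cs : Finset (Fin d → ℤ)}
    {Tc : (Fin d → ℤ) → Finset (Fin d → ℤ)}
    (h : ∀ g : (Fin d → ℤ) → ℂ, ∑ k ∈ T, g k = ∑ c ∈ Cs, ∑ k ∈ Tc c, g k) (F : (Fin d → ℤ) → ℂ)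
    (z : Fin d → ℝ) : clusterTaylor L m Cs Tc F z z = trigPoly L T F z := by
  rw [trigPoly_eq_clusters h F z z, clusterTaylor]
  have h0 : ∀ k : Fin d → ℤ, phase L k 0 = 0 := fun k => by simp [phase]
  have h1 : ∑ s ∈ Finset.range m, (0 : ℂ) ^ s / (s.factorial : ℂ) = 1 := by
    rw [Finset.sum_eq_single_of_mem 0 (Finset.mem_range.2 hm) fun s _ hs => by simp [hs]]
    simp
  simp only [sub_self, h0, Complex.ofReal_zero, mul_zero, h1, Complex.exp_zero]

/-- Taylor's formula for the demodulated clusters. -/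
lemma enorm_sub_clusterTaylor_le {d : ℕ} {L : ℝ} (hL : 0 < L) (m : ℕ) {A : Fin d → ℝ}
    {T Cs : Finset (Fin d → ℤ)} {Tc : (Fin d → ℤ) → Finset (Fin d → ℤ)}
    (h : ∀ g : (Fin d → ℤ) → ℂ, ∑ k ∈ T, g k = ∑ c ∈ Cs, ∑ k ∈ Tc c, g k) (F : (Fin d → ℤ) → ℂ)
    {z x : Fin d → ℝ} (hx : ∀ j, |x j - z j| ≤ A j) :
    ‖trigPoly L T F x - clusterTaylor L m Cs Tc F z x‖ₑ ≤ taylorMajorant L m A Cs Tc F z := by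
  rw [trigPoly_eq_clusters h F z x, clusterTaylor, ← Finset.sum_sub_distrib, taylorMajorant]
  refine (enorm_sum_le _ _).trans (Finset.sum_le_sum fun c _ => ?_)
  have hexp : ∀ w : ℂ, HasSum (fun s : ℕ => w ^ (s + m) / ((s + m).factorial : ℂ))
      (Complex.exp w - ∑ s ∈ Finset.range m, w ^ s / (s.factorial : ℂ)) := by
    intro w
    rw [hasSum_nat_add_iff' m (f := fun s => w ^ s / (s.factorial : ℂ)), Complex.exp_eq_exp_ℂ]
    exact NormedSpace.expSeries_div_hasSum_exp w
  have hpow : ∀ (s : ℕ) (k : Fin d → ℤ), (Complex.I * phase L (k - c) (x - z)) ^ s =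
      Complex.I ^ s * ∑ w : Fin s → Fin d, ((∏ r, ((x (w r) - z (w r)) / L) : ℝ) : ℂ) *
        ∏ r, ((k (w r) - c (w r) : ℤ) : ℂ) := by
    intro s k
    rw [mul_pow]
    congr 1
    rw [phase, Complex.ofReal_sum, Fintype.sum_pow]
    refine Finset.sum_congr rfl fun w _ => ?_
    rw [Complex.ofReal_prod, ← Finset.prod_mul_distrib]
    refine Finset.prod_congr rfl fun r _ => ?_
    simp only [Pi.sub_apply]
    push_cast
    ring
  have hS : HasSum (fun s : ℕ => ∑ k ∈ Tc c, F k * Complex.exp (Complex.I * phase L (k - c) z) *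
      ((Complex.I * phase L (k - c) (x - z)) ^ (s + m) / ((s + m).factorial : ℂ)) *
        Complex.exp (Complex.I * phase L c x))
      (∑ k ∈ Tc c, F k * Complex.exp (Complex.I * phase L (k - c) z) *
      Complex.exp (Complex.I * phase L (k - c) (x - z)) * Complex.exp (Complex.I * phase L c x) -
      ∑ k ∈ Tc c, F k * Complex.exp (Complex.I * phase L (k - c) z) *
      (∑ s ∈ Finset.range m, (Complex.I * phase L (k - c) (x - z)) ^ s / (s.factorial : ℂ)) *
        Complex.exp (Complex.I * phase L c x)) := by
    rw [← Finset.sum_sub_distrib]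
    refine hasSum_sum fun k _ => ?_
    rw [← sub_mul, ← mul_sub]
    exact ((hexp _).mul_left _).mul_right _
  rw [← hS.tsum_eq]
  refine (enorm_tsum_le_tsum_enorm).trans (ENNReal.tsum_le_tsum fun s => ?_)
  have e1 : ∑ k ∈ Tc c, F k * Complex.exp (Complex.I * phase L (k - c) z) *
      ((Complex.I * phase L (k - c) (x - z)) ^ (s + m) / ((s + m).factorial : ℂ)) *
        Complex.exp (Complex.I * phase L c x) =
      ∑ w : Fin (s + m) → Fin d, (Complex.I ^ (s + m) * Complex.exp (Complex.I * phase L c x) *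
        Complex.exp (-(Complex.I * phase L c z)) *
        (((∏ r, ((x (w r) - z (w r)) / L)) / (s + m).factorial : ℝ) : ℂ)) *
        trigPoly L (Tc c) (fun k => (∏ r, ((k (w r) - c (w r) : ℤ) : ℂ)) * F k) z := by
    simp only [trigPoly, Finset.mul_sum]
    rw [Finset.sum_comm]
    refine Finset.sum_congr rfl fun k _ => ?_
    have h3 : Complex.exp (Complex.I * ((∑ j, z j * (k j : ℝ) / L : ℝ) : ℂ)) =
        Complex.exp (Complex.I * phase L c z) * Complex.exp (Complex.I * phase L (k - c) z) := by
      rw [← Complex.exp_add, ← mul_add, ← Complex.ofReal_add, ← phase_add_left, add_sub_cancel]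
      rfl
    have h4 : Complex.exp (-(Complex.I * phase L c z)) * Complex.exp (Complex.I * phase L c z) = 1 := by
      rw [← Complex.exp_add, neg_add_cancel, Complex.exp_zero]
    rw [hpow, h3, mul_div_assoc, Finset.sum_div, Finset.mul_sum, Finset.mul_sum, Finset.sum_mul]
    refine Finset.sum_congr rfl fun w _ => ?_
    push_cast
    linear_combination (-(F k * Complex.exp (Complex.I * phase L (k - c) z) * Complex.I ^ (s + m) *
      (∏ r, (((x (w r) : ℂ) - z (w r)) / L)) * (∏ r, ((k (w r) : ℂ) - c (w r))) / (s + m).factorial *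
      Complex.exp (Complex.I * phase L c x))) * h4
  rw [e1]
  refine (enorm_sum_le _ _).trans (Finset.sum_le_sum fun w _ => ?_)
  rw [enorm_mul]
  refine mul_le_mul_left ?_ _
  have hn : ∀ r : ℝ, ‖Complex.exp (Complex.I * r)‖ = 1 := fun r => by
    rw [mul_comm, Complex.norm_exp_ofReal_mul_I]
  have hn' : ∀ r : ℝ, ‖Complex.exp (-(Complex.I * r))‖ = 1 := fun r => by
    rw [← mul_neg, ← Complex.ofReal_neg, hn]
  rw [← ofReal_norm]
  refine ENNReal.ofReal_le_ofReal ?_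
  rw [norm_mul, norm_mul, norm_mul, norm_pow, Complex.norm_I, one_pow, hn, hn', one_mul, one_mul,
    one_mul, Complex.norm_real, norm_div, Real.norm_natCast, norm_prod]
  refine div_le_div_of_nonneg_right (Finset.prod_le_prod (fun _ _ => norm_nonneg _) fun r _ => ?_)
    (by positivity)
  rw [norm_div, Real.norm_eq_abs, Real.norm_of_nonneg hL.le]
  exact div_le_div_of_nonneg_right (hx _) hL.le

/-- Restricted to a line, the demodulated Taylor polynomial is an exponential polynomial. -/
lemma clusterTaylor_line_mem_expPoly {d : ℕ} (L : ℝ) (m : ℕ) (Cs : Finset (Fin d → ℤ))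
    (Tc : (Fin d → ℤ) → Finset (Fin d → ℤ)) (F : (Fin d → ℤ) → ℂ) (z y u : Fin d → ℝ) :
    ∃ ν : Cs → ℝ, ∃ p ∈ expPoly ν (fun _ => m), ∀ t : ℝ,
      clusterTaylor L m Cs Tc F z (y + t • u) = p t := by
  refine ⟨fun c => phase L c.1 u, _, ⟨fun c => ∑ k ∈ Tc c.1, ∑ s ∈ Finset.range m,
    Polynomial.C (F k * Complex.exp (Complex.I * phase L (k - c.1) z) * Complex.exp (Complex.I * phase L c.1 y) *
      (Complex.I ^ s / (s.factorial : ℂ))) *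
      (Polynomial.C (phase L (k - c.1) (y - z) : ℂ) + Polynomial.C (phase L (k - c.1) u : ℂ) * Polynomial.X) ^ s,
    fun c => ?_, rfl⟩, fun t => ?_⟩
  · refine Submodule.sum_mem _ fun k _ => Submodule.sum_mem _ fun s hs => ?_
    rw [Polynomial.C_mul']
    refine Submodule.smul_mem _ _ ?_
    rw [Polynomial.mem_degreeLT]
    refine lt_of_le_of_lt (b := (s : WithBot ℕ)) ?_ (by exact_mod_cast Finset.mem_range.1 hs)
    refine (Polynomial.degree_pow_le _ _).trans ?_
    have h1 : (Polynomial.C (phase L (k - c.1) (y - z) : ℂ) +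
        Polynomial.C (phase L (k - c.1) u : ℂ) * Polynomial.X).degree ≤ 1 := by
      rw [add_comm]; exact Polynomial.degree_linear_le
    refine (nsmul_le_nsmul_right h1 s).trans ?_
    simp
  · rw [clusterTaylor, ← Finset.sum_coe_sort Cs]
    refine Finset.sum_congr rfl fun c _ => ?_
    rw [Polynomial.eval_finsetSum, Finset.sum_mul]
    refine Finset.sum_congr rfl fun k _ => ?_
    have e1 : phase L (k - c.1) (y + t • u - z) = phase L (k - c.1) (y - z) + t * phase L (k - c.1) u := by
      rw [← phase_smul, ← phase_add_right]; congr 1; abel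
    have e2 : Complex.exp (Complex.I * phase L c.1 (y + t • u)) =
        Complex.exp (Complex.I * phase L c.1 y) * Complex.exp (Complex.I * phase L c.1 u * t) := by
      rw [phase_add_right, phase_smul, ← Complex.exp_add]; congr 1; push_cast; ring
    rw [Polynomial.eval_finsetSum, e1, e2, Finset.mul_sum, Finset.sum_mul, Finset.sum_mul]
    refine Finset.sum_congr rfl fun s _ => ?_
    simp only [Polynomial.eval_mul, Polynomial.eval_C, Polynomial.eval_pow, Polynomial.eval_add,
      Polynomial.eval_X]
    push_cast
    rw [mul_pow]
    ring

lemma exists_cells {d : ℕ} {L : ℝ} (hL : 0 < L) {a : Fin d → ℝ}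
    (ha : ∀ j, 0 < a j ∧ a j ≤ 2 * π * L) {γ : ℝ} (hγ : 0 < γ) {S : Set (Fin d → ℝ)}
    (hS : ∀ x : Fin d → ℝ, volume (S ∩ Set.univ.pi fun i => Set.Icc (x i) (x i + a i)) ≥
      ENNReal.ofReal (γ * ∏ i, a i)) :
    ∃ (ι : Type) (_ : Fintype ι) (Q : ι → Set (Fin d → ℝ)),
      (∀ i, MeasurableSet (Q i)) ∧ (∀ i, Convex ℝ (Q i)) ∧ (∀ i, volume (Q i) ≠ 0) ∧
      (∀ i, volume (Q i) ≠ ⊤) ∧ Pairwise (Function.onFun Disjoint Q) ∧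
      (⋃ i, Q i) = Set.univ.pi (fun _ => Set.Ico 0 (2 * π * L)) ∧
      (∀ i, ∀ x ∈ Q i, ∀ z ∈ Q i, ∀ j, |x j - z j| ≤ 2 * a j) ∧
      ∀ i, ENNReal.ofReal (γ / 2 ^ d) * volume (Q i) ≤ volume (S ∩ Q i) := by
  have hP : 0 < 2 * π * L := by positivity
  set K : Fin d → ℕ := fun j => ⌊2 * π * L / a j⌋₊ with hK
  have hK1 : ∀ j, 1 ≤ K j := fun j => Nat.le_floor (by
    rw [Nat.cast_one, le_div_iff₀ (ha j).1, one_mul]; exact (ha j).2)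
  have hK0 : ∀ j, (0 : ℝ) < K j := fun j => by exact_mod_cast hK1 j
  set A : Fin d → ℝ := fun j => 2 * π * L / K j with hA
  have hA0 : ∀ j, 0 < A j := fun j => div_pos hP (hK0 j)
  have hKA : ∀ j, A j * K j = 2 * π * L := fun j => div_mul_cancel₀ _ (hK0 j).ne'
  have haA : ∀ j, a j ≤ A j := fun j => by
    rw [hA, le_div_iff₀ (hK0 j), mul_comm, ← le_div_iff₀ (ha j).1]
    exact Nat.floor_le (div_pos hP (ha j).1).le
  have hAa : ∀ j, A j ≤ 2 * a j := fun j => by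
    rw [hA, div_le_iff₀ (hK0 j)]
    have h1 : 2 * π * L / a j < K j + 1 := Nat.lt_floor_add_one _
    rw [div_lt_iff₀ (ha j).1] at h1
    have h2 : (1 : ℝ) ≤ K j := by exact_mod_cast hK1 j
    nlinarith [(ha j).1]
  set Q : (∀ j, Fin (K j)) → Set (Fin d → ℝ) :=
    fun i => Set.univ.pi fun j => Set.Ico (A j * (i j : ℕ)) (A j * (i j : ℕ) + A j) with hQ
  have hvol : ∀ i, volume (Q i) = ENNReal.ofReal (∏ j, A j) := fun i => by
    rw [hQ, Real.volume_pi_Ico]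
    simp only [add_sub_cancel_left]
    rw [ENNReal.ofReal_prod_of_nonneg fun j _ => (hA0 j).le]
  have hprod : 0 < ∏ j, A j := Finset.prod_pos fun j _ => hA0 j
  refine ⟨∀ j, Fin (K j), inferInstance, Q, fun i => MeasurableSet.univ_pi fun _ => measurableSet_Ico,
    fun i => convex_pi fun _ _ => convex_Ico _ _, fun i => ?_, fun i => ?_, ?_, ?_, ?_, ?_⟩
  · rw [hvol]; exact (ENNReal.ofReal_pos.2 hprod).ne'
  · rw [hvol]; exact ENNReal.ofReal_ne_top
  · intro i i' hii
    rw [Function.onFun, Set.disjoint_left]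
    intro x hx hx'
    refine hii (funext fun j => Fin.ext ?_)
    have h1 := hx j (Set.mem_univ j)
    have h2 := hx' j (Set.mem_univ j)
    rw [Set.mem_Ico, ← mul_add_one] at h1 h2
    have h3 : ((i j : ℕ) : ℝ) < (i' j : ℕ) + 1 := lt_of_mul_lt_mul_left (h1.1.trans_lt h2.2) (hA0 j).le
    have h4 : ((i' j : ℕ) : ℝ) < (i j : ℕ) + 1 := lt_of_mul_lt_mul_left (h2.1.trans_lt h1.2) (hA0 j).le
    have h5 : (i j : ℕ) < (i' j : ℕ) + 1 := by exact_mod_cast h3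
    have h6 : (i' j : ℕ) < (i j : ℕ) + 1 := by exact_mod_cast h4
    omega
  · ext x
    simp only [Set.mem_iUnion, hQ, Set.mem_univ_pi, Set.mem_Ico]
    constructor
    · rintro ⟨i, hi⟩ j
      refine ⟨le_trans (mul_nonneg (hA0 j).le (Nat.cast_nonneg _)) (hi j).1, (hi j).2.trans_le ?_⟩
      rw [← hKA, ← mul_add_one]
      refine mul_le_mul_of_nonneg_left ?_ (hA0 j).le
      exact_mod_cast (i j).2
    · intro hx
      have h1 : ∀ j, ⌊x j / A j⌋₊ < K j := fun j => by
        rw [Nat.floor_lt (div_nonneg (hx j).1 (hA0 j).le), div_lt_iff₀ (hA0 j), mul_comm, hKA]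
        exact (hx j).2
      refine ⟨fun j => ⟨_, h1 j⟩, fun j => ⟨?_, ?_⟩⟩
      · rw [mul_comm, ← le_div_iff₀ (hA0 j)]
        exact Nat.floor_le (div_nonneg (hx j).1 (hA0 j).le)
      · rw [← mul_add_one, mul_comm, ← div_lt_iff₀ (hA0 j)]
        exact Nat.lt_floor_add_one _
  · intro i x hx z hz j
    have h1 := hx j (Set.mem_univ j)
    have h2 := hz j (Set.mem_univ j)
    rw [Set.mem_Ico] at h1 h2
    have := hAa j
    rw [abs_le]; constructor <;> linarith
  · intro i
    set x₀ : Fin d → ℝ := fun j => A j * (i j : ℕ) with hx₀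
    have h1 : (Set.univ.pi fun j => Set.Ico (x₀ j) (x₀ j + a j)) ⊆ Q i :=
      Set.pi_mono fun j _ => Set.Ico_subset_Ico_right (by have := haA j; simp only [hx₀]; linarith)
    have h2 : volume (S ∩ Set.univ.pi fun j => Set.Ico (x₀ j) (x₀ j + a j)) =
        volume (S ∩ Set.univ.pi fun j => Set.Icc (x₀ j) (x₀ j + a j)) := by
      refine measure_congr ((Filter.EventuallyEq.refl _ _).inter ?_)
      have := Measure.univ_pi_Ico_ae_eq_Icc (μ := fun _ : Fin d => (volume : Measure ℝ))
        (f := x₀) (g := fun j => x₀ j + a j)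
      rwa [← Set.pi_univ_Icc] at this
    refine le_trans ?_ (measure_mono (Set.inter_subset_inter_right S h1))
    rw [h2]
    refine le_trans ?_ (hS x₀)
    rw [hvol, ← ENNReal.ofReal_mul (by positivity)]
    refine ENNReal.ofReal_le_ofReal ?_
    have h3 : ∏ j, A j ≤ 2 ^ d * ∏ j, a j := by
      calc ∏ j, A j ≤ ∏ j, 2 * a j := Finset.prod_le_prod (fun j _ => (hA0 j).le) fun j _ => hAa j
        _ = _ := by rw [Finset.prod_mul_distrib]; simp
    rw [div_mul_eq_mul_div, div_le_iff₀ (by positivity), mul_assoc, mul_comm _ (2 ^ d : ℝ)]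
    exact mul_le_mul_of_nonneg_left h3 hγ.le

lemma half_measure_le {α : Type*} [MeasurableSpace α] {μ : Measure α} {G : Set α}
    (hG0 : μ G ≠ 0) (hGt : μ G ≠ ⊤) {g : α → ENNReal} (hg : Measurable g)
    (hI : ∫⁻ x in G, g x ∂μ ≠ ⊤) :
    μ G / 2 ≤ μ (G ∩ {x | g x ≤ 2 / μ G * ∫⁻ x in G, g x ∂μ}) := by
  set I := ∫⁻ x in G, g x ∂μ with hIdef
  set t := 2 / μ G * I with ht
  have hB : μ (G ∩ {x | t < g x}) ≤ μ G / 2 := by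
    rcases eq_or_ne I 0 with h0 | h0
    · have h1 : g =ᵐ[μ.restrict G] 0 := (lintegral_eq_zero_iff hg).1 h0
      have h2 : μ (G ∩ {x | t < g x}) = 0 := by
        rw [Set.inter_comm, ← Measure.restrict_apply (measurableSet_lt measurable_const hg)]
        refine measure_mono_null (fun x hx => ?_) h1
        exact (lt_of_le_of_lt (zero_le) hx).ne'
      rw [h2]; exact zero_le
    · have h1 : t * μ (G ∩ {x | t < g x}) ≤ I := by
        rw [Set.inter_comm, ← Measure.restrict_apply (measurableSet_lt measurable_const hg)]
        refine le_trans (mul_le_mul_right (measure_mono fun x hx => ?_) t)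
          (mul_meas_ge_le_lintegral hg t)
        exact le_of_lt (show t < g x from hx)
      rw [ENNReal.le_div_iff_mul_le (by simp) (by simp)]
      have h2 : 2 / μ G * μ (G ∩ {x | t < g x}) * I ≤ 1 * I := by
        rw [one_mul]; refine le_trans (le_of_eq ?_) h1; rw [ht]; ring
      have h3 := (ENNReal.mul_le_mul_iff_left h0 hI).1 h2
      have h4 := mul_le_mul_left h3 (μ G)
      rw [one_mul] at h4
      refine le_trans (le_of_eq ?_) h4
      rw [mul_right_comm, ENNReal.div_mul_cancel hG0 hGt, mul_comm]
  have hun : μ G ≤ μ (G ∩ {x | g x ≤ t}) + μ (G ∩ {x | t < g x}) := by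
    refine le_trans (measure_mono fun x hx => ?_) (measure_union_le _ _)
    rcases le_or_gt (g x) t with h | h
    · exact Or.inl ⟨hx, h⟩
    · exact Or.inr ⟨hx, h⟩
  have hfin : μ G / 2 ≠ ⊤ := ENNReal.div_ne_top hGt (by simp)
  have h5 := hun.trans (add_le_add_right hB _)
  exact (ENNReal.add_le_add_iff_right hfin).1 ((ENNReal.add_halves (μ G)).le.trans h5)

lemma enorm_trigPoly_le_of_cell {d : ℕ} {L : ℝ} (hL : 0 < L) {m N : ℕ} (hm : 0 < m) {A : Fin d → ℝ}
    {T Cs : Finset (Fin d → ℤ)} {Tc : (Fin d → ℤ) → Finset (Fin d → ℤ)} (hN : Cs.card * m = N + 1)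
    (h : ∀ g : (Fin d → ℤ) → ℂ, ∑ k ∈ T, g k = ∑ c ∈ Cs, ∑ k ∈ Tc c, g k) (F : (Fin d → ℤ) → ℂ)
    {Q E : Set (Fin d → ℝ)} (hQm : MeasurableSet Q) (hQc : Convex ℝ Q)
    (hQ0 : volume Q ≠ 0) (hQfin : volume Q ≠ ⊤) (hE : MeasurableSet E)
    (hEQ : E ⊆ Q) {v : ℝ} (hv : 0 < v) (hvE : ENNReal.ofReal v * volume Q ≤ volume E)
    (hQA : ∀ x ∈ Q, ∀ z ∈ Q, ∀ j, |x j - z j| ≤ A j) {τ : ENNReal}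
    (hτ : ∀ x ∈ E, ‖trigPoly L T F x‖ₑ ≤ τ) {z : Fin d → ℝ} (hz : z ∈ Q) :
    ‖trigPoly L T F z‖ₑ ≤ ENNReal.ofReal ((3900 * exp 16 * 2 ^ d / v) ^ N) *
      (τ + taylorMajorant L m A Cs Tc F z) := by
  have hpos : 0 < (3900 * exp 16 * 2 ^ d / v) ^ N := by positivity
  by_cases htop : τ + taylorMajorant L m A Cs Tc F z = ⊤
  · rw [htop, ENNReal.mul_top (ENNReal.ofReal_pos.2 hpos).ne']; exact le_top
  have key := remez_convex (ι := Cs) (m := m) (N := N) (by simpa using hN)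
    (P := clusterTaylor L m Cs Tc F z) (fun y u => clusterTaylor_line_mem_expPoly L m Cs Tc F z y u)
    hQm hQc hQ0 hQfin hE hEQ hv hvE (δ := (τ + taylorMajorant L m A Cs Tc F z).toReal) (fun x hx => ?_)
    hz
  · rw [clusterTaylor_self hm h] at key
    rw [← ENNReal.ofReal_toReal htop, ← ENNReal.ofReal_mul hpos.le, ← ofReal_norm]
    exact ENNReal.ofReal_le_ofReal key
  · rw [← ENNReal.ofReal_le_iff_le_toReal htop, ofReal_norm]
    have h1 := enorm_sub_clusterTaylor_le hL m h F (hQA x (hEQ hx) z hz)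
    have h2 : clusterTaylor L m Cs Tc F z x = trigPoly L T F x -
      (trigPoly L T F x - clusterTaylor L m Cs Tc F z x) := by ring
    rw [h2]
    exact (enorm_sub_le).trans (add_le_add (hτ x hx) h1)

lemma torusCube_ae_eq_Ico (d : ℕ) (L : ℝ) :
    (Set.univ.pi fun _ : Fin d => Set.Ico (0 : ℝ) (2 * π * L)) =ᵐ[volume] torusCube d L := by
  have := Measure.univ_pi_Ico_ae_eq_Icc (μ := fun _ : Fin d => (volume : Measure ℝ))
    (f := fun _ => 0) (g := fun _ => 2 * π * L)
  rwa [← Set.pi_univ_Icc] at this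

lemma eLpNorm_le_of_cells {X ι : Type*} [MeasurableSpace X] [Fintype ι] {μ : Measure X} {p : ENNReal}
    (hp : 1 ≤ p) {S : Set X} (hS : MeasurableSet S) {Q : ι → Set X} (hQm : ∀ i, MeasurableSet (Q i))
    (hQ0 : ∀ i, μ (Q i) ≠ 0) (hQfin : ∀ i, μ (Q i) ≠ ⊤) (hQd : Pairwise (Function.onFun Disjoint Q))
    {v : ℝ} (hv : 0 < v) (hvQ : ∀ i, ENNReal.ofReal v * μ (Q i) ≤ μ (S ∩ Q i))
    {f : X → ℂ} (hf : Measurable f) {M : ℝ} (hM : ∀ x, ‖f x‖ ≤ M) {R : X → ENNReal}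
    (hR : Measurable R) {B : ENNReal}
    (h : ∀ i, ∀ E ⊆ Q i, MeasurableSet E → ENNReal.ofReal (v / 2) * μ (Q i) ≤ μ E → ∀ τ : ENNReal,
      (∀ x ∈ E, ‖f x‖ₑ ≤ τ) → ∀ z ∈ Q i, ‖f z‖ₑ ≤ B * (τ + R z)) (hB : B ≠ ⊤) :
    eLpNorm f p (μ.restrict (⋃ i, Q i)) ≤ B * (ENNReal.ofReal (2 / v) ^ ((1 / p).toReal) *
      eLpNorm f p (μ.restrict (S ∩ ⋃ i, Q i)) + eLpNorm R p (μ.restrict (⋃ i, Q i))) := by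
  have hQU : MeasurableSet (⋃ i, Q i) := MeasurableSet.iUnion hQm
  suffices H : ∃ τ : X → ENNReal, Measurable τ ∧ (∀ z ∈ ⋃ i, Q i, ‖f z‖ₑ ≤ B * (τ z + R z)) ∧
      eLpNorm τ p (μ.restrict (⋃ i, Q i)) ≤ ENNReal.ofReal (2 / v) ^ ((1 / p).toReal) *
        eLpNorm f p (μ.restrict (S ∩ ⋃ i, Q i)) by
    obtain ⟨τ, hτ, h1, h2⟩ := H
    calc eLpNorm f p (μ.restrict (⋃ i, Q i))
        ≤ eLpNorm (fun z => B * (τ z + R z)) p (μ.restrict (⋃ i, Q i)) := by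
          refine eLpNorm_mono_enorm_ae ?_
          filter_upwards [ae_restrict_mem hQU] with z hz
          rw [enorm_eq_self]; exact h1 z hz
      _ ≤ B * eLpNorm (fun z => τ z + R z) p (μ.restrict (⋃ i, Q i)) := by
          have := eLpNorm_le_nnreal_smul_eLpNorm_of_ae_le_mul' (c := B.toNNReal)
            (f := fun z => B * (τ z + R z)) (g := fun z => τ z + R z)
            (μ := μ.restrict (⋃ i, Q i)) (Filter.Eventually.of_forall fun z => by
              rw [enorm_eq_self, enorm_eq_self, ENNReal.coe_toNNReal hB]) p
          rwa [ENNReal.smul_def, ENNReal.coe_toNNReal hB] at this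
      _ ≤ B * (eLpNorm τ p (μ.restrict (⋃ i, Q i)) + eLpNorm R p (μ.restrict (⋃ i, Q i))) :=
          mul_le_mul_right (eLpNorm_add_le hτ.aestronglyMeasurable hR.aestronglyMeasurable hp) B
      _ ≤ _ := mul_le_mul_right (add_le_add_left h2 _) B
  have hG : ∀ i, MeasurableSet (S ∩ Q i) := fun i => hS.inter (hQm i)
  have hG0 : ∀ i, μ (S ∩ Q i) ≠ 0 := fun i h0 => by
    have := hvQ i
    rw [h0, nonpos_iff_eq_zero, mul_eq_zero] at this
    rcases this with h1 | h1
    · exact (ENNReal.ofReal_pos.2 hv).ne' h1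
    · exact hQ0 i h1
  have hGt : ∀ i, μ (S ∩ Q i) ≠ ⊤ := fun i =>
    ne_top_of_le_ne_top (hQfin i) (measure_mono Set.inter_subset_right)
  have hvhalf : ∀ i, ENNReal.ofReal (v / 2) * μ (Q i) ≤ μ (S ∩ Q i) / 2 := fun i => by
    rw [ENNReal.ofReal_div_of_pos two_pos, ENNReal.ofReal_ofNat, ENNReal.mul_div_right_comm.symm]
    exact ENNReal.div_le_div_right (hvQ i) 2
  rcases eq_or_ne p ⊤ with rfl | hpt
  · refine ⟨fun _ => eLpNorm f ⊤ (μ.restrict (S ∩ ⋃ i, Q i)), measurable_const, ?_, ?_⟩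
    · intro z hz
      obtain ⟨i, hi⟩ := Set.mem_iUnion.1 hz
      set τ := eLpNorm f ⊤ (μ.restrict (S ∩ ⋃ i, Q i)) with hτ
      refine h i ((S ∩ Q i) ∩ {x | ‖f x‖ₑ ≤ τ}) (fun x hx => hx.1.2)
        ((hG i).inter (measurableSet_le hf.enorm measurable_const)) ?_ τ (fun x hx => hx.2) z hi
      have h1 : ∀ᵐ x ∂(μ.restrict (S ∩ Q i)), ‖f x‖ₑ ≤ τ := by
        refine ae_restrict_of_ae_restrict_of_subset
          (Set.inter_subset_inter_right S (Set.subset_iUnion Q i)) ?_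
        rw [hτ, eLpNorm_exponent_top]
        exact ae_le_eLpNormEssSup
      have h2 : μ ((S ∩ Q i) ∩ {x | ‖f x‖ₑ ≤ τ}) = μ (S ∩ Q i) := by
        refine measure_congr ?_
        rw [ae_restrict_iff' (hG i)] at h1
        filter_upwards [h1] with x hx
        exact propext ⟨fun hy => hy.1, fun hy => ⟨hy, hx hy⟩⟩
      rw [h2]
      exact (hvhalf i).trans ENNReal.half_le_self
    · simp only [ENNReal.div_top, ENNReal.toReal_zero, ENNReal.rpow_zero, one_mul]
      rw [eLpNorm_exponent_top]
      refine eLpNormEssSup_le_of_ae_enorm_bound (Filter.Eventually.of_forall fun x => ?_)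
      rw [enorm_eq_self]
  · have hp0 : p ≠ 0 := (lt_of_lt_of_le one_pos hp).ne'
    set r := p.toReal with hr
    have hr0 : 0 < r := ENNReal.toReal_pos hp0 hpt
    set I : ι → ENNReal := fun i => ∫⁻ x in S ∩ Q i, ‖f x‖ₑ ^ r ∂μ with hI
    have hIt : ∀ i, I i ≠ ⊤ := fun i => by
      refine (setLIntegral_lt_top_of_le_nnreal (hGt i)
        ⟨(ENNReal.ofReal M ^ r).toNNReal, fun x _ => ?_⟩).ne
      rw [ENNReal.coe_toNNReal (ENNReal.rpow_ne_top_of_nonneg hr0.le ENNReal.ofReal_ne_top),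
        ← ofReal_norm]
      exact ENNReal.rpow_le_rpow (ENNReal.ofReal_le_ofReal (hM x)) hr0.le
    have hmeas : Measurable fun x => ‖f x‖ₑ ^ r := hf.enorm.pow_const r
    set τ : ι → ENNReal := fun i => (2 / μ (S ∩ Q i) * I i) ^ (1 / r) with hτ
    have hτr : ∀ i, τ i ^ r = 2 / μ (S ∩ Q i) * I i := fun i => by
      rw [hτ, ← ENNReal.rpow_mul, one_div_mul_cancel hr0.ne', ENNReal.rpow_one]
    refine ⟨fun z => ∑ i, (Q i).indicator (fun _ => τ i) z, ?_, ?_, ?_⟩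
    · exact Finset.measurable_fun_sum _ fun i _ => measurable_const.indicator (hQm i)
    · intro z hz
      obtain ⟨i, hi⟩ := Set.mem_iUnion.1 hz
      have h1 : τ i ≤ ∑ i, (Q i).indicator (fun _ => τ i) z := by
        refine le_trans (le_of_eq ?_)
          (Finset.single_le_sum (fun _ _ => zero_le) (Finset.mem_univ i))
        rw [Set.indicator_of_mem hi]
      refine (h i ((S ∩ Q i) ∩ {x | ‖f x‖ₑ ^ r ≤ 2 / μ (S ∩ Q i) * I i}) (fun x hx => hx.1.2)
        ((hG i).inter (measurableSet_le hmeas measurable_const))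
        ((hvhalf i).trans (half_measure_le (hG0 i) (hGt i) hmeas (hIt i))) (τ i)
        (fun x hx => ?_) z hi).trans (mul_le_mul_right (add_le_add_left h1 _) _)
      have h2 : ‖f x‖ₑ ^ r ≤ 2 / μ (S ∩ Q i) * I i := hx.2
      rwa [← hτr, ENNReal.rpow_le_rpow_iff hr0] at h2
    · rw [eLpNorm_eq_lintegral_rpow_enorm_toReal hp0 hpt, eLpNorm_eq_lintegral_rpow_enorm_toReal hp0 hpt]
      have hp1 : (1 / p).toReal = 1 / p.toReal := by simp
      rw [hp1, ← hr, ← ENNReal.mul_rpow_of_nonneg _ _ (by positivity)]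
      refine ENNReal.rpow_le_rpow ?_ (by positivity)
      have hdis : Pairwise (Function.onFun Disjoint fun i => S ∩ Q i) := fun i j hij =>
        (hQd hij).mono Set.inter_subset_right Set.inter_subset_right
      rw [Set.inter_iUnion, lintegral_iUnion hG hdis, lintegral_iUnion hQm hQd, tsum_fintype,
        tsum_fintype, Finset.mul_sum]
      refine Finset.sum_le_sum fun i _ => ?_
      have h3 : ∫⁻ x in Q i, ‖∑ i, (Q i).indicator (fun _ => τ i) x‖ₑ ^ r ∂μ =
          ∫⁻ x in Q i, 2 / μ (S ∩ Q i) * I i ∂μ := by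
        refine setLIntegral_congr_fun (hQm i) fun x hx => ?_
        rw [← hτr, enorm_eq_self]
        refine congrArg (· ^ r) ?_
        rw [Finset.sum_eq_single i, Set.indicator_of_mem hx]
        · intro j _ hj
          exact Set.indicator_of_notMem (fun hx' => Set.disjoint_left.1 (hQd hj) hx' hx) _
        · intro hi; exact absurd (Finset.mem_univ i) hi
      rw [h3, setLIntegral_const, mul_right_comm]
      refine mul_le_mul_left ?_ (I i)
      rw [ENNReal.mul_div_right_comm.symm]
      refine ENNReal.div_le_of_le_mul ?_
      calc 2 * μ (Q i) = ENNReal.ofReal (2 / v) * (ENNReal.ofReal v * μ (Q i)) := by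
            rw [← mul_assoc, ← ENNReal.ofReal_mul (by positivity), div_mul_cancel₀ _ hv.ne',
              ENNReal.ofReal_ofNat]
        _ ≤ _ := mul_le_mul_right (hvQ i) _

lemma norm_trigPoly_le {d : ℕ} (L : ℝ) (T : Finset (Fin d → ℤ)) (F : (Fin d → ℤ) → ℂ)
    (x : Fin d → ℝ) : ‖trigPoly L T F x‖ ≤ ∑ k ∈ T, ‖F k‖ := by
  refine (norm_sum_le _ _).trans (Finset.sum_le_sum fun k _ => ?_)
  rw [norm_mul, mul_comm Complex.I, Complex.norm_exp_ofReal_mul_I, mul_one]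

lemma eLpNorm_trigPoly_torusCube_ne_top {d : ℕ} (L : ℝ) (T : Finset (Fin d → ℤ))
    (F : (Fin d → ℤ) → ℂ) (p : ENNReal) :
    eLpNorm (trigPoly L T F) p (volume.restrict (torusCube d L)) ≠ ⊤ := by
  have : IsFiniteMeasure ((volume : Measure (Fin d → ℝ)).restrict (torusCube d L)) := by
    refine isFiniteMeasure_restrict.2 ?_
    exact (isCompact_univ_pi fun _ => isCompact_Icc).measure_lt_top.ne
  exact (MemLp.of_bound (continuous_trigPoly L T F).aestronglyMeasurable _
    (Filter.Eventually.of_forall (norm_trigPoly_le L T F))).eLpNorm_ne_top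

lemma eLpNorm_trigPoly_le_add {d n m : ℕ} (hm : 0 < m) {L : ℝ} (hL : 0 < L) {p : ENNReal} (hp : 1 ≤ p)
    {b a : Fin d → ℝ} (hb : ∀ j, 0 < b j) (ha : ∀ j, 0 < a j ∧ a j ≤ 2 * π * L)
    {γ : ℝ} (hγ : 0 < γ) {S : Set (Fin d → ℝ)} (hSm : MeasurableSet S)
    (hS : ∀ x : Fin d → ℝ, volume (S ∩ Set.univ.pi fun i => Set.Icc (x i) (x i + a i)) ≥
      ENNReal.ofReal (γ * ∏ i, a i))
    {lam : Fin n → Fin d → ℝ} {T : Finset (Fin d → ℤ)} (hT0 : T.Nonempty) (F : (Fin d → ℤ) → ℂ)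
    (hT : ∀ k ∈ T, ∃ l : Fin n, ∀ j,
      (k j : ℝ) / L ∈ Set.Icc (lam l j - b j / 2) (lam l j + b j / 2)) :
    ∃ κ N : ℕ, κ ≤ n ∧ κ * m = N + 1 ∧
      eLpNorm (trigPoly L T F) p (volume.restrict (torusCube d L)) ≤
        ENNReal.ofReal ((7800 * exp 16 * 4 ^ d / γ) ^ N) *
          (ENNReal.ofReal (2 * 2 ^ d / γ) ^ ((1 / p).toReal) *
            eLpNorm (trigPoly L T F) p (volume.restrict (S ∩ torusCube d L)) +
          ENNReal.ofReal (κ * 3 ^ d * ((4 ^ n * ∑ j, a j * b j) ^ m / m.factorial *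
            exp (4 ^ n * ∑ j, a j * b j))) *
            eLpNorm (trigPoly L T F) p (volume.restrict (torusCube d L))) := by
  obtain ⟨Cs, N₀, Tc, hCs0, hCsn, hN₀, hcl, hsplit⟩ := exists_clusters hL hb hT0 hT
  obtain ⟨ι, _, Q, hQm, hQc, hQ0, hQfin, hQd, hQU, hQA, hQv⟩ := exists_cells hL ha hγ hS
  have hκ : 0 < Cs.card := Finset.card_pos.2 hCs0
  have hn : 1 ≤ n := hκ.trans_le hCsn
  obtain ⟨N, hN⟩ : ∃ N, Cs.card * m = N + 1 := Nat.exists_eq_succ_of_ne_zero (Nat.mul_pos hκ hm).ne'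
  refine ⟨Cs.card, N, hCsn, hN, ?_⟩
  have hv : 0 < γ / 2 ^ d := by positivity
  have h1 := eLpNorm_le_of_cells hp hSm hQm hQ0 hQfin hQd hv hQv
    (continuous_trigPoly L T F).measurable (norm_trigPoly_le L T F)
    (measurable_taylorMajorant L m (fun j => 2 * a j) Cs Tc F)
    (B := ENNReal.ofReal ((3900 * exp 16 * 2 ^ d / (γ / 2 ^ d / 2)) ^ N))
    (fun i E hEQ hE hvE τ hτ z hz => enorm_trigPoly_le_of_cell hL hm hN hsplit F (hQm i) (hQc i)
      (hQ0 i) (hQfin i) hE hEQ (by positivity) hvE (hQA i) hτ hz) ENNReal.ofReal_ne_top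
  have h2 := eLpNorm_taylorMajorant_le hL hp m (A := fun j => 2 * a j)
    (fun j => by have := (ha j).1; positivity) hcl F (Z := 4 ^ n * ∑ j, a j * b j) (by
      rw [Finset.mul_sum]
      refine Finset.sum_le_sum fun j _ => ?_
      have h4 : (4 : ℝ) ^ n = 4 * 4 ^ (n - 1) := by rw [← pow_succ', Nat.sub_add_cancel hn]
      have h5 := mul_le_mul_of_nonneg_left (hN₀ j) (show 0 ≤ 2 * a j / L * 2 from
        mul_nonneg (div_nonneg (by linarith [(ha j).1]) hL.le) two_pos.le)
      refine le_trans (le_of_eq (by ring)) (h5.trans (le_of_eq ?_))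
      rw [h4]; field_simp; ring)
  rw [hQU, Measure.restrict_congr_set (torusCube_ae_eq_Ico d L), Measure.restrict_congr_set
    ((Filter.EventuallyEq.refl _ S).inter (torusCube_ae_eq_Ico d L))] at h1
  have e1 : 3900 * exp 16 * 2 ^ d / (γ / 2 ^ d / 2) = 7800 * exp 16 * 4 ^ d / γ := by
    rw [show (4 : ℝ) = 2 * 2 by norm_num, mul_pow]; field_simp; ring
  have e2 : 2 / (γ / 2 ^ d) = 2 * 2 ^ d / γ := by field_simp
  rw [e1, e2] at h1
  exact h1.trans (mul_le_mul_right (add_le_add_right h2 _) _)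

lemma exists_taylor_order {n : ℕ} (hn : 1 ≤ n) {G D W : ℝ} (hG : 1 ≤ G) (hD : 0 ≤ D) (hDG : D ≤ G)
    (hW : 0 < W) : ∃ m : ℕ, 0 < m ∧ (m : ℝ) ≤ 1 + (128 * G) ^ n * W ∧
      ∀ κ N : ℕ, κ ≤ n → κ * m = N + 1 →
        G ^ N * (κ * D * ((4 ^ n * W) ^ m / m.factorial * exp (4 ^ n * W))) ≤
          1 - exp (-((128 * G) ^ n * W)) := by
  set Y := (128 * G) ^ n * W with hY
  have hY0 : 0 < Y := by positivity
  set X := Y / 32 ^ n with hX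
  have hX0 : 0 < X := by positivity
  have hXG : G ^ n * (4 ^ n * W) = X := by
    rw [hX, hY, eq_div_iff (by positivity), mul_pow, show (128 : ℝ) = 4 * 32 by norm_num, mul_pow]
    ring
  have hZX : 4 ^ n * W ≤ X := by
    rw [← hXG]; exact le_mul_of_one_le_left (by positivity) (one_le_pow₀ hG)
  have hn2 : (n : ℝ) ≤ 2 ^ n := by exact_mod_cast Nat.lt_two_pow_self.le
  have hn16 : (n : ℝ) / 32 ^ n ≤ 1 / 16 := by
    have h16 : (16 : ℝ) ≤ 16 ^ n := le_self_pow₀ (by norm_num) (by omega)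
    rw [div_le_div_iff₀ (by positivity) (by norm_num), one_mul,
      show (32 : ℝ) = 2 * 16 by norm_num, mul_pow]
    exact mul_le_mul hn2 h16 (by norm_num) (by positivity)
  refine ⟨⌊Y⌋₊ + 1, Nat.succ_pos _, ?_, ?_⟩
  · push_cast; linarith [Nat.floor_le hY0.le]
  intro κ N hκ hN
  set m := ⌊Y⌋₊ + 1 with hm
  have hYm : Y < m := by rw [hm]; push_cast; exact Nat.lt_floor_add_one Y
  have hstep : G ^ N * (κ * D * ((4 ^ n * W) ^ m / m.factorial * exp (4 ^ n * W))) ≤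
      n * (X ^ m / m.factorial * exp X) := by
    have h1 : G ^ N * D ≤ (G ^ n) ^ m := by
      rw [← pow_mul]
      calc G ^ N * D ≤ G ^ N * G := mul_le_mul_of_nonneg_left hDG (by positivity)
        _ = G ^ (N + 1) := (pow_succ _ _).symm
        _ ≤ G ^ (n * m) := pow_le_pow_right₀ hG (hN ▸ Nat.mul_le_mul_right m hκ)
    calc G ^ N * (κ * D * ((4 ^ n * W) ^ m / m.factorial * exp (4 ^ n * W)))
        = κ * ((G ^ N * D) * ((4 ^ n * W) ^ m / m.factorial * exp (4 ^ n * W))) := by ring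
      _ ≤ n * ((G ^ n) ^ m * ((4 ^ n * W) ^ m / m.factorial * exp X)) := by
          refine mul_le_mul (by exact_mod_cast hκ) ?_ (by positivity) (by positivity)
          refine mul_le_mul h1 ?_ (by positivity) (by positivity)
          exact mul_le_mul_of_nonneg_left (exp_le_exp.2 hZX) (by positivity)
      _ = n * (X ^ m / m.factorial * exp X) := by rw [← hXG]; ring
  refine hstep.trans ?_
  rcases lt_or_ge Y 1 with h | h
  · have hm1 : m = 1 := by rw [hm, Nat.floor_eq_zero.2 h]
    rw [hm1, pow_one, Nat.factorial_one, Nat.cast_one, div_one]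
    have hX1 : X ≤ 1 := (div_le_self hY0.le (one_le_pow₀ (by norm_num))).trans h.le
    have hexp : exp X ≤ 3 := (exp_le_exp.2 hX1).trans (by linarith [exp_one_lt_d9])
    have h1 : n * (X * exp X) ≤ Y / 2 := by
      calc n * (X * exp X) ≤ n * (X * 3) := by gcongr
        _ = 3 * Y * (n / 32 ^ n) := by rw [hX]; ring
        _ ≤ 3 * Y * (1 / 16) := mul_le_mul_of_nonneg_left hn16 (by positivity)
        _ ≤ Y / 2 := by linarith
    have h2 : exp (-Y) ≤ 1 - Y / 2 := by
      rw [exp_neg, inv_le_comm₀ (exp_pos _) (by linarith), inv_le_iff_one_le_mul₀ (by linarith)]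
      have := add_one_le_exp Y
      nlinarith
    linarith
  · have hmpos : 0 < m := Nat.succ_pos _
    have hXm : X ≤ m / 32 ^ n := div_le_div_of_nonneg_right hYm.le (by positivity)
    have hXm' : X ≤ m := hXm.trans (div_le_self (by positivity) (one_le_pow₀ (by norm_num)))
    have he2 : exp 1 * exp 1 ≤ 8 := by
      have := exp_one_lt_d9
      have := exp_pos 1
      nlinarith
    have h1 : n * (X ^ m / m.factorial * exp X) ≤ 1 / 2 := by
      calc n * (X ^ m / m.factorial * exp X)
          ≤ n * ((m / 32 ^ n) ^ m / m.factorial * exp m) := by gcongr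
        _ = n * ((m : ℝ) ^ m / m.factorial * exp m / (32 ^ n) ^ m) := by rw [div_pow]; ring
        _ ≤ n * (exp m * exp m / (32 ^ n) ^ m) := by
            refine mul_le_mul_of_nonneg_left (div_le_div_of_nonneg_right (mul_le_mul_of_nonneg_right
              (pow_div_factorial_le_exp _ (by positivity) _) (exp_pos _).le) (by positivity))
              (by positivity)
        _ = n * (exp 1 * exp 1 / 32 ^ n) ^ m := by
            rw [div_pow, mul_pow, ← exp_nat_mul, mul_one]
        _ ≤ n * (8 / 32 ^ n) ^ m := by gcongr
        _ ≤ n * (8 / 32 ^ n) := by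
            refine mul_le_mul_of_nonneg_left (pow_le_of_le_one (by positivity) ?_ hmpos.ne')
              (by positivity)
            rw [div_le_one (by positivity)]
            exact le_trans (by norm_num) (le_self_pow₀ (a := (32 : ℝ)) (by norm_num) (by omega))
        _ = 8 * (n / 32 ^ n) := by ring
        _ ≤ 1 / 2 := by linarith
    have h2 : exp (-Y) ≤ 1 / 2 := by
      rw [exp_neg, one_div]
      exact inv_anti₀ two_pos (by linarith [add_one_le_exp Y])
    linarith

lemma le_of_le_add_ofReal_mul {x u : ENNReal} {q : ℝ} (hq0 : 0 < q) (hq1 : q ≤ 1) (hx : x ≠ ⊤)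
    (h : x ≤ u + ENNReal.ofReal (1 - q) * x) : x ≤ ENNReal.ofReal q⁻¹ * u := by
  have h1 : ENNReal.ofReal q * x + ENNReal.ofReal (1 - q) * x = x := by
    rw [← add_mul, ← ENNReal.ofReal_add hq0.le (by linarith), add_sub_cancel, ENNReal.ofReal_one,
      one_mul]
  have h2 : ENNReal.ofReal q * x ≤ u :=
    (ENNReal.add_le_add_iff_right (ENNReal.mul_ne_top ENNReal.ofReal_ne_top hx)).1 (h1.le.trans h)
  calc x = ENNReal.ofReal q⁻¹ * (ENNReal.ofReal q * x) := by
        rw [← mul_assoc, ← ENNReal.ofReal_mul (by positivity), inv_mul_cancel₀ hq0.ne',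
          ENNReal.ofReal_one, one_mul]
    _ ≤ _ := mul_le_mul_right h2 _

lemma exp_mul_pow_mul_rpow_le {d n m N κ : ℕ} (hd : 1 ≤ d) {c γ W t : ℝ} (hc : exp 1 ≤ c)
    (hγ : 0 < γ) (hγ1 : γ ≤ 1) (hW : 0 ≤ W) (hκ : κ ≤ n) (hN : κ * m = N + 1)
    (hm : (m : ℝ) ≤ 1 + (128 * (c ^ d / γ)) ^ n * W) (ht : 0 ≤ t) :
    exp ((128 * (c ^ d / γ)) ^ n * W) * (c ^ d / γ) ^ N * (c ^ d / γ) ^ t ≤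
      ((256 * c) ^ d / γ) ^ (((256 * c) ^ d / γ) ^ n * W + n - (1 - t)) := by
  have hc0 : 0 < c := (exp_pos 1).trans_le hc
  have hc1 : 1 ≤ c := (one_le_exp zero_le_one).trans hc
  set G := c ^ d / γ with hG
  have hcG : c ≤ G := by
    rw [hG, le_div_iff₀ hγ]
    exact (mul_le_of_le_one_right hc0.le hγ1).trans (le_self_pow₀ hc1 (by omega))
  have hG0 : 0 < G := hc0.trans_le hcG
  have hG1 : 1 ≤ G := hc1.trans hcG
  have hGG : 256 * G ≤ (256 * c) ^ d / γ := by
    rw [hG, mul_pow, mul_div_assoc]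
    exact mul_le_mul_of_nonneg_right (le_self_pow₀ (by norm_num) (by omega)) hG0.le
  set Y := (128 * G) ^ n * W with hY
  have hY0 : 0 ≤ Y := by positivity
  have hn2 : (n : ℝ) + 1 ≤ 2 ^ n := by exact_mod_cast Nat.lt_two_pow_self
  have hYn : (n + 1) * Y ≤ ((256 * c) ^ d / γ) ^ n * W := by
    calc (n + 1) * Y ≤ 2 ^ n * Y := mul_le_mul_of_nonneg_right hn2 hY0
      _ = (256 * G) ^ n * W := by
          rw [hY, ← mul_assoc, ← mul_pow]; norm_num [← mul_assoc]
      _ ≤ _ := mul_le_mul_of_nonneg_right (pow_le_pow_left₀ (by positivity) hGG n) hW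
  have hNm : (N : ℝ) + 1 ≤ n + n * Y := by
    have h1 : ((N + 1 : ℕ) : ℝ) = κ * m := by rw [← hN]; push_cast; ring
    push_cast at h1
    have h2 : (κ : ℝ) ≤ n := by exact_mod_cast hκ
    calc (N : ℝ) + 1 = κ * m := h1
      _ ≤ n * (1 + Y) := mul_le_mul h2 hm (by positivity) (by positivity)
      _ = n + n * Y := by ring
  have hexp : exp Y ≤ G ^ Y := by
    rw [← mul_one Y, mul_comm, exp_mul, mul_comm, mul_one]
    exact rpow_le_rpow (exp_pos 1).le (hc.trans hcG) hY0
  calc exp Y * G ^ N * G ^ t ≤ G ^ Y * G ^ (N : ℝ) * G ^ t := by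
        rw [rpow_natCast]; gcongr
    _ = G ^ (Y + N + t) := by rw [rpow_add hG0, rpow_add hG0]
    _ ≤ G ^ (((256 * c) ^ d / γ) ^ n * W + n - (1 - t)) :=
        rpow_le_rpow_of_exponent_le hG1 (by linarith)
    _ ≤ _ := by
        refine rpow_le_rpow hG0.le (le_trans (by linarith) hGG) ?_
        have : (0 : ℝ) ≤ N := Nat.cast_nonneg N
        linarith [mul_nonneg (Nat.cast_nonneg (α := ℝ) n) hY0]

/-- Logvinenko–Sereda theorem on the torus, finitely many parallelepipeds: there is a
universal constant `c̃ ≥ 3` such that for `f ∈ L^p(T^d_L)`, `p ∈ [1,∞]`, with Fourier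
coefficients supported in `J_1 ∪ … ∪ J_n`, each `J_l` an axis-parallel parallelepiped with
sides `b_1,…,b_d`, and any `(γ,a)`-thick set `S` with `a_j ≤ 2πL`,
`‖f‖_{L^p(T^d_L)} ≤ (c̃^d/γ)^{(c̃^d/γ)^n a·b + n - (p-1)/p} ‖f‖_{L^p(S ∩ T^d_L)}`. -/
theorem stmt_13 :
    ∃ c : ℝ, 3 ≤ c ∧
      ∀ (d n : ℕ), 1 ≤ d → 1 ≤ n → ∀ L : ℝ, 0 < L → ∀ p : ENNReal, 1 ≤ p →
        ∀ b a : Fin d → ℝ, (∀ j, 0 < b j) → (∀ j, 0 < a j ∧ a j ≤ 2 * π * L) →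
          ∀ γ : ℝ, 0 < γ → γ ≤ 1 →
            ∀ S : Set (Fin d → ℝ), MeasurableSet S →
              (∀ x : Fin d → ℝ,
                volume (S ∩ Set.univ.pi fun i => Set.Icc (x i) (x i + a i)) ≥
                  ENNReal.ofReal (γ * ∏ i, a i)) →
              ∀ (lam : Fin n → Fin d → ℝ) (T : Finset (Fin d → ℤ)) (F : (Fin d → ℤ) → ℂ),
                (∀ k ∈ T, ∃ l : Fin n, ∀ j,
                  (k j : ℝ) / L ∈ Set.Icc (lam l j - b j / 2) (lam l j + b j / 2)) →
                eLpNorm (trigPoly L T F) p (volume.restrict (torusCube d L)) ≤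
                  ENNReal.ofReal ((c ^ d / γ) ^
                      ((c ^ d / γ) ^ n * (∑ j, a j * b j) + n -
                        ((1 : ENNReal) - 1 / p).toReal)) *
                    eLpNorm (trigPoly L T F) p (volume.restrict (S ∩ torusCube d L)) := by
  set c₀ : ℝ := 7800 * exp 16 * 4 with hc₀
  have he16 : exp 1 ≤ exp 16 := exp_le_exp.2 (by norm_num)
  have h1e : (1 : ℝ) ≤ exp 16 := one_le_exp (by norm_num)
  refine ⟨256 * c₀, by linarith, ?_⟩
  intro d n hd hn L hL p hp b a hb ha γ hγ hγ1 S hSm hS lam T F hT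
  rcases T.eq_empty_or_nonempty with rfl | hT0
  · have h0 : trigPoly L ∅ F = 0 := by ext x; simp [trigPoly]
    rw [h0, eLpNorm_zero]; exact zero_le
  set W := ∑ j, a j * b j with hW
  have hW0 : 0 < W := Finset.sum_pos (fun j _ => mul_pos (ha j).1 (hb j)) ⟨⟨0, hd⟩, Finset.mem_univ _⟩
  set G := c₀ ^ d / γ with hG
  have hbase : 7800 * exp 16 * 4 ^ d / γ ≤ G := by
    rw [hG, hc₀, mul_pow]
    refine div_le_div_of_nonneg_right (mul_le_mul_of_nonneg_right ?_ (by positivity)) hγ.le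
    exact le_self_pow₀ (by linarith) (by omega)
  have hdiv : (4 : ℝ) ^ d ≤ 4 ^ d / γ := le_div_self (by positivity) hγ hγ1
  have h4G : 7800 * (4 ^ d / γ) ≤ G := by
    refine le_trans ?_ hbase
    rw [mul_div_assoc]
    exact mul_le_mul_of_nonneg_right (by linarith) (by positivity)
  have h41 : (1 : ℝ) ≤ 4 ^ d := one_le_pow₀ (by norm_num)
  have h24 : 2 * 2 ^ d / γ ≤ G := by
    have : (2 : ℝ) ^ d / γ ≤ 4 ^ d / γ :=
      div_le_div_of_nonneg_right (pow_le_pow_left₀ two_pos.le (by norm_num) d) hγ.le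
    rw [mul_div_assoc]; linarith
  have h34 : (3 : ℝ) ^ d ≤ G := by
    have : (3 : ℝ) ^ d ≤ 4 ^ d := pow_le_pow_left₀ (by norm_num) (by norm_num) d
    linarith
  have hG1 : 1 ≤ G := by linarith
  have hG0 : 0 < G := by linarith
  obtain ⟨m, hm0, hm, hmain⟩ := exists_taylor_order hn hG1 (by positivity) h34 hW0
  obtain ⟨κ, N, hκ, hN, hadd⟩ := eLpNorm_trigPoly_le_add hm0 hL hp hb ha hγ hSm hS hT0 F hT
  set t := (1 / p).toReal with ht
  have ht0 : 0 ≤ t := ENNReal.toReal_nonneg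
  have hexpnt : ((1 : ENNReal) - 1 / p).toReal = 1 - t := by
    rw [ENNReal.toReal_sub_of_le (by rw [one_div]; exact ENNReal.inv_le_one.2 hp) ENNReal.one_ne_top,
      ENNReal.toReal_one]
  have hfin := eLpNorm_trigPoly_torusCube_ne_top L T F p
  set x := eLpNorm (trigPoly L T F) p (volume.restrict (torusCube d L))
  set y := eLpNorm (trigPoly L T F) p (volume.restrict (S ∩ torusCube d L))
  set Y := (128 * G) ^ n * W with hY
  have hstep : x ≤ ENNReal.ofReal (G ^ N * G ^ t) * y + ENNReal.ofReal (1 - exp (-Y)) * x := by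
    refine hadd.trans ?_
    rw [mul_add, ← mul_assoc, ← mul_assoc, ENNReal.ofReal_rpow_of_nonneg (by positivity) ht0,
      ← ENNReal.ofReal_mul (by positivity), ← ENNReal.ofReal_mul (by positivity)]
    refine add_le_add (mul_le_mul_left (ENNReal.ofReal_le_ofReal ?_) _)
      (mul_le_mul_left (ENNReal.ofReal_le_ofReal (le_trans ?_ (hmain κ N hκ hN))) _)
    · exact mul_le_mul (pow_le_pow_left₀ (by positivity) hbase N)
        (rpow_le_rpow (by positivity) h24 ht0) (by positivity) (by positivity)
    · exact mul_le_mul_of_nonneg_right (pow_le_pow_left₀ (by positivity) hbase N) (by positivity)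
  have hx := le_of_le_add_ofReal_mul (exp_pos _) (exp_le_one_iff.2 (by
    rw [Left.neg_nonpos_iff]; positivity)) hfin hstep
  rw [← mul_assoc, ← ENNReal.ofReal_mul (by positivity), exp_neg, inv_inv, ← mul_assoc] at hx
  refine hx.trans (mul_le_mul_left (ENNReal.ofReal_le_ofReal ?_) _)
  rw [hexpnt]
  exact exp_mul_pow_mul_rpow_le hd (by linarith) hγ hγ1 hW0.le hκ hN hm ht0
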